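/- Let G be a finite group. If the average of the degrees of the irreducible complex characters of G is strictly less than 16/5, then G is solvable. -/

import Mathlib

open CategoryTheory

/-- The set of irreducible complex characters of `G`: characters of simple
finite-dimensional complex representations of `G`. -/
noncomputable def IrrChar (G : Type) [Group G] : Set (G → ℂ) :=
  {χ | ∃ V : FDRep ℂ G, Simple V ∧ χ = fun g => V.character g}

/-- The degree of a character, read off from its value at `1`. -/
noncomputable def charDeg {G : Type} [Group G] (χ : G → ℂ) : ℕ :=
  ⌊(χ 1).re⌋₊

/-- The average degree of the irreducible characters of `G` satisfying a
predicate `p` (with the convention that the average of the empty set is `0`). -/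
noncomputable def acdRel (G : Type) [Group G] (p : (G → ℂ) → Prop) : ℝ :=
  (∑ᶠ χ ∈ {χ ∈ IrrChar G | p χ}, (charDeg χ : ℝ)) /
    ({χ ∈ IrrChar G | p χ} : Set (G → ℂ)).ncard

/-- The average character degree of `G`. -/
noncomputable def acd (G : Type) [Group G] : ℝ := acdRel G fun _ => True

set_option linter.unusedSectionVars false
set_option linter.unusedFintypeInType false
set_option linter.unusedDecidableInType false

namespace ACD

/-! ### Averages -/

section Avg

variable {G : Type} [Finite G] {A B : Type*} [AddCommGroup A] [Module ℂ A]
  [AddCommGroup B] [Module ℂ B]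

/-- Average of a function over a finite type. -/
noncomputable def avg (f : G → A) : A := (Nat.card G : ℂ)⁻¹ • ∑ᶠ g, f g

theorem avg_eq [Fintype G] (f : G → A) : avg f = (Nat.card G : ℂ)⁻¹ • ∑ g, f g := by
  rw [avg, finsum_eq_sum_of_fintype]

theorem avg_add (f h : G → A) : avg (fun g => f g + h g) = avg f + avg h := by
  cases nonempty_fintype G
  simp [avg_eq, Finset.sum_add_distrib]

theorem avg_sub (f h : G → A) : avg (fun g => f g - h g) = avg f - avg h := by
  cases nonempty_fintype G
  simp [avg_eq, Finset.sum_sub_distrib, smul_sub]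

theorem avg_map (L : A →ₗ[ℂ] B) (f : G → A) : L (avg f) = avg (fun g => L (f g)) := by
  cases nonempty_fintype G
  simp [avg_eq]

theorem avg_smul (c : ℂ) (f : G → A) : avg (fun g => c • f g) = c • avg f :=
  (avg_map (LinearMap.lsmul ℂ A c) f).symm

theorem avg_zero : avg (fun _ : G => (0 : A)) = 0 := by
  cases nonempty_fintype G
  simp [avg_eq]

theorem avg_finset_sum {ι : Type*} (s : Finset ι) (f : ι → G → A) :
    avg (fun g => ∑ i ∈ s, f i g) = ∑ i ∈ s, avg (f i) := by
  cases nonempty_fintype G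
  simp only [avg_eq]
  rw [Finset.sum_comm, Finset.smul_sum]

theorem avg_const [Nonempty G] (a : A) : avg (fun _ : G => a) = a := by
  cases nonempty_fintype G
  have : (Fintype.card G : ℂ) ≠ 0 := by simp
  rw [avg_eq]
  simp only [Nat.card_eq_fintype_card, Finset.sum_const, Finset.card_univ]
  rw [← Nat.cast_smul_eq_nsmul ℂ, smul_smul, inv_mul_cancel₀ this, one_smul]

theorem avg_equiv {H : Type} [Finite H] (e : G ≃ H) (f : H → A) :
    avg (fun g => f (e g)) = avg f := by
  cases nonempty_fintype G
  cases nonempty_fintype H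
  rw [avg_eq, avg_eq, Nat.card_congr e, e.sum_comp]

theorem avg_comm {H : Type} [Finite H] (f : G → H → A) :
    avg (fun g => avg (f g)) = avg (fun h => avg (fun g => f g h)) := by
  cases nonempty_fintype G
  cases nonempty_fintype H
  simp only [avg_eq]
  rw [← Finset.smul_sum, ← Finset.smul_sum, Finset.sum_comm, smul_comm]

end Avg

section AvgGroup

variable {G : Type} [Group G] [Finite G] {A : Type*} [AddCommGroup A] [Module ℂ A]

theorem avg_mul_left (f : G → A) (h : G) : avg (fun g => f (h * g)) = avg f :=
  avg_equiv (Equiv.mulLeft h) f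

theorem avg_mul_right (f : G → A) (h : G) : avg (fun g => f (g * h)) = avg f :=
  avg_equiv (Equiv.mulRight h) f

theorem avg_inv (f : G → A) : avg (fun g => f g⁻¹) = avg f :=
  avg_equiv (Equiv.inv G) f

theorem avg_conj (f : G → A) (h : G) : avg (fun g => f (h * g * h⁻¹)) = avg f :=
  avg_equiv (MulAut.conj h).toEquiv f

theorem avg_surj {H : Type} [Group H] [Finite H] (φ : G →* H) (hφ : Function.Surjective φ)
    (f : H → A) : avg (fun g => f (φ g)) = avg f := by
  have h1 : ∀ g0 : G, avg (fun h => f (φ g0 * h)) = avg f := fun g0 => avg_mul_left f _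
  have h2 : avg (fun g : G => avg (fun h : H => f (φ g * h))) = avg f := by
    simp only [h1, avg_const]
  rw [avg_comm] at h2
  have h3 : ∀ h : H, avg (fun g : G => f (φ g * h)) = avg (fun g : G => f (φ g)) := by
    intro h
    obtain ⟨k, rfl⟩ := hφ h
    simp only [← map_mul]
    exact avg_mul_right (fun g => f (φ g)) k
  simpa only [h3, avg_const] using h2

/-- The bilinear form on functions. -/
noncomputable def ip (f h : G → ℂ) : ℂ := avg (fun g => f g * h g⁻¹)

theorem ip_comm (f h : G → ℂ) : ip f h = ip h f := by
  rw [ip, ← avg_inv]; simp [ip, mul_comm]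

theorem ip_add_left (f f' h : G → ℂ) : ip (f + f') h = ip f h + ip f' h := by
  simp only [ip, ← avg_add]; congr 1; ext g; simp [add_mul]

theorem ip_sub_left (f f' h : G → ℂ) : ip (f - f') h = ip f h - ip f' h := by
  simp only [ip, ← avg_sub]; congr 1; ext g; simp [sub_mul]

theorem ip_add_right (f h h' : G → ℂ) : ip f (h + h') = ip f h + ip f h' := by
  rw [ip_comm, ip_add_left, ip_comm h, ip_comm h']

theorem ip_sub_right (f h h' : G → ℂ) : ip f (h - h') = ip f h - ip f h' := by
  rw [ip_comm, ip_sub_left, ip_comm h, ip_comm h']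

theorem ip_smul_left (c : ℂ) (f h : G → ℂ) : ip (c • f) h = c * ip f h := by
  simp only [ip, ← smul_eq_mul (a := c), ← avg_smul]; congr 1; ext g; simp [mul_assoc]

theorem ip_smul_right (c : ℂ) (f h : G → ℂ) : ip f (c • h) = c * ip f h := by
  rw [ip_comm, ip_smul_left, ip_comm h]

theorem ip_zero_left (h : G → ℂ) : ip 0 h = 0 := by
  simp [ip, avg_zero]

theorem ip_zero_right (h : G → ℂ) : ip h 0 = 0 := by
  simp [ip, avg_zero]

theorem ip_sum_left {ι : Type*} (s : Finset ι) (f : ι → G → ℂ) (h : G → ℂ) :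
    ip (∑ i ∈ s, f i) h = ∑ i ∈ s, ip (f i) h := by
  simp only [ip, ← avg_finset_sum]; congr 1; ext g; simp [Finset.sum_mul]

theorem ip_sum_right {ι : Type*} (s : Finset ι) (f : ι → G → ℂ) (h : G → ℂ) :
    ip h (∑ i ∈ s, f i) = ∑ i ∈ s, ip h (f i) := by
  rw [ip_comm, ip_sum_left]; simp only [ip_comm]

/-- The dual (contragredient) function. -/
def dual {G : Type} [Group G] (f : G → ℂ) : G → ℂ := fun g => f g⁻¹

section
variable {G : Type} [Group G]
@[simp] theorem dual_apply (f : G → ℂ) (g : G) : dual f g = f g⁻¹ := rfl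
@[simp] theorem dual_dual (f : G → ℂ) : dual (dual f) = f := by ext g; simp
@[simp] theorem dual_add (f h : G → ℂ) : dual (f + h) = dual f + dual h := rfl
@[simp] theorem dual_sub (f h : G → ℂ) : dual (f - h) = dual f - dual h := rfl
@[simp] theorem dual_mul (f h : G → ℂ) : dual (f * h) = dual f * dual h := rfl
@[simp] theorem dual_one : dual (1 : G → ℂ) = 1 := rfl
@[simp] theorem dual_pow (f : G → ℂ) (n : ℕ) : dual (f ^ n) = dual f ^ n := rfl
end

theorem ip_dual (f h : G → ℂ) : ip (dual f) (dual h) = ip f h := by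
  simp only [ip, dual_apply]
  exact avg_inv (fun g => f g * h g⁻¹)

theorem ip_mul_left (f k h : G → ℂ) : ip (f * k) h = ip f (dual k * h) := by
  simp only [ip]; congr 1; ext g; simp [mul_assoc]

theorem ip_mul_right (f k h : G → ℂ) : ip h (f * k) = ip (dual k * h) f := by
  rw [ip_comm, ip_mul_left, ip_comm]

theorem ip_one_right (f : G → ℂ) : ip f 1 = avg f := by simp [ip]

theorem ip_surj {H : Type} [Group H] [Finite H] (φ : G →* H) (hφ : Function.Surjective φ)
    (f h : H → ℂ) : ip (f ∘ φ) (h ∘ φ) = ip f h := by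
  simp only [ip, ← avg_surj φ hφ]; simp

end AvgGroup

end ACD

namespace ACD
open Matrix

/-! ### Characters as traces of matrix representations -/

/-- `χ` is the character of some complex matrix representation. -/
def IsChar {G : Type} [Group G] (χ : G → ℂ) : Prop :=
  ∃ (n : ℕ) (ρ : G →* Matrix (Fin n) (Fin n) ℂ), ∀ g, χ g = (ρ g).trace

section
variable {G : Type} [Group G]

theorem isChar_of_matrix {ι : Type*} [Fintype ι] [DecidableEq ι] (ρ : G →* Matrix ι ι ℂ)
    {χ : G → ℂ} (h : ∀ g, χ g = (ρ g).trace) : IsChar χ := by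
  let e := Fintype.equivFin ι
  refine ⟨Fintype.card ι, ((Matrix.reindexAlgEquiv ℂ ℂ e).toAlgHom : _ →* _).comp ρ, fun g => ?_⟩
  rw [h]
  simp [Matrix.trace, ← e.symm.sum_comp]

theorem isChar_iff_fdrep {χ : G → ℂ} : IsChar χ ↔ ∃ V : FDRep ℂ G, χ = fun g => V.character g := by
  constructor
  · rintro ⟨n, ρ, h⟩
    refine ⟨FDRep.of ((Matrix.toLinAlgEquiv' : Matrix (Fin n) (Fin n) ℂ ≃ₐ[ℂ] _).toMulEquiv.toMonoidHom.comp ρ), ?_⟩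
    ext g
    rw [h, FDRep.character, FDRep.of_ρ']
    exact (Matrix.trace_toLin'_eq (ρ g)).symm
  · rintro ⟨V, rfl⟩
    let b := Module.finBasis ℂ V
    refine isChar_of_matrix ((LinearMap.toMatrixAlgEquiv b).toMulEquiv.toMonoidHom.comp V.ρ) ?_
    intro g
    rw [FDRep.character, LinearMap.trace_eq_matrix_trace ℂ b]
    rfl

theorem IsChar.comp {H : Type} [Group H] {χ : G → ℂ} (h : IsChar χ) (φ : H →* G) :
    IsChar (fun x => χ (φ x)) := by
  obtain ⟨n, ρ, h⟩ := h
  exact ⟨n, ρ.comp φ, fun g => h _⟩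

theorem isChar_one : IsChar (1 : G → ℂ) :=
  ⟨1, 1, fun g => by simp⟩

theorem isChar_zero : IsChar (0 : G → ℂ) :=
  ⟨0, 1, fun g => by simp⟩

theorem IsChar.dual {χ : G → ℂ} (h : IsChar χ) : IsChar (dual χ) := by
  obtain ⟨n, ρ, h⟩ := h
  refine ⟨n, ⟨⟨fun g => (ρ g⁻¹)ᵀ, by simp⟩, fun a b => by simp [Matrix.transpose_mul]⟩, fun g => ?_⟩
  simp [h]

theorem IsChar.add {χ ψ : G → ℂ} (h : IsChar χ) (h' : IsChar ψ) : IsChar (χ + ψ) := by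
  obtain ⟨n, ρ, h⟩ := h
  obtain ⟨m, σ, h'⟩ := h'
  refine isChar_of_matrix (ι := Fin n ⊕ Fin m)
    ⟨⟨fun g => Matrix.fromBlocks (ρ g) 0 0 (σ g), by simp⟩,
      fun a b => by simp [Matrix.fromBlocks_multiply]⟩ fun g => ?_
  simp [h, h', Matrix.trace, Fintype.sum_sum_type]

theorem IsChar.mul {χ ψ : G → ℂ} (h : IsChar χ) (h' : IsChar ψ) : IsChar (χ * ψ) := by
  obtain ⟨n, ρ, h⟩ := h
  obtain ⟨m, σ, h'⟩ := h'
  refine isChar_of_matrix (ι := Fin n × Fin m)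
    ⟨⟨fun g => Matrix.kronecker (ρ g) (σ g), by simp⟩,
      fun a b => by simp [Matrix.mul_kronecker_mul]⟩ fun g => ?_
  simp [h, h', Matrix.trace_kronecker]

theorem IsChar.conj {χ : G → ℂ} (h : IsChar χ) (a b : G) : χ (a * b * a⁻¹) = χ b := by
  obtain ⟨n, ρ, h⟩ := h
  rw [h, h, map_mul, Matrix.trace_mul_comm, ← map_mul]; simp

theorem IsChar.one_eq {χ : G → ℂ} (h : IsChar χ) : χ 1 = charDeg χ := by
  obtain ⟨n, ρ, h⟩ := h
  simp [charDeg, h]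

theorem IsChar.charDeg_add {χ ψ : G → ℂ} (h : IsChar χ) (h' : IsChar ψ) :
    charDeg (χ + ψ) = charDeg χ + charDeg ψ := by
  have := (h.add h').one_eq
  rw [Pi.add_apply, h.one_eq, h'.one_eq] at this
  exact_mod_cast this.symm

theorem IsChar.charDeg_sub {χ ψ : G → ℂ} (h : IsChar ψ) (h' : IsChar (χ - ψ)) :
    charDeg χ = charDeg (χ - ψ) + charDeg ψ := by
  rw [← h'.charDeg_add h]; simp

theorem IsChar.charDeg_mul {χ ψ : G → ℂ} (h : IsChar χ) (h' : IsChar ψ) :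
    charDeg (χ * ψ) = charDeg χ * charDeg ψ := by
  have := (h.mul h').one_eq
  rw [Pi.mul_apply, h.one_eq, h'.one_eq] at this
  exact_mod_cast this.symm

theorem charDeg_dual (χ : G → ℂ) : charDeg (dual χ) = charDeg χ := by
  simp [charDeg]

theorem charDeg_one : charDeg (1 : G → ℂ) = 1 := by
  simp [charDeg]

theorem charDeg_zero : charDeg (0 : G → ℂ) = 0 := by
  simp [charDeg]

theorem IsChar.eq_zero {χ : G → ℂ} (h : IsChar χ) (h0 : charDeg χ = 0) : χ = 0 := by
  have h1 := h.one_eq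
  obtain ⟨n, ρ, h⟩ := h
  rw [h0, h] at h1
  have : n = 0 := by simpa using h1
  subst this
  ext g; simp [h]

end

/-- Splitting an idempotent matrix. -/
theorem idem_split {ι : Type*} [Fintype ι] [DecidableEq ι] (E : Matrix ι ι ℂ) (hE : E * E = E) :
    ∃ (r : ℕ) (A : Matrix ι (Fin r) ℂ) (B : Matrix (Fin r) ι ℂ), A * B = E ∧ B * A = 1 := by
  let f := Matrix.toLin' E
  have hf : ∀ x, f (f x) = f x := fun x => by
    simp [f, hE]
  let W := LinearMap.range f
  let b := Module.finBasis ℂ W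
  let i : W →ₗ[ℂ] (ι → ℂ) := W.subtype
  let p : (ι → ℂ) →ₗ[ℂ] W := f.rangeRestrict
  have hip : i ∘ₗ p = f := by ext; simp [i, p]
  have hpi : p ∘ₗ i = LinearMap.id := by
    ext ⟨x, y, rfl⟩ : 2
    simp [i, p, hf]
  let st := Pi.basisFun ℂ ι
  refine ⟨_, LinearMap.toMatrix b st i, LinearMap.toMatrix st b p, ?_, ?_⟩
  · rw [← LinearMap.toMatrix_comp, hip]
    simp [f, st]
  · rw [← LinearMap.toMatrix_comp, hpi, LinearMap.toMatrix_id]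

theorem idem_trace_nat {ι : Type*} [Fintype ι] [DecidableEq ι] (E : Matrix ι ι ℂ)
    (hE : E * E = E) : ∃ r : ℕ, E.trace = r ∧ (r = 0 → E = 0) := by
  obtain ⟨r, A, B, h1, h2⟩ := idem_split E hE
  refine ⟨r, ?_, ?_⟩
  · rw [← h1, Matrix.trace_mul_comm, h2]; simp
  · rintro rfl
    rw [← h1]; ext; simp [Matrix.mul_apply]

section
variable {G : Type} [Finite G]

theorem avg_mulLeft {ι κ τ : Type*} [Fintype ι] [Fintype κ] [Fintype τ] (X : Matrix ι κ ℂ)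
    (f : G → Matrix κ τ ℂ) : X * avg f = avg (fun g => X * f g) := by
  cases nonempty_fintype G
  simp only [avg_eq, Matrix.mul_smul, Matrix.mul_sum]

theorem avg_mulRight {ι κ τ : Type*} [Fintype ι] [Fintype κ] [Fintype τ] (X : Matrix κ τ ℂ)
    (f : G → Matrix ι κ ℂ) : avg f * X = avg (fun g => f g * X) := by
  cases nonempty_fintype G
  simp only [avg_eq, Matrix.smul_mul, Matrix.sum_mul]

theorem avg_trace {ι : Type*} [Fintype ι] (f : G → Matrix ι ι ℂ) :
    (avg f).trace = avg (fun g => (f g).trace) :=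
  avg_map (Matrix.traceLinearMap ι ℂ ℂ) f

end

section
variable {G : Type} [Group G]

theorem isChar_idem {ι : Type*} [Fintype ι] [DecidableEq ι] (ρ : G →* Matrix ι ι ℂ)
    (E : Matrix ι ι ℂ) (hE : E * E = E) (hc : ∀ g, ρ g * E = E * ρ g) :
    IsChar (fun g => (ρ g * E).trace) := by
  obtain ⟨r, A, B, h1, h2⟩ := idem_split E hE
  have hEA : E * A = A := by rw [← h1, Matrix.mul_assoc, h2, Matrix.mul_one]
  refine ⟨r, ⟨⟨fun g => B * ρ g * A, by simp [h2]⟩, fun a b => ?_⟩, fun g => ?_⟩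
  · show B * ρ (a * b) * A = B * ρ a * A * (B * ρ b * A)
    calc B * ρ (a * b) * A = B * (ρ a * (ρ b * (E * A))) := by
            rw [hEA, map_mul]; simp only [Matrix.mul_assoc]
      _ = B * (ρ a * ((ρ b * E) * A)) := by simp only [Matrix.mul_assoc]
      _ = B * ρ a * A * (B * ρ b * A) := by
            rw [hc, ← h1]; simp only [Matrix.mul_assoc]
  · show (ρ g * E).trace = (B * ρ g * A).trace
    rw [← h1, ← Matrix.mul_assoc, Matrix.trace_mul_comm, Matrix.mul_assoc]

variable [Finite G]

theorem avg_rep_idem {ι : Type*} [Fintype ι] [DecidableEq ι] (ρ : G →* Matrix ι ι ℂ) :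
    avg (fun g => ρ g) * avg (fun g => ρ g) = avg (fun g => ρ g) := by
  rw [avg_mulLeft]
  have : ∀ g, avg (fun g => ρ g) * ρ g = avg (fun g => ρ g) := fun g => by
    rw [avg_mulRight]; simp only [← map_mul]
    exact avg_mul_right (fun g => ρ g) g
  simp only [this, avg_const]

theorem IsChar.avg_nat {χ : G → ℂ} (h : IsChar χ) : ∃ r : ℕ, avg χ = r := by
  obtain ⟨n, ρ, h⟩ := h
  obtain ⟨r, hr, -⟩ := idem_trace_nat _ (avg_rep_idem ρ)
  refine ⟨r, ?_⟩
  rw [← hr, avg_trace]; congr 1; ext g; exact h g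

theorem IsChar.ip_nat {χ ψ : G → ℂ} (h : IsChar χ) (h' : IsChar ψ) : ∃ r : ℕ, ip χ ψ = r :=
  (h.mul h'.dual).avg_nat

theorem mem_irr_iff {χ : G → ℂ} : χ ∈ IrrChar G ↔ IsChar χ ∧ ip χ χ = 1 := by
  cases nonempty_fintype G
  have key : ∀ V : FDRep ℂ G, Simple V ↔ ip (fun g => V.character g) (fun g => V.character g) = 1 := by
    intro V
    rw [FDRep.simple_iff_char_is_norm_one, ip, avg_eq, smul_eq_mul, inv_mul_eq_one₀ (by simp)]
    exact eq_comm
  constructor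
  · rintro ⟨V, hV, rfl⟩
    exact ⟨isChar_iff_fdrep.2 ⟨V, rfl⟩, (key V).1 hV⟩
  · rintro ⟨h, h1⟩
    obtain ⟨V, rfl⟩ := isChar_iff_fdrep.1 h
    exact ⟨V, (key V).2 h1, rfl⟩

/-- Intertwiners. -/
theorem exists_intertwiner {ι κ : Type*} [Fintype ι] [DecidableEq ι] [Fintype κ] [DecidableEq κ]
    (ρ : G →* Matrix ι ι ℂ) (σ : G →* Matrix κ κ ℂ)
    (h : ip (fun g => (ρ g).trace) (fun g => (σ g).trace) ≠ 0) :
    ∃ T : Matrix ι κ ℂ, T ≠ 0 ∧ ∀ g, ρ g * T = T * σ g := by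
  by_contra hcon
  push Not at hcon
  apply h
  have h0 : ∀ X : Matrix ι κ ℂ, avg (fun g => ρ g * X * σ g⁻¹) = 0 := by
    intro X
    by_contra hne
    obtain ⟨g, hg⟩ := hcon _ hne
    apply hg
    rw [avg_mulLeft, avg_mulRight]
    refine Eq.trans ?_ (avg_mul_left _ g)
    congr 1; ext1 x
    simp only [_root_.mul_inv_rev, map_mul, Matrix.mul_assoc]
    rw [← map_mul σ g⁻¹ g]; simp
  have h1 : ∀ i j, avg (fun g => ρ g i i * σ g⁻¹ j j) = 0 := by
    intro i j
    have h2 := h0 (Matrix.single i j 1)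
    have h3 := congrArg (Matrix.entryLinearMap ℂ ℂ i j) h2
    rw [avg_map] at h3
    rw [map_zero] at h3
    rw [← h3]; congr 1; ext1 g
    simp [Matrix.mul_apply, Matrix.single_apply, Matrix.entryLinearMap_apply]
    simp [ite_and]
  rw [ip]
  simp only [Matrix.trace, Matrix.diag, Finset.sum_mul_sum]
  rw [avg_finset_sum]
  simp only [avg_finset_sum, h1, Finset.sum_const_zero]

/-- The conjugation representation on matrices, in coordinates. -/
noncomputable def conjRep {ι : Type*} [Fintype ι] [DecidableEq ι] (ρ : G →* Matrix ι ι ℂ) :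
    G →* Matrix (ι × ι) (ι × ι) ℂ where
  toFun g := Matrix.kronecker (ρ g⁻¹)ᵀ (ρ g)
  map_one' := by simp
  map_mul' a b := by simp [Matrix.transpose_mul, Matrix.mul_kronecker_mul]

theorem conjRep_vec {ι : Type*} [Fintype ι] [DecidableEq ι] (ρ : G →* Matrix ι ι ℂ) (g : G)
    (T : Matrix ι ι ℂ) : conjRep ρ g *ᵥ vec T = vec (ρ g * T * ρ g⁻¹) := by
  show Matrix.kronecker (ρ g⁻¹)ᵀ (ρ g) *ᵥ vec T = _
  rw [Matrix.kronecker, Matrix.kronecker_mulVec_vec, Matrix.transpose_transpose]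

theorem conjRep_trace {ι : Type*} [Fintype ι] [DecidableEq ι] (ρ : G →* Matrix ι ι ℂ) :
    (avg (fun g => conjRep ρ g)).trace = ip (fun g => (ρ g).trace) (fun g => (ρ g).trace) := by
  rw [avg_trace, ip]; congr 1; ext1 g
  show (Matrix.kronecker (ρ g⁻¹)ᵀ (ρ g)).trace = _
  rw [Matrix.kronecker, Matrix.trace_kronecker]; simp [mul_comm]

theorem avg_mulVec {ι : Type*} [Fintype ι] (f : G → Matrix ι ι ℂ) (v : ι → ℂ) :
    avg f *ᵥ v = avg (fun g => f g *ᵥ v) := by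
  cases nonempty_fintype G
  simp only [avg_eq, Matrix.smul_mulVec, Matrix.sum_mulVec]

theorem conj_of_comm {ι : Type*} [Fintype ι] [DecidableEq ι]
    (ρ : G →* Matrix ι ι ℂ) (T : Matrix ι ι ℂ) (hT : ∀ g, ρ g * T = T * ρ g) (g : G) :
    ρ g * T * ρ g⁻¹ = T := by
  rw [hT, Matrix.mul_assoc, ← map_mul]; simp

theorem comm_of_conj {ι : Type*} [Fintype ι] [DecidableEq ι]
    (ρ : G →* Matrix ι ι ℂ) (T : Matrix ι ι ℂ) (g : G) (hT : ρ g * T * ρ g⁻¹ = T) :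
     ρ g * T = T * ρ g := by
  nth_rewrite 2 [← hT]
  rw [Matrix.mul_assoc _ (ρ g⁻¹), ← map_mul]; simp

/-- Schur package: a matrix representation of an irreducible character has scalar commutant. -/
theorem schur {ι : Type*} [Fintype ι] [DecidableEq ι]
    (ρ : G →* Matrix ι ι ℂ) (h : ip (fun g => (ρ g).trace) (fun g => (ρ g).trace) = 1)
    (T : Matrix ι ι ℂ) (hT : ∀ g, ρ g * T = T * ρ g) : ∃ c : ℂ, T = c • 1 := by
  have hfix : ∀ T : Matrix ι ι ℂ, (∀ g, ρ g * T = T * ρ g) →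
      avg (fun g => conjRep ρ g) *ᵥ vec T = vec T := by
    intro T hT
    rw [avg_mulVec]
    simp only [conjRep_vec, conj_of_comm ρ T hT, avg_const]
  obtain ⟨r, A, B, h1, h2⟩ := idem_split _ (avg_rep_idem (conjRep ρ))
  have hr : r = 1 := by
    have h3 := conjRep_trace ρ
    rw [← h1, Matrix.trace_mul_comm, h2, h] at h3
    simpa using h3
  subst hr
  have key : ∀ T : Matrix ι ι ℂ, (∀ g, ρ g * T = T * ρ g) → ∃ c : ℂ, vec T = c • A.col 0 := by
    intro T hT
    refine ⟨(B *ᵥ vec T) 0, ?_⟩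
    have h4 := hfix T hT
    rw [← h1, ← Matrix.mulVec_mulVec] at h4
    nth_rewrite 1 [← h4]
    generalize B *ᵥ vec T = w
    ext x
    simp [Matrix.mulVec, dotProduct, mul_comm]
  obtain ⟨c, hc⟩ := key T hT
  obtain ⟨d, hd⟩ := key 1 (by simp)
  by_cases hd0 : d = 0
  · rw [hd0, zero_smul] at hd
    have : (1 : Matrix ι ι ℂ) = 0 := Matrix.vec_inj.1 (by rw [hd]; rfl)
    exact ⟨0, by rw [← Matrix.one_mul T, this]; simp⟩
  · refine ⟨c / d, Matrix.vec_inj.1 ?_⟩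
    rw [Matrix.vec_smul, hc, hd, smul_smul, div_mul_cancel₀ _ hd0]

/-- A nonzero representation whose character does not have norm one has a nonscalar commutant. -/
theorem exists_nonscalar {ι : Type*} [Fintype ι] [DecidableEq ι] [Nonempty ι]
    (ρ : G →* Matrix ι ι ℂ) (h : ip (fun g => (ρ g).trace) (fun g => (ρ g).trace) ≠ 1) :
    ∃ T : Matrix ι ι ℂ, (∀ g, ρ g * T = T * ρ g) ∧ ∀ c : ℂ, T ≠ c • 1 := by
  by_contra hcon
  push Not at hcon
  obtain ⟨r, A, B, h1, h2⟩ := idem_split _ (avg_rep_idem (conjRep ρ))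
  have hr : r ≠ 1 := by
    rintro rfl
    have h3 := conjRep_trace ρ
    rw [← h1, Matrix.trace_mul_comm, h2] at h3
    exact h (by rw [← h3]; simp)
  have hKA : avg (fun g => conjRep ρ g) * A = A := by
    rw [← h1, Matrix.mul_assoc, h2, Matrix.mul_one]
  have hcol : ∀ j, ∃ c : ℂ, ∀ x, A x j = c * vec (1 : Matrix ι ι ℂ) x := by
    intro j
    obtain ⟨T, hT⟩ : ∃ T : Matrix ι ι ℂ, vec T = A.col j :=
      ⟨Matrix.of fun a b => A (b, a) j, by ext ⟨a, b⟩; simp [Matrix.vec]⟩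
    obtain ⟨c, hc⟩ := hcon T (fun g => by
      apply comm_of_conj
      apply Matrix.vec_inj.1
      rw [← conjRep_vec, hT]
      have h5 : conjRep ρ g * A = A := by
        rw [← hKA, ← Matrix.mul_assoc, avg_mulLeft]
        simp only [← map_mul]
        rw [avg_mul_left (fun x => conjRep ρ x) g]
      ext x
      have := congrFun (congrFun h5 x) j
      simpa [Matrix.mul_apply, Matrix.mulVec, dotProduct] using this)
    refine ⟨c, fun x => ?_⟩
    have := congrFun hT x
    rw [hc, Matrix.vec_smul] at this
    simpa using this.symm
  choose c hc using hcol
  have hBA : ∀ i j, (B * A) i j = c j * (B *ᵥ vec (1 : Matrix ι ι ℂ)) i := by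
    intro i j
    simp only [Matrix.mul_apply, hc, Matrix.mulVec, dotProduct, Finset.mul_sum]
    exact Finset.sum_congr rfl fun _ _ => by ring
  rw [h2] at hBA
  rcases Nat.lt_or_ge r 1 with h0 | h0
  · have : r = 0 := by omega
    subst this
    have h5 : avg (fun g => conjRep ρ g) *ᵥ vec (1 : Matrix ι ι ℂ) = vec 1 := by
      rw [avg_mulVec]
      simp only [conjRep_vec, conj_of_comm ρ 1 (by simp), avg_const]
    rw [← h1] at h5
    have h6 : (1 : Matrix ι ι ℂ) = 0 := Matrix.vec_inj.1 (by
      rw [← h5]; ext; simp [Matrix.mulVec, dotProduct, Matrix.mul_apply])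
    exact one_ne_zero h6
  · have h00 := hBA ⟨0, by omega⟩ ⟨0, by omega⟩
    have h01 := hBA ⟨0, by omega⟩ ⟨1, by omega⟩
    have h11 := hBA ⟨1, by omega⟩ ⟨1, by omega⟩
    rw [Matrix.one_apply_eq] at h00 h11
    rw [Matrix.one_apply_ne (by simp)] at h01
    rcases mul_eq_zero.1 h01.symm with h | h
    · rw [h] at h11; simp at h11
    · rw [h] at h00; simp at h00

/-- Peeling off an irreducible constituent. -/
theorem IsChar.peel {χ ψ : G → ℂ} (h : IsChar χ) (h' : ψ ∈ IrrChar G) (hne : ip χ ψ ≠ 0) :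
    IsChar (χ - ψ) := by
  obtain ⟨hψ, h1⟩ := mem_irr_iff.1 h'
  obtain ⟨n, ρ, h⟩ := h
  obtain ⟨m, σ, hψ⟩ := hψ
  obtain rfl : χ = _ := funext h
  obtain rfl : ψ = _ := funext hψ
  obtain ⟨T, hT0, hT⟩ := exists_intertwiner ρ σ hne
  obtain ⟨i, j, hij⟩ : ∃ i j, T i j ≠ 0 := by
    by_contra hc; push Not at hc; exact hT0 (by ext i j; exact hc i j)
  let S : Matrix (Fin m) (Fin n) ℂ := avg (fun g => σ g * Matrix.single j i (1 : ℂ) * ρ g⁻¹)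
  have hS : ∀ g, σ g * S = S * ρ g := by
    intro g
    simp only [S]
    rw [avg_mulLeft, avg_mulRight]
    refine Eq.trans ?_ (avg_mul_left _ g)
    congr 1; ext1 x
    simp only [_root_.mul_inv_rev, map_mul, Matrix.mul_assoc]
    rw [← map_mul ρ g⁻¹ g]; simp
  have htr : (S * T).trace = T i j := by
    simp only [S]
    rw [avg_mulRight, avg_trace]
    have : ∀ g, (σ g * Matrix.single j i (1 : ℂ) * ρ g⁻¹ * T).trace = T i j := by
      intro g
      rw [Matrix.mul_assoc, hT, ← Matrix.mul_assoc, Matrix.trace_mul_comm, ← Matrix.mul_assoc,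
        ← Matrix.mul_assoc, ← map_mul]
      simp [Matrix.trace_single_mul]
    simp only [this, avg_const]
  obtain ⟨c, hc⟩ := schur σ h1 (S * T) (fun g => by
    rw [← Matrix.mul_assoc, hS, Matrix.mul_assoc, hT, Matrix.mul_assoc])
  have hc0 : c ≠ 0 := by
    rintro rfl
    rw [hc] at htr; simp at htr; exact hij htr.symm
  let E := c⁻¹ • (T * S)
  have hE : E * E = E := by
    simp only [E, Matrix.smul_mul, Matrix.mul_smul]
    rw [Matrix.mul_assoc, ← Matrix.mul_assoc S, hc]
    simp [smul_smul, hc0]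
  have hEc : ∀ g, ρ g * E = E * ρ g := by
    intro g
    simp only [E, Matrix.smul_mul, Matrix.mul_smul]
    rw [← Matrix.mul_assoc, hT, Matrix.mul_assoc, hS, Matrix.mul_assoc]
  have hEt : ∀ g, (ρ g * E).trace = (σ g).trace := by
    intro g
    simp only [E, Matrix.mul_smul, Matrix.trace_smul]
    rw [← Matrix.mul_assoc, hT, Matrix.trace_mul_comm, ← Matrix.mul_assoc, hc]
    simp [hc0]
  have := isChar_idem ρ (1 - E) (by simp [sub_mul, mul_sub, hE]) (fun g => by
    simp [sub_mul, mul_sub, hEc])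
  convert this using 1
  ext g
  simp [mul_sub, hEt]

theorem IsChar.split {χ : G → ℂ} (h : IsChar χ) (h0 : χ ≠ 0) (h1 : ip χ χ ≠ 1) :
    ∃ α β : G → ℂ, IsChar α ∧ IsChar β ∧ α ≠ 0 ∧ β ≠ 0 ∧ χ = α + β := by
  obtain ⟨n, ρ, h⟩ := h
  obtain rfl : χ = _ := funext h
  have hn : n ≠ 0 := by
    rintro rfl; apply h0; ext g; simp
  have : NeZero n := ⟨hn⟩
  obtain ⟨T, hT, hTs⟩ := exists_nonscalar ρ h1
  obtain ⟨c, hc⟩ := Module.End.exists_eigenvalue (Matrix.toLin' T)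
  obtain ⟨v, hv⟩ := hc.exists_hasEigenvector
  have hv1 : T *ᵥ v = c • v := by simpa using hv.apply_eq_smul
  have hv0 : v ≠ 0 := hv.2
  let S := T - c • (1 : Matrix (Fin n) (Fin n) ℂ)
  have hS0 : S ≠ 0 := fun h => hTs c (sub_eq_zero.1 h)
  have hS : ∀ g, ρ g * S = S * ρ g := fun g => by simp [S, mul_sub, sub_mul, hT]
  have hSv : S *ᵥ v = 0 := by simp [S, Matrix.sub_mulVec, hv1, Matrix.smul_mulVec]
  obtain ⟨P, hP1, hP2⟩ : ∃ P : Matrix (Fin n) (Fin n) ℂ, S * P = 0 ∧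
      ∀ K : Matrix (Fin n) (Fin n) ℂ, S * K = 0 → P * K = K := by
    obtain ⟨p, hp⟩ := Submodule.exists_isCompl (LinearMap.ker (Matrix.toLin' S))
    let q := (LinearMap.ker (Matrix.toLin' S)).subtype ∘ₗ Submodule.projectionOnto _ p hp
    have hq : ∀ x, S *ᵥ x = 0 → q x = x := by
      intro x hx
      have : x ∈ LinearMap.ker (Matrix.toLin' S) := by simpa using hx
      exact congrArg Subtype.val (Submodule.projectionOnto_apply_left hp ⟨x, this⟩)
    refine ⟨LinearMap.toMatrix' q, ?_, ?_⟩
    · apply (Matrix.toLin').injective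
      rw [Matrix.toLin'_mul, Matrix.toLin'_toMatrix', map_zero]
      ext1 x
      exact LinearMap.ext fun y => (Submodule.projectionOnto _ p hp _).2
    · intro K hK
      apply (Matrix.toLin').injective
      rw [Matrix.toLin'_mul, Matrix.toLin'_toMatrix']
      refine LinearMap.ext fun x => ?_
      rw [LinearMap.comp_apply]
      apply hq
      simp [hK]
  let E : Matrix (Fin n) (Fin n) ℂ := avg (fun g => ρ g * P * ρ g⁻¹)
  have hE : ∀ g, ρ g * E = E * ρ g := by
    intro g
    simp only [E]
    rw [avg_mulLeft, avg_mulRight]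
    refine Eq.trans ?_ (avg_mul_left _ g)
    congr 1; ext1 x
    simp only [_root_.mul_inv_rev, map_mul, Matrix.mul_assoc]
    rw [← map_mul ρ g⁻¹ g]; simp
  have hSE : S * E = 0 := by
    simp only [E]
    rw [avg_mulLeft]
    have : ∀ g, S * (ρ g * P * ρ g⁻¹) = 0 := fun g => by
      rw [← Matrix.mul_assoc, ← Matrix.mul_assoc, ← hS, Matrix.mul_assoc (ρ g), hP1]; simp
    simp only [this, avg_zero]
  have hEK : ∀ K : Matrix (Fin n) (Fin n) ℂ, S * K = 0 → E * K = K := by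
    intro K hK
    simp only [E]
    rw [avg_mulRight]
    have : ∀ g, ρ g * P * ρ g⁻¹ * K = K := fun g => by
      rw [Matrix.mul_assoc, Matrix.mul_assoc, hP2, ← Matrix.mul_assoc, ← map_mul]
      · simp
      · rw [← Matrix.mul_assoc, ← hS, Matrix.mul_assoc, hK]; simp
    simp only [this, avg_const]
  have hEE : E * E = E := hEK E hSE
  have hne0 : E ≠ 0 := by
    intro h
    have h2 := hEK (Matrix.of fun i _ => v i) (by
      ext i j; exact congrFun hSv i)
    rw [h, Matrix.zero_mul] at h2
    apply hv0; ext i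
    exact (congrFun (congrFun h2 i) ⟨0, Nat.pos_of_ne_zero hn⟩).symm
  have hne1 : 1 - E ≠ 0 := by
    intro h
    rw [← sub_eq_zero.1 h, Matrix.mul_one] at hSE
    exact hS0 hSE
  have hFF : (1 - E) * (1 - E) = 1 - E := by simp [sub_mul, mul_sub, hEE]
  have hnz : ∀ E : Matrix (Fin n) (Fin n) ℂ, E * E = E → E ≠ 0 →
      (fun g => (ρ g * E).trace) ≠ 0 := by
    intro E hE h0 h
    obtain ⟨r, hr, hr0⟩ := idem_trace_nat E hE
    have := congrFun h 1
    simp [hr] at this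
    exact h0 (hr0 this)
  refine ⟨_, _, isChar_idem ρ E hEE hE, isChar_idem ρ (1 - E) hFF (fun g => by
    simp [sub_mul, mul_sub, hE]), hnz _ hEE hne0, hnz _ hFF hne1, ?_⟩
  ext g
  simp [mul_sub]

end
end ACD

namespace ACD
open Matrix

section
variable {G : Type} [Group G] [Finite G]

theorem irr_isChar {χ : G → ℂ} (h : χ ∈ IrrChar G) : IsChar χ := (mem_irr_iff.1 h).1

theorem irr_norm {χ : G → ℂ} (h : χ ∈ IrrChar G) : ip χ χ = 1 := (mem_irr_iff.1 h).2

theorem irr_ne_zero {χ : G → ℂ} (h : χ ∈ IrrChar G) : χ ≠ 0 := by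
  rintro rfl
  have := irr_norm h
  rw [ip_zero_left] at this
  exact zero_ne_one this

theorem irr_pos {χ : G → ℂ} (h : χ ∈ IrrChar G) : 0 < charDeg χ := by
  rcases Nat.eq_zero_or_pos (charDeg χ) with h0 | h0
  · exact absurd ((irr_isChar h).eq_zero h0) (irr_ne_zero h)
  · exact h0

theorem IsChar.pos {χ : G → ℂ} (h : IsChar χ) (h' : χ ≠ 0) : 0 < charDeg χ := by
  rcases Nat.eq_zero_or_pos (charDeg χ) with h0 | h0
  · exact absurd (h.eq_zero h0) h'
  · exact h0

theorem irr_eq_of_ip {χ ψ : G → ℂ} (h : χ ∈ IrrChar G) (h' : ψ ∈ IrrChar G) (hne : ip χ ψ ≠ 0) :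
    χ = ψ := by
  have h1 := (irr_isChar h).peel h' hne
  have h2 := (irr_isChar h').peel h (by rwa [ip_comm])
  have h3 := (irr_isChar h').charDeg_sub h1
  have h4 := (irr_isChar h).charDeg_sub h2
  exact sub_eq_zero.1 (h1.eq_zero (by omega))

theorem irr_ip_ne {χ ψ : G → ℂ} (h : χ ∈ IrrChar G) (h' : ψ ∈ IrrChar G) (hne : χ ≠ ψ) :
    ip χ ψ = 0 := by
  by_contra hc
  exact hne (irr_eq_of_ip h h' hc)

theorem IsChar.exists_constituent {χ : G → ℂ} (h : IsChar χ) (h0 : χ ≠ 0) :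
    ∃ ψ ∈ IrrChar G, ip χ ψ ≠ 0 := by
  induction hn : charDeg χ using Nat.strong_induction_on generalizing χ with
  | _ n ih =>
    by_cases h1 : ip χ χ = 1
    · exact ⟨χ, mem_irr_iff.2 ⟨h, h1⟩, by rw [h1]; exact one_ne_zero⟩
    · obtain ⟨α, β, hα, hβ, hα0, hβ0, rfl⟩ := h.split h0 h1
      have hd := hα.charDeg_add hβ
      have hp := hβ.pos hβ0
      obtain ⟨ψ, hψ, hne⟩ := ih (charDeg α) (by omega) hα hα0 rfl
      refine ⟨ψ, hψ, ?_⟩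
      obtain ⟨a, ha⟩ := hα.ip_nat (irr_isChar hψ)
      obtain ⟨b, hb⟩ := hβ.ip_nat (irr_isChar hψ)
      rw [ip_add_left, ha, hb]
      rw [ha] at hne
      norm_cast at *
      omega

theorem irr_finite : (IrrChar G).Finite := by
  have hli : LinearIndependent ℂ (fun χ : IrrChar G => (χ : G → ℂ)) := by
    rw [linearIndependent_iff']
    intro s c hc i hi
    have h1 := congrArg (fun f => ip f (i : G → ℂ)) hc
    simp only [ip_sum_left, ip_smul_left, ip_zero_left] at h1
    rw [Finset.sum_eq_single i] at h1
    · rwa [irr_norm i.2, mul_one] at h1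
    · intro j _ hj
      rw [irr_ip_ne j.2 i.2 (fun h => hj (Subtype.ext h)), mul_zero]
    · exact fun h => absurd hi h
  have := hli.finite
  exact Set.toFinite _

/-- The finset of irreducible characters. -/
noncomputable def Irr (G : Type) [Group G] [Finite G] : Finset (G → ℂ) := (irr_finite (G := G)).toFinset

@[simp] theorem mem_Irr {χ : G → ℂ} : χ ∈ Irr G ↔ χ ∈ IrrChar G := by simp [Irr]

/-- The multiplicity, as a natural number. -/
noncomputable def mu (χ ψ : G → ℂ) : ℕ := ⌊(ip χ ψ).re⌋₊

theorem IsChar.ip_eq {χ ψ : G → ℂ} (h : IsChar χ) (h' : IsChar ψ) : ip χ ψ = mu χ ψ := by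
  obtain ⟨r, hr⟩ := h.ip_nat h'
  simp [mu, hr]

theorem IsChar.ip_eq' {χ ψ : G → ℂ} (h : IsChar χ) (h' : ψ ∈ IrrChar G) : ip χ ψ = mu χ ψ :=
  h.ip_eq (irr_isChar h')

theorem mu_ne_zero {χ ψ : G → ℂ} (h : IsChar χ) (h' : IsChar ψ) : mu χ ψ ≠ 0 ↔ ip χ ψ ≠ 0 := by
  rw [h.ip_eq h']; norm_cast

theorem IsChar.eq_sum {χ : G → ℂ} (h : IsChar χ) : χ = ∑ ψ ∈ Irr G, (ip χ ψ) • ψ := by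
  induction hn : charDeg χ using Nat.strong_induction_on generalizing χ with
  | _ n ih =>
    by_cases h0 : χ = 0
    · subst h0; simp [ip_zero_left]
    · obtain ⟨φ, hφ, hne⟩ := h.exists_constituent h0
      have h1 := h.peel hφ hne
      have h2 := (irr_isChar hφ).charDeg_sub h1
      have h3 := irr_pos hφ
      have h4 := ih (charDeg (χ - φ)) (by omega) h1 rfl
      have h5 : φ = ∑ ψ ∈ Irr G, (ip φ ψ) • ψ := by
        rw [Finset.sum_eq_single φ]
        · rw [irr_norm hφ, one_smul]
        · intro b hb hbn
          rw [irr_ip_ne hφ (mem_Irr.1 hb) (Ne.symm hbn), zero_smul]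
        · intro h; exact absurd (mem_Irr.2 hφ) h
      have h6 : χ = (χ - φ) + φ := by simp
      nth_rewrite 1 [h6]
      rw [h4]
      nth_rewrite 2 [h5]
      rw [← Finset.sum_add_distrib]
      refine Finset.sum_congr rfl fun ψ _ => ?_
      rw [← add_smul, ip_sub_left, sub_add_cancel]

theorem IsChar.deg_eq_sum {χ : G → ℂ} (h : IsChar χ) :
    charDeg χ = ∑ ψ ∈ Irr G, mu χ ψ * charDeg ψ := by
  have h1 := congrFun h.eq_sum 1
  rw [h.one_eq, Finset.sum_apply] at h1
  have : ∀ ψ ∈ Irr G, ((ip χ ψ) • ψ) 1 = ((mu χ ψ * charDeg ψ : ℕ) : ℂ) := by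
    intro ψ hψ
    rw [Pi.smul_apply, (irr_isChar (mem_Irr.1 hψ)).one_eq, h.ip_eq' (mem_Irr.1 hψ)]
    simp
  rw [Finset.sum_congr rfl this] at h1
  exact_mod_cast h1

theorem IsChar.ip_eq_sum {χ : G → ℂ} (h : IsChar χ) (φ : G → ℂ) :
    ip χ φ = ∑ ψ ∈ Irr G, ip χ ψ * ip ψ φ := by
  nth_rewrite 1 [h.eq_sum]
  rw [ip_sum_left]
  simp only [ip_smul_left]

theorem IsChar.mu_eq_sum {χ φ : G → ℂ} (h : IsChar χ) (h' : IsChar φ) :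
    mu χ φ = ∑ ψ ∈ Irr G, mu χ ψ * mu φ ψ := by
  have h1 := h.ip_eq_sum φ
  rw [h.ip_eq h'] at h1
  have : ∀ ψ ∈ Irr G, ip χ ψ * ip ψ φ = ((mu χ ψ * mu φ ψ : ℕ) : ℂ) := by
    intro ψ hψ
    rw [ip_comm ψ, h.ip_eq' (mem_Irr.1 hψ), h'.ip_eq' (mem_Irr.1 hψ)]
    simp
  rw [Finset.sum_congr rfl this] at h1
  exact_mod_cast h1

theorem IsChar.mu_mul_le {χ ψ : G → ℂ} (h : IsChar χ) (h' : ψ ∈ IrrChar G) :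
    mu χ ψ * charDeg ψ ≤ charDeg χ := by
  rw [h.deg_eq_sum]
  exact Finset.single_le_sum (f := fun ψ => mu χ ψ * charDeg ψ) (fun _ _ => Nat.zero_le _)
    (mem_Irr.2 h')

theorem IsChar.deg_le {χ ψ : G → ℂ} (h : IsChar χ) (h' : ψ ∈ IrrChar G) (hne : ip χ ψ ≠ 0) :
    charDeg ψ ≤ charDeg χ := by
  have := h.mu_mul_le h'
  have h2 := (mu_ne_zero h (irr_isChar h')).2 hne
  nlinarith [Nat.pos_of_ne_zero h2]

theorem IsChar.norm_eq_zero {χ : G → ℂ} (h : IsChar χ) (h0 : ip χ χ = 0) : χ = 0 := by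
  by_contra hne
  obtain ⟨ψ, hψ, hn⟩ := h.exists_constituent hne
  have h1 := h.mu_eq_sum h
  have h2 : mu χ χ = 0 := by rw [h.ip_eq h] at h0; exact_mod_cast h0
  rw [h2] at h1
  have h3 := (Finset.sum_eq_zero_iff.1 h1.symm) ψ (mem_Irr.2 hψ)
  have := (mu_ne_zero h (irr_isChar hψ)).2 hn
  exact this (by simpa using h3)

theorem isChar_sum {ι : Type*} (s : Finset ι) (f : ι → G → ℂ) (h : ∀ i ∈ s, IsChar (f i)) :
    IsChar (∑ i ∈ s, f i) := by
  classical
  induction s using Finset.induction_on with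
  | empty => simpa using isChar_zero
  | insert a s ha ih =>
    rw [Finset.sum_insert ha]
    exact (h a (by simp)).add (ih fun i hi => h i (by simp [hi]))

/-- A character all of whose constituents are large is irreducible. -/
theorem IsChar.irr_of_small {χ : G → ℂ} (h : IsChar χ) (h0 : χ ≠ 0)
    (hs : ∀ ψ ∈ IrrChar G, ip χ ψ ≠ 0 → charDeg χ < 2 * charDeg ψ) : χ ∈ IrrChar G := by
  obtain ⟨ψ, hψ, hne⟩ := h.exists_constituent h0
  have h1 := h.peel hψ hne
  have hd := (irr_isChar hψ).charDeg_sub h1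
  by_cases h2 : χ - ψ = 0
  · rwa [sub_eq_zero.1 h2]
  · exfalso
    obtain ⟨φ, hφ, hne'⟩ := h1.exists_constituent h2
    have h3 := h1.deg_le hφ hne'
    have h4 : ip χ φ ≠ 0 := by
      have h5 : ip χ φ = ip (χ - ψ) φ + ip ψ φ := by rw [ip_sub_left]; ring
      rw [h5]
      rw [h1.ip_eq' hφ] at hne' ⊢
      rw [(irr_isChar hψ).ip_eq' hφ]
      norm_cast at *
      omega
    have := hs ψ hψ hne
    have := hs φ hφ h4
    omega

theorem irr_one : (1 : G → ℂ) ∈ IrrChar G :=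
  mem_irr_iff.2 ⟨isChar_one, by simp [ip, avg_const]⟩

theorem irr_dual {χ : G → ℂ} (h : χ ∈ IrrChar G) : dual χ ∈ IrrChar G :=
  mem_irr_iff.2 ⟨(irr_isChar h).dual, by rw [ip_dual, irr_norm h]⟩

/-- Pullback along an isomorphism or a surjection. -/
theorem irr_surj {H : Type} [Group H] [Finite H] (φ : G →* H) (hφ : Function.Surjective φ)
    {χ : H → ℂ} (h : χ ∈ IrrChar H) : (fun g => χ (φ g)) ∈ IrrChar G :=
  mem_irr_iff.2 ⟨(irr_isChar h).comp φ, by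
    have := ip_surj φ hφ χ χ
    rw [irr_norm h] at this; exact this⟩

/-- Linear characters: multiplicative. -/
theorem IsChar.linear {χ : G → ℂ} (h : IsChar χ) (h1 : charDeg χ = 1) :
    ∃ f : G →* ℂˣ, ∀ g, χ g = f g := by
  have h2 := h.one_eq
  obtain ⟨n, ρ, hρ⟩ := h
  rw [h1, hρ] at h2
  have : n = 1 := by simpa using h2
  subst this
  let f : G →* ℂ := ⟨⟨χ, by rw [hρ]; simp⟩, fun a b => by
    simp [hρ, Matrix.trace, Matrix.mul_apply]⟩
  exact ⟨f.toHomUnits, fun g => rfl⟩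

theorem linear_mul_dual {χ : G → ℂ} (h : IsChar χ) (h1 : charDeg χ = 1) : χ * dual χ = 1 := by
  obtain ⟨f, hf⟩ := h.linear h1
  ext g; simp [hf]

theorem linear_irr {χ : G → ℂ} (h : IsChar χ) (h1 : charDeg χ = 1) : χ ∈ IrrChar G := by
  refine mem_irr_iff.2 ⟨h, ?_⟩
  rw [← one_mul χ, ip_mul_left, one_mul, mul_comm, linear_mul_dual h h1]
  exact irr_norm irr_one

theorem linear_mul_irr {l χ : G → ℂ} (h : IsChar l) (h1 : charDeg l = 1) (hχ : χ ∈ IrrChar G) :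
    l * χ ∈ IrrChar G := by
  refine mem_irr_iff.2 ⟨h.mul (irr_isChar hχ), ?_⟩
  rw [mul_comm, ip_mul_left, mul_comm χ, ← mul_assoc, mul_comm (dual l), linear_mul_dual h h1,
    one_mul, irr_norm hχ]

end
end ACD

namespace ACD
open Matrix
open scoped Classical in
/-- The regular character. -/
noncomputable def regChar (G : Type) [Group G] : G → ℂ := fun g => if g = 1 then (Nat.card G : ℂ) else 0

section
variable {G : Type} [Group G] [Finite G]

/-- permutation characters -/
theorem isChar_perm {Ω : Type} [Finite Ω] [MulAction G Ω] :
    IsChar (fun g : G => (Nat.card {x : Ω // g • x = x} : ℂ)) := by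
  classical
  cases nonempty_fintype Ω
  refine isChar_of_matrix (ι := Ω)
    ⟨⟨fun g => Matrix.of fun x y => if x = g • y then (1 : ℂ) else 0, ?_⟩, ?_⟩ ?_
  · ext x y; simp [Matrix.one_apply]
  · intro a b
    ext x y
    simp [Matrix.mul_apply, mul_smul]
  · intro g
    simp only [Matrix.trace, MonoidHom.coe_mk, OneHom.coe_mk, Matrix.diag_apply, Matrix.of_apply]
    rw [Finset.sum_boole, Nat.card_eq_fintype_card, Fintype.card_subtype]
    congr 2; ext x; simp [eq_comm]

theorem isChar_reg : IsChar (regChar G) := by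
  convert isChar_perm (G := G) (Ω := G) using 1
  ext g
  simp only [regChar, smul_eq_mul, mul_eq_right]
  split_ifs with h
  · simp [h]
  · simp [h]

theorem ip_reg (f : G → ℂ) : ip (regChar G) f = f 1 := by
  classical
  cases nonempty_fintype G
  rw [ip, avg_eq, smul_eq_mul, Finset.sum_eq_single 1]
  · simp [regChar]
  · intro b _ hb; simp [regChar, hb]
  · simp

theorem sum_irr_eq_reg (g : G) : ∑ χ ∈ Irr G, χ 1 * χ g = regChar G g := by
  have := congrFun (isChar_reg (G := G)).eq_sum g
  rw [this]
  simp [ip_reg]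

/-! ### Restriction to subgroups -/

/-- Restriction of a function to a subgroup. -/
def res (M : Subgroup G) (χ : G → ℂ) : M → ℂ := fun m => χ m

theorem res_mul (M : Subgroup G) (χ ψ : G → ℂ) : res M (χ * ψ) = res M χ * res M ψ := rfl
theorem res_add (M : Subgroup G) (χ ψ : G → ℂ) : res M (χ + ψ) = res M χ + res M ψ := rfl
theorem res_sub (M : Subgroup G) (χ ψ : G → ℂ) : res M (χ - ψ) = res M χ - res M ψ := rfl
theorem res_one (M : Subgroup G) : res M (1 : G → ℂ) = 1 := rfl
theorem res_dual (M : Subgroup G) (χ : G → ℂ) : res M (dual χ) = dual (res M χ) := rfl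
theorem res_smul (M : Subgroup G) (c : ℂ) (χ : G → ℂ) : res M (c • χ) = c • res M χ := rfl
theorem res_sum {ι : Type*} (s : Finset ι) (f : ι → G → ℂ) (M : Subgroup G) :
    res M (∑ i ∈ s, f i) = ∑ i ∈ s, res M (f i) := by
  ext m; simp [res]
theorem charDeg_res (M : Subgroup G) (χ : G → ℂ) : charDeg (res M χ) = charDeg χ := rfl

theorem IsChar.res {χ : G → ℂ} (h : IsChar χ) (M : Subgroup G) : IsChar (res M χ) :=
  h.comp M.subtype

/-- `χ` is trivial on `M`. -/
def Triv (M : Subgroup G) (χ : G → ℂ) : Prop := ∀ m ∈ M, χ m = χ 1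

theorem Triv.mul {M : Subgroup G} {χ ψ : G → ℂ} (h : Triv M χ) (h' : Triv M ψ) : Triv M (χ * ψ) :=
  fun m hm => by simp [h m hm, h' m hm]

theorem Triv.dual {M : Subgroup G} {χ : G → ℂ} (h : Triv M χ) : Triv M (dual χ) :=
  fun m hm => by simp [h _ (M.inv_mem hm)]

theorem triv_one (M : Subgroup G) : Triv M (1 : G → ℂ) := fun _ _ => rfl

/-- Twisted central elements act by scalars. -/
theorem central_scalar {K ι : Type} [Finite K] [Fintype ι] [DecidableEq ι]
    (ρ : G →* Matrix ι ι ℂ) (h : ip (fun g => (ρ g).trace) (fun g => (ρ g).trace) = 1)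
    (j : K → G) (φ : K → ℂ) (e : G → K ≃ K) (he : ∀ g k, j (e g k) = g * j k * g⁻¹)
    (hφ : ∀ g k, φ (e g k) = φ k) :
    ∃ c : ℂ, avg (fun k => φ k • ρ (j k)) = c • 1 := by
  apply schur ρ h
  intro g
  rw [avg_mulLeft, avg_mulRight]
  rw [← avg_equiv (e g) (fun k => φ k • ρ (j k) * ρ g)]
  congr 1; ext1 k
  rw [hφ, he, Matrix.smul_mul, Matrix.mul_smul, ← map_mul, ← map_mul]; simp

/-- The conjugation action on a normal subgroup. -/
def cj {M : Subgroup G} [M.Normal] (g : G) (θ : M → ℂ) : M → ℂ := fun m => θ (MulAut.conjNormal g m)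

theorem irr_cj {M : Subgroup G} [M.Normal] (g : G) {θ : M → ℂ} (h : θ ∈ IrrChar M) :
    cj g θ ∈ IrrChar M :=
  irr_surj (MulAut.conjNormal g).toMonoidHom (MulAut.conjNormal g).surjective h

theorem charDeg_cj {M : Subgroup G} [M.Normal] (g : G) (θ : M → ℂ) :
    charDeg (cj g θ) = charDeg θ := by simp [charDeg, cj]

theorem irr_rep {χ : G → ℂ} (h : χ ∈ IrrChar G) : ∃ (n : ℕ) (ρ : G →* Matrix (Fin n) (Fin n) ℂ),
    χ = (fun g => (ρ g).trace) ∧ ip (fun g => (ρ g).trace) (fun g => (ρ g).trace) = 1 ∧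
    0 < n ∧ charDeg χ = n := by
  have h1 := irr_isChar h
  have h2 := h1.one_eq
  have h4 := irr_norm h
  obtain ⟨n, ρ, hρ⟩ := h1
  have h3 := irr_pos h
  rw [hρ] at h2
  simp at h2
  obtain rfl : χ = _ := funext hρ
  exact ⟨n, ρ, rfl, h4, by omega, h2.symm⟩

theorem irr_triv {M : Subgroup G} [M.Normal] {n : ℕ} (ρ : G →* Matrix (Fin n) (Fin n) ℂ)
    (hn : 0 < n) (h : ip (fun g => (ρ g).trace) (fun g => (ρ g).trace) = 1) :
    (∀ m ∈ M, ρ m = 1) ∨ (¬ Triv M (fun g => (ρ g).trace) ∧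
      ip (res M (fun g => (ρ g).trace)) 1 = 0) := by
  obtain ⟨c, hc⟩ := central_scalar (K := M) ρ h (fun m => m) 1
    (fun g => (MulAut.conjNormal g).toEquiv) (fun g k => by simp) (fun g k => rfl)
  simp only [Pi.one_apply, one_smul] at hc
  have hid := avg_rep_idem (ρ.comp M.subtype)
  simp only [MonoidHom.comp_apply, Subgroup.coe_subtype] at hid
  rw [hc] at hid
  have hne : NeZero n := ⟨hn.ne'⟩
  have hcc : c * c = c := by
    have := congrFun (congrFun hid 0) 0
    simpa using this
  have hcc' : c = 0 ∨ c = 1 := by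
    have : c * (c - 1) = 0 := by rw [mul_sub, hcc]; simp
    rcases mul_eq_zero.1 this with h | h
    · exact Or.inl h
    · exact Or.inr (sub_eq_zero.1 h)
  rcases hcc' with rfl | rfl
  · right
    have h0 : ip (res M (fun g => (ρ g).trace)) 1 = 0 := by
      rw [ip_one_right]
      show avg (fun m : M => (ρ m).trace) = 0
      rw [← avg_trace, hc]; simp
    refine ⟨fun ht => ?_, h0⟩
    rw [ip_one_right] at h0
    have : res M (fun g => (ρ g).trace) = fun _ => (n : ℂ) := by
      ext m; have := ht m m.2; simp only [map_one, Matrix.trace_one, Fintype.card_fin] at this; exact this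
    rw [this, avg_const] at h0
    exact hn.ne' (by exact_mod_cast h0)
  · left
    intro m hm
    have h1 : ρ m * avg (fun k : M => ρ k) = avg (fun k : M => ρ k) := by
      rw [avg_mulLeft]
      simp only [← map_mul]
      exact avg_mul_left (fun k : M => ρ k) ⟨m, hm⟩
    rw [hc] at h1
    simpa using h1

theorem irr_not_triv {M : Subgroup G} [M.Normal] {χ : G → ℂ} (h : χ ∈ IrrChar G)
    (ht : ¬ Triv M χ) : ip (res M χ) 1 = 0 := by
  obtain ⟨n, ρ, rfl, h1, hn, -⟩ := irr_rep h
  rcases irr_triv (M := M) ρ hn h1 with h2 | h2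
  · exfalso; apply ht; intro m hm; simp [h2 m hm]
  · exact h2.2

theorem ip_triv {M : Subgroup G} {χ : G → ℂ} (ht : Triv M χ) : ip (res M χ) 1 = χ 1 := by
  rw [ip_one_right]
  have : res M χ = fun _ => χ 1 := by ext m; exact ht m m.2
  rw [this, avg_const]

/-- Lemma (b). -/
theorem central_eq {M : Subgroup G} [M.Normal] {ψ : G → ℂ} (hψ : ψ ∈ IrrChar G) {θ : M → ℂ}
    (hθ : θ ∈ IrrChar M) (hne : ip (res M ψ) θ ≠ 0) (φ : M → ℂ)
    (hφ : ∀ (g : G) (m : M), φ (MulAut.conjNormal g m) = φ m) :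
    avg (fun m => φ m * ψ m) * θ 1 = avg (fun m => φ m * θ m) * ψ 1 := by
  obtain ⟨n, ρ, rfl, h1, hn, -⟩ := irr_rep hψ
  obtain ⟨k, σ, rfl, h2, hk, -⟩ := irr_rep hθ
  obtain ⟨c, hc⟩ := central_scalar (K := M) ρ h1 (fun m => m) φ
    (fun g => (MulAut.conjNormal g).toEquiv) (fun g k => by simp) (fun g k => hφ g k)
  obtain ⟨d, hd⟩ := central_scalar (K := M) σ h2 (fun m => m) φ
    (fun g => (MulAut.conj g).toEquiv) (fun g k => by simp) (fun g k => by
      rw [← hφ g k]; congr 1)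
  obtain ⟨T, hT0, hT⟩ := exists_intertwiner (ρ.comp M.subtype) σ hne
  have hcd : c = d := by
    have h3 : avg (fun m : M => φ m • ρ m) * T = T * avg (fun m : M => φ m • σ m) := by
      rw [avg_mulRight, avg_mulLeft]; congr 1; ext1 m
      rw [Matrix.smul_mul, Matrix.mul_smul]; congr 1; exact hT m
    rw [hc, hd] at h3
    have h4 : (c - d) • T = 0 := by
      rw [sub_smul, sub_eq_zero]; simpa using h3
    rcases smul_eq_zero.1 h4 with h | h
    · exact sub_eq_zero.1 h
    · exact absurd h hT0
  have e1 : avg (fun m : M => φ m * (ρ m).trace) = c * n := by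
    have := congrArg Matrix.trace hc
    rw [avg_trace] at this
    simpa using this
  have e2 : avg (fun m : M => φ m * (σ m).trace) = d * k := by
    have := congrArg Matrix.trace hd
    rw [avg_trace] at this
    simpa using this
  simp only [e1, e2, hcd]
  simp
  ring

theorem clifford {M : Subgroup G} [M.Normal] {ψ : G → ℂ} (hψ : ψ ∈ IrrChar G) {θ α : M → ℂ}
    (hθ : θ ∈ IrrChar M) (hα : α ∈ IrrChar M)
    (h1 : ip (res M ψ) θ ≠ 0) (h2 : ip (res M ψ) α ≠ 0) : ∃ g : G, θ = cj g α := by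
  let φ : M → ℂ := fun m => avg (fun g : G => cj g α m⁻¹)
  have hφ : ∀ (g : G) (m : M), φ (MulAut.conjNormal g m) = φ m := by
    intro g m
    simp only [φ]
    rw [← avg_mul_right (fun x : G => cj x α m⁻¹) g]
    congr 1; ext1 x
    simp [cj, map_mul]
  have key : ∀ β : M → ℂ, avg (fun m => φ m * β m) = avg (fun g : G => ip β (cj g α)) := by
    intro β
    simp only [ip]
    rw [avg_comm]
    congr 1; ext1 m
    simp only [φ]
    rw [mul_comm, ← smul_eq_mul, ← avg_smul]
    rfl
  have hpos : avg (fun g : G => ip α (cj g α)) ≠ 0 := by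
    cases nonempty_fintype G
    rw [avg_eq, smul_eq_mul]
    refine mul_ne_zero (by simp) ?_
    have : ∀ g : G, ip α (cj g α) = mu α (cj g α) := fun g =>
      (irr_isChar hα).ip_eq' (irr_cj g hα)
    simp only [this]
    rw [← Nat.cast_sum]
    norm_cast
    intro h0
    have h3 := Finset.sum_eq_zero_iff.1 h0 1 (Finset.mem_univ _)
    have h4 : cj (1 : G) α = α := by ext m; simp [cj]
    have h5 := this 1
    rw [h3, h4, irr_norm hα] at h5
    simp at h5
  rw [← key] at hpos
  have e1 := central_eq hψ hα h2 φ hφ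
  have e2 := central_eq hψ hθ h1 φ hφ
  have hψ1 : ψ 1 ≠ 0 := by
    rw [(irr_isChar hψ).one_eq]; exact_mod_cast (irr_pos hψ).ne'
  have hθ1 : θ 1 ≠ 0 := by
    rw [(irr_isChar hθ).one_eq]; exact_mod_cast (irr_pos hθ).ne'
  have n1 : avg (fun m : M => φ m * ψ m) ≠ 0 := by
    intro h; rw [h, zero_mul] at e1
    exact mul_ne_zero hpos hψ1 e1.symm
  have n2 : avg (fun m : M => φ m * θ m) ≠ 0 := by
    intro h; rw [h, zero_mul] at e2
    exact mul_ne_zero n1 hθ1 e2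
  rw [key] at n2
  by_contra hcon
  push Not at hcon
  apply n2
  have : ∀ g : G, ip θ (cj g α) = 0 := fun g => irr_ip_ne hθ (irr_cj g hα) (hcon g)
  simp only [this, avg_zero]

theorem clifford_deg {M : Subgroup G} [M.Normal] {ψ : G → ℂ} (hψ : ψ ∈ IrrChar G) {θ α : M → ℂ}
    (hθ : θ ∈ IrrChar M) (hα : α ∈ IrrChar M)
    (h1 : ip (res M ψ) θ ≠ 0) (h2 : ip (res M ψ) α ≠ 0) : charDeg θ = charDeg α := by
  obtain ⟨g, rfl⟩ := clifford hψ hθ hα h1 h2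
  exact charDeg_cj g α

theorem IsChar.deg_dvd {χ : G → ℂ} (h : IsChar χ) (d : ℕ)
    (hd : ∀ ψ ∈ IrrChar G, ip χ ψ ≠ 0 → d ∣ charDeg ψ) : d ∣ charDeg χ := by
  rw [h.deg_eq_sum]
  refine Finset.dvd_sum fun ψ hψ => ?_
  by_cases h0 : mu χ ψ = 0
  · simp [h0]
  · exact Dvd.dvd.mul_left (hd ψ (mem_Irr.1 hψ) ((mu_ne_zero h (irr_isChar (mem_Irr.1 hψ))).1 h0)) _

theorem clifford_dvd {M : Subgroup G} [M.Normal] {ψ : G → ℂ} (hψ : ψ ∈ IrrChar G) {θ : M → ℂ}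
    (hθ : θ ∈ IrrChar M) (h1 : ip (res M ψ) θ ≠ 0) : charDeg θ ∣ charDeg ψ := by
  rw [← charDeg_res M ψ]
  refine ((irr_isChar hψ).res M).deg_dvd _ fun α hα h2 => ?_
  rw [clifford_deg hψ hθ hα h1 h2]

theorem isChar_res_ne {M : Subgroup G} {ψ : G → ℂ} (hψ : ψ ∈ IrrChar G) : res M ψ ≠ 0 := by
  intro h
  have := irr_pos hψ
  rw [← charDeg_res M ψ, h, charDeg_zero] at this
  exact lt_irrefl _ this

theorem IsChar.eq_of_deg {χ ψ : G → ℂ} (h : IsChar χ) (hψ : ψ ∈ IrrChar G) (hne : ip χ ψ ≠ 0)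
    (hd : charDeg χ ≤ charDeg ψ) : χ = ψ := by
  have h1 := h.peel hψ hne
  have h2 := (irr_isChar hψ).charDeg_sub h1
  exact sub_eq_zero.1 (h1.eq_zero (by omega))

/-- Linear characters of perfect groups are trivial. -/
theorem linear_eq_one (hG : commutator G = ⊤) {χ : G → ℂ} (h : IsChar χ) (h1 : charDeg χ = 1) :
    χ = 1 := by
  obtain ⟨f, hf⟩ := h.linear h1
  have : commutator G ≤ f.ker := Abelianization.commutator_subset_ker f
  rw [hG] at this
  ext g
  have := this (Subgroup.mem_top g)
  rw [MonoidHom.mem_ker] at this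
  simp [hf, this]

theorem linear_triv {M : Subgroup G} (hM : commutator M = ⊤) {χ : G → ℂ} (h : IsChar χ)
    (h1 : charDeg χ = 1) : Triv M χ := by
  have h2 : res M χ = 1 := linear_eq_one hM (h.res M) h1
  intro m hm
  have e1 := congrFun h2 ⟨m, hm⟩
  have e2 := congrFun h2 1
  exact e1.trans e2.symm

theorem res_irr_of_deg {M : Subgroup G} [M.Normal] (hM : commutator M = ⊤) {ψ : G → ℂ}
    (hψ : ψ ∈ IrrChar G) (ht : ¬ Triv M ψ)
    (hd : ∀ θ ∈ IrrChar M, charDeg θ ∣ charDeg ψ → charDeg θ = 1 ∨ charDeg θ = charDeg ψ) :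
    res M ψ ∈ IrrChar M := by
  obtain ⟨θ, hθ, hne⟩ := ((irr_isChar hψ).res M).exists_constituent (isChar_res_ne hψ)
  rcases hd θ hθ (clifford_dvd hψ hθ hne) with h1 | h1
  · exfalso
    rw [linear_eq_one hM (irr_isChar hθ) h1] at hne
    exact hne (irr_not_triv hψ ht)
  · rw [((irr_isChar hψ).res M).eq_of_deg hθ hne (by rw [charDeg_res, h1])]
    exact hθ

theorem res_irr_of_prime {M : Subgroup G} [M.Normal] (hM : commutator M = ⊤) {ψ : G → ℂ}
    (hψ : ψ ∈ IrrChar G) (ht : ¬ Triv M ψ) (hp : (charDeg ψ).Prime) :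
    res M ψ ∈ IrrChar M :=
  res_irr_of_deg hM hψ ht fun _ _ h => (Nat.dvd_prime hp).1 h

open scoped Classical in
/-- The trivial part of the restriction. -/
theorem IsChar.mu_res_one {A : G → ℂ} (h : IsChar A) (M : Subgroup G) [M.Normal] :
    mu (ACD.res M A) 1 = ∑ ψ ∈ (Irr G).filter (Triv M), mu A ψ * charDeg ψ := by
  have h1 : ip (ACD.res M A) 1 = ∑ ψ ∈ Irr G, ip A ψ * ip (ACD.res M ψ) 1 := by
    nth_rewrite 1 [h.eq_sum]
    rw [res_sum, ip_sum_left]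
    simp only [res_smul, ip_smul_left]
  rw [(h.res M).ip_eq isChar_one] at h1
  rw [Finset.sum_filter]
  have : ∀ ψ ∈ Irr G, ip A ψ * ip (ACD.res M ψ) 1 =
      ((if Triv M ψ then mu A ψ * charDeg ψ else 0 : ℕ) : ℂ) := by
    intro ψ hψ
    have hψ := mem_Irr.1 hψ
    split_ifs with ht
    · rw [ip_triv ht, (irr_isChar hψ).one_eq, h.ip_eq' hψ]; simp
    · rw [irr_not_triv hψ ht]; simp
  rw [Finset.sum_congr rfl this] at h1
  exact_mod_cast h1

theorem Triv.constituent {A : G → ℂ} (h : IsChar A) {M : Subgroup G} [M.Normal] (ht : Triv M A)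
    {ψ : G → ℂ} (hψ : ψ ∈ IrrChar G) (hne : ip A ψ ≠ 0) : Triv M ψ := by
  classical
  by_contra hnt
  have h1 := h.mu_res_one M
  have h2 := h.deg_eq_sum
  have h3 : mu (ACD.res M A) 1 = charDeg A := by
    have := ip_triv ht
    rw [(h.res M).ip_eq isChar_one, h.one_eq] at this
    exact_mod_cast this
  have h8 := Finset.sum_filter_add_sum_filter_not (Irr G) (Triv M) (fun ψ => mu A ψ * charDeg ψ)
  have h4 : ∑ ψ ∈ (Irr G).filter (fun ψ => ¬ Triv M ψ), mu A ψ * charDeg ψ = 0 := by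
    rw [← h2, ← h3, h1] at h8
    have h9 : ∑ ψ ∈ Irr G with Triv M ψ, mu A ψ * charDeg ψ = ∑ ψ ∈ (Irr G).filter (Triv M), mu A ψ * charDeg ψ := by
      congr!
    omega
  have h5 := Finset.sum_eq_zero_iff.1 h4 ψ (by simp [hψ, hnt])
  have h6 := (mu_ne_zero h (irr_isChar hψ)).2 hne
  have h7 := irr_pos hψ
  rcases Nat.mul_eq_zero.1 h5 with h | h
  · exact h6 h
  · omega

/-- If `χ` restricts irreducibly, `χχ*` contains no nontrivial constituent trivial on `M`. -/
theorem mu_triv_self {M : Subgroup G} [M.Normal] {χ : G → ℂ} (hχ : IsChar χ)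
    (hr : res M χ ∈ IrrChar M) {ψ : G → ℂ} (hψ : ψ ∈ IrrChar G) (ht : Triv M ψ) (h1 : ψ ≠ 1) :
    ip (χ * dual χ) ψ = 0 := by
  classical
  have hD := hχ.mul hχ.dual
  have e := hD.mu_res_one M
  have e1 : mu (res M (χ * dual χ)) 1 = 1 := by
    have : ip (res M (χ * dual χ)) 1 = 1 := by
      rw [res_mul, res_dual, ip_mul_left, dual_dual, mul_one, irr_norm hr]
    rw [(hD.res M).ip_eq isChar_one] at this
    exact_mod_cast this
  have e2 : mu (χ * dual χ) 1 ≠ 0 := by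
    rw [mu_ne_zero hD isChar_one]
    rw [ip_mul_left, mul_one, dual_dual]
    intro h0
    have := hχ.norm_eq_zero h0
    rw [this] at hr
    exact irr_ne_zero hr rfl
  rw [e1] at e
  by_contra hne
  have e3 := (mu_ne_zero hD (irr_isChar hψ)).2 hne
  have hsub : ({1, ψ} : Finset (G → ℂ)) ⊆ (Irr G).filter (Triv M) := by
    intro x hx
    simp at hx
    rcases hx with rfl | rfl
    · simp [irr_one, triv_one]
    · simp [hψ, ht]
  have h2 := Finset.sum_le_sum_of_subset (f := fun ψ => mu (χ * dual χ) ψ * charDeg ψ) hsub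
  rw [Finset.sum_pair (Ne.symm h1), ← e, charDeg_one] at h2
  have h3 := Nat.mul_le_mul (Nat.pos_of_ne_zero e3) (irr_pos hψ)
  have h4 := Nat.pos_of_ne_zero e2
  omega

theorem irr_of_res {M : Subgroup G} {χ : G → ℂ} (hχ : IsChar χ)
    (hr : res M χ ∈ IrrChar M) : χ ∈ IrrChar G := by
  refine mem_irr_iff.2 ⟨hχ, ?_⟩
  by_contra h1
  have h0 : χ ≠ 0 := by rintro rfl; exact irr_ne_zero hr rfl
  obtain ⟨α, β, hα, hβ, hα0, hβ0, rfl⟩ := hχ.split h0 h1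
  have h2 := irr_norm hr
  have hz : ∀ γ : G → ℂ, IsChar γ → γ ≠ 0 → mu (res M γ) (res M γ) ≠ 0 := by
    intro γ h h'
    rw [mu_ne_zero (h.res M) (h.res M)]
    intro h3
    have := (h.res M).norm_eq_zero h3
    have h4 := h.pos h'
    rw [← charDeg_res M, this, charDeg_zero] at h4
    exact lt_irrefl _ h4
  rw [res_add, ip_add_left, ip_add_right, ip_add_right, (hα.res M).ip_eq (hα.res M),
    (hα.res M).ip_eq (hβ.res M), (hβ.res M).ip_eq (hα.res M), (hβ.res M).ip_eq (hβ.res M)] at h2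
  have := hz α hα hα0
  have := hz β hβ hβ0
  norm_cast at h2
  omega

theorem gallagher_ip {M : Subgroup G} [M.Normal] {χ : G → ℂ} (hχ : IsChar χ)
    (hr : res M χ ∈ IrrChar M) {A : G → ℂ} (hA : IsChar A) (ht : Triv M A) :
    ip (A * χ) χ = ip A 1 := by
  rw [ip_mul_left, mul_comm, hA.ip_eq_sum, hA.ip_eq_sum]
  refine Finset.sum_congr rfl fun ψ hψ => ?_
  have hψ := mem_Irr.1 hψ
  by_cases hne : ip A ψ = 0
  · simp [hne]
  · have h1 := ht.constituent hA hψ hne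
    congr 1
    by_cases h2 : ψ = 1
    · rw [h2, irr_norm irr_one, ip_comm, ip_mul_left, mul_one, dual_dual, irr_norm (irr_of_res hχ hr)]
    · rw [ip_comm, mu_triv_self hχ hr hψ h1 h2, irr_ip_ne hψ irr_one h2]

theorem gallagher_ip2 {M : Subgroup G} [M.Normal] {χ : G → ℂ} (hχ : IsChar χ)
    (hr : res M χ ∈ IrrChar M) {A B : G → ℂ} (hA : IsChar A) (ht : Triv M A) (hB : IsChar B)
    (htB : Triv M B) : ip (A * χ) (B * χ) = ip A B := by
  rw [mul_comm B χ, ip_mul_right, ← mul_assoc, gallagher_ip hχ hr (hB.dual.mul hA) (htB.dual.mul ht),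
    mul_comm, ip_mul_left]; simp

theorem gallagher_irr {M : Subgroup G} [M.Normal] {χ : G → ℂ} (hχ : IsChar χ)
    (hr : res M χ ∈ IrrChar M) {A : G → ℂ} (hA : A ∈ IrrChar G) (ht : Triv M A) :
    A * χ ∈ IrrChar G :=
  mem_irr_iff.2 ⟨(irr_isChar hA).mul hχ, by
    rw [gallagher_ip2 hχ hr (irr_isChar hA) ht (irr_isChar hA) ht, irr_norm hA]⟩

theorem gallagher_inj {M : Subgroup G} [M.Normal] {χ : G → ℂ} (hχ : IsChar χ)
    (hr : res M χ ∈ IrrChar M) {A B : G → ℂ} (hA : A ∈ IrrChar G) (ht : Triv M A)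
    (hB : B ∈ IrrChar G) (htB : Triv M B) (h : A * χ = B * χ) : A = B := by
  by_contra hne
  have := gallagher_ip2 hχ hr (irr_isChar hA) ht (irr_isChar hB) htB
  rw [h, irr_norm (gallagher_irr hχ hr hB htB), irr_ip_ne hA hB hne] at this
  exact one_ne_zero this

theorem gallagher_not_triv {M : Subgroup G} [M.Normal] {χ : G → ℂ} (hχ : IsChar χ)
    (hr : res M χ ∈ IrrChar M) (h1 : ¬ Triv M χ) {A : G → ℂ} (hA : A ∈ IrrChar G)
    (ht : Triv M A) : ¬ Triv M (A * χ) := by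
  intro h
  apply h1
  intro m hm
  have h2 := h m hm
  have h3 : A 1 ≠ 0 := by
    rw [(irr_isChar hA).one_eq]; exact_mod_cast (irr_pos hA).ne'
  simp only [Pi.mul_apply, ht m hm] at h2
  exact mul_left_cancel₀ h3 h2

/-- Characters with the same irreducible restriction differ by a linear character. -/
theorem same_res {M : Subgroup G} [M.Normal] {χ χ' : G → ℂ} (hχ : IsChar χ) (hχ' : IsChar χ')
    (hr : res M χ ∈ IrrChar M) (he : res M χ' = res M χ) :
    ∃ l ∈ IrrChar G, charDeg l = 1 ∧ Triv M l ∧ χ' = l * χ := by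
  classical
  have hD := hχ'.mul hχ.dual
  have e := hD.mu_res_one M
  have e1 : mu (res M (χ' * dual χ)) 1 = 1 := by
    have : ip (res M (χ' * dual χ)) 1 = 1 := by
      rw [res_mul, res_dual, ip_mul_left, dual_dual, mul_one, he, irr_norm hr]
    rw [(hD.res M).ip_eq isChar_one] at this
    exact_mod_cast this
  rw [e1] at e
  obtain ⟨l, hl, hl0⟩ := Finset.exists_ne_zero_of_sum_ne_zero (by rw [← e]; exact one_ne_zero)
  have hle := Finset.single_le_sum (f := fun ψ => mu (χ' * dual χ) ψ * charDeg ψ)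
    (fun _ _ => Nat.zero_le _) hl
  rw [← e] at hle
  simp only [Finset.mem_filter, mem_Irr] at hl
  have h3 : mu (χ' * dual χ) l * charDeg l = 1 := by
    have := Nat.pos_of_ne_zero hl0
    omega
  have h4 := mul_eq_one.1 h3
  refine ⟨l, hl.1, h4.2, hl.2, ?_⟩
  have h5 : ip (χ' * dual χ) l ≠ 0 := (mu_ne_zero hD (irr_isChar hl.1)).1 (by omega)
  rw [ip_mul_left, dual_dual, mul_comm] at h5
  exact irr_eq_of_ip (irr_of_res hχ' (he ▸ hr)) (gallagher_irr hχ hr hl.1 hl.2) h5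

/-- Irreducible characters trivial on `M` come from the quotient. -/
theorem irr_quotient {M : Subgroup G} [M.Normal] {χ : G → ℂ} (h : χ ∈ IrrChar G) (ht : Triv M χ) :
    ∃ ψ ∈ IrrChar (G ⧸ M), χ = fun g => ψ (QuotientGroup.mk' M g) := by
  obtain ⟨n, ρ, rfl, h1, hn, -⟩ := irr_rep h
  rcases irr_triv (M := M) ρ hn h1 with h2 | h2
  · let σ : G ⧸ M →* Matrix (Fin n) (Fin n) ℂ := QuotientGroup.lift M ρ h2
    have e : (fun g => (ρ g).trace) = fun g => (fun x => (σ x).trace) (QuotientGroup.mk' M g) := by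
      ext g; rfl
    refine ⟨fun x => (σ x).trace, mem_irr_iff.2 ⟨⟨n, σ, fun _ => rfl⟩, ?_⟩, e⟩
    rw [← ip_surj (QuotientGroup.mk' M) (QuotientGroup.mk'_surjective M)]
    exact h1
  · exact absurd ht h2.1

theorem quotient_triv {M : Subgroup G} [M.Normal] (ψ : G ⧸ M → ℂ) :
    Triv M (fun g => ψ (QuotientGroup.mk' M g)) := by
  intro m hm
  have : QuotientGroup.mk' M m = QuotientGroup.mk' M 1 := by
    rw [map_one]; exact (QuotientGroup.eq_one_iff m).2 hm
  simp only [this]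

open scoped Classical in
theorem sum_quotient {M : Subgroup G} [M.Normal] (F : ℕ → ℤ) :
    ∑ ψ ∈ Irr (G ⧸ M), F (charDeg ψ) = ∑ χ ∈ (Irr G).filter (Triv M), F (charDeg χ) := by
  refine Finset.sum_bij (fun ψ _ => fun g => ψ (QuotientGroup.mk' M g)) ?_ ?_ ?_ ?_
  · intro ψ hψ
    simp only [Finset.mem_filter, mem_Irr] at *
    exact ⟨irr_surj _ (QuotientGroup.mk'_surjective M) hψ, quotient_triv ψ⟩
  · intro a _ b _ hab
    ext x
    obtain ⟨g, rfl⟩ := QuotientGroup.mk'_surjective M x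
    exact congrFun hab g
  · intro χ hχ
    simp only [Finset.mem_filter, mem_Irr] at hχ
    obtain ⟨ψ, hψ, e⟩ := irr_quotient hχ.1 hχ.2
    exact ⟨ψ, mem_Irr.2 hψ, e.symm⟩
  · intro ψ hψ
    congr 1

end
end ACD

namespace ACD
open Matrix
section
variable {G : Type} [Group G] [Finite G]

theorem norm_sum_le (s : Multiset ℂ) (h : ∀ z ∈ s, ‖z‖ = 1) : ‖s.sum‖ ≤ s.card := by
  induction s using Multiset.induction with
  | empty => simp
  | cons a s ih =>
    rw [Multiset.sum_cons, Multiset.card_cons]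
    have h1 := h a (by simp)
    have h2 := ih (fun z hz => h z (by simp [hz]))
    have := norm_add_le a s.sum
    push_cast
    linarith

theorem re_sum_le (s : Multiset ℂ) (h : ∀ z ∈ s, ‖z‖ = 1) (he : (s.card : ℝ) ≤ s.sum.re) :
    ∀ z ∈ s, z = 1 := by
  induction s using Multiset.induction with
  | empty => simp
  | cons a s ih =>
    have h1 := h a (by simp)
    have h2 : ∀ z ∈ s, ‖z‖ = 1 := fun z hz => h z (by simp [hz])
    have h3 : s.sum.re ≤ s.card := (Complex.re_le_norm _).trans (norm_sum_le s h2)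
    have h4 : a.re ≤ 1 := h1 ▸ Complex.re_le_norm a
    rw [Multiset.sum_cons, Multiset.card_cons] at he
    push_cast at he
    simp only [Complex.add_re] at he
    have h5 : a.re = 1 := by linarith
    have h6 : a = 1 := by
      have : a.re ^ 2 + a.im ^ 2 = 1 := by
        have := Complex.sq_norm a
        rw [h1, Complex.normSq_apply] at this
        nlinarith
      apply Complex.ext
      · simp [h5]
      · rw [h5] at this
        have : a.im ^ 2 = 0 := by linarith
        simpa using this
    intro z hz
    rcases Multiset.mem_cons.1 hz with rfl | hz
    · exact h6
    · exact ih h2 (by linarith) z hz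

theorem sum_eq_card (s : Multiset ℂ) (h : ∀ z ∈ s, ‖z‖ = 1) (he : ‖s.sum‖ = s.card)
    (h0 : 0 < s.card) : ∃ c : ℂ, c ≠ 0 ∧ ∀ z ∈ s, z = c := by
  have hs : s.sum ≠ 0 := by
    intro h'
    rw [h', norm_zero] at he
    have : s.card = 0 := by exact_mod_cast he.symm
    omega
  have hs' : (‖s.sum‖ : ℂ) ≠ 0 := by simpa using hs
  set u : ℂ := ‖s.sum‖ / s.sum with hu
  have hu1 : ‖u‖ = 1 := by rw [hu, norm_div]; simp [hs]
  have hu0 : u ≠ 0 := div_ne_zero hs' hs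
  refine ⟨u⁻¹, inv_ne_zero hu0, ?_⟩
  have h1 := re_sum_le (s.map (fun z => u * z)) (by
    intro z hz
    obtain ⟨w, hw, rfl⟩ := Multiset.mem_map.1 hz
    rw [norm_mul, hu1, h w hw, one_mul]) (by
    rw [Multiset.card_map, Multiset.sum_map_mul_left, Multiset.map_id', hu, div_mul_cancel₀ _ hs,
      Complex.ofReal_re, he])
  intro z hz
  have := h1 (u * z) (Multiset.mem_map_of_mem _ hz)
  exact eq_inv_of_mul_eq_one_right this

theorem norm_root {N : ℕ} (hN : N ≠ 0) {z : ℂ} (h : z ^ N = 1) : ‖z‖ = 1 :=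
  Complex.norm_eq_one_of_pow_eq_one h hN

/-- Key lemma for Burnside's theorem. -/
theorem integral_avg {N : ℕ} (hN : N ≠ 0) (s : Multiset ℂ) (h : ∀ z ∈ s, z ^ N = 1)
    (h0 : 0 < s.card) (hi : IsIntegral ℤ (s.sum / s.card)) :
    s.sum = 0 ∨ ‖s.sum‖ = s.card := by
  by_contra hcon
  push Not at hcon
  obtain ⟨hs, hlt⟩ := hcon
  have hlt : ‖s.sum‖ < s.card :=
    lt_of_le_of_ne (norm_sum_le s fun z hz => norm_root hN (h z hz)) hlt
  have hc : (0 : ℝ) < s.card := by exact_mod_cast h0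
  let R : Set ℂ := {z | z ^ N = 1}
  have hRi : ∀ z ∈ R, IsIntegral ℚ z := by
    intro z hz
    have : IsIntegral ℚ (z ^ N) := by rw [show z ^ N = 1 from hz]; exact isIntegral_one
    exact this.of_pow (Nat.pos_of_ne_zero hN)
  have hRf : R.Finite := by
    have : R ⊆ ((Polynomial.nthRoots N (1 : ℂ)).toFinset : Set ℂ) := by
      intro z hz
      simp only [Finset.mem_coe, Multiset.mem_toFinset]
      exact (Polynomial.mem_nthRoots (Nat.pos_of_ne_zero hN)).2 hz
    exact Set.Finite.subset (Finset.finite_toSet _) this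
  let K := IntermediateField.adjoin ℚ R
  have : Finite R := hRf
  have : FiniteDimensional ℚ K := IntermediateField.finiteDimensional_adjoin hRi
  have hmem : ∀ z ∈ s, z ∈ K := fun z hz => IntermediateField.subset_adjoin ℚ R (h z hz)
  have hsum : s.sum ∈ K := multiset_sum_mem s hmem
  have hα : s.sum / s.card ∈ K := K.div_mem hsum (natCast_mem K _)
  let a : K := ⟨s.sum / s.card, hα⟩
  have ha : IsIntegral ℤ a := by
    have : IsIntegral ℤ (algebraMap K ℂ a) := hi
    exact (isIntegral_algebraMap_iff (algebraMap K ℂ).injective).1 this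
  have hn := Algebra.isIntegral_norm ℚ ha
  obtain ⟨m, hm⟩ := IsIntegrallyClosed.isIntegral_iff.1 hn
  have hp := Algebra.norm_eq_prod_embeddings ℚ ℂ a
  -- every embedding has norm at most one
  have hle : ∀ σ : K →ₐ[ℚ] ℂ, ‖σ a‖ ≤ 1 := by
    intro σ
    let t : Multiset K := s.attach.map (fun z => ⟨z.1, hmem z.1 z.2⟩)
    have ht : s = t.map (algebraMap K ℂ) := by
      simp only [t, Multiset.map_map, Function.comp_def]
      exact (Multiset.attach_map_val s).symm
    have hts : t.sum = (⟨s.sum, hsum⟩ : K) := by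
      apply (algebraMap K ℂ).injective
      rw [map_multiset_sum, ← ht]; rfl
    have e : a = t.sum / (s.card : K) := by
      rw [hts]
      apply (algebraMap K ℂ).injective
      rw [map_div₀, map_natCast]; rfl
    have h2 : ‖(t.map σ).sum‖ ≤ (t.map σ).card := by
      apply norm_sum_le
      intro z hz
      obtain ⟨w, hw, rfl⟩ := Multiset.mem_map.1 hz
      apply norm_root hN
      rw [← map_pow]
      have : w ^ N = 1 := by
        apply (algebraMap K ℂ).injective
        rw [map_pow, map_one]
        apply h
        rw [ht]
        exact Multiset.mem_map_of_mem _ hw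
      rw [this, map_one]
    have hcard : (t.map σ).card = s.card := by simp [t]
    rw [hcard] at h2
    rw [e, map_div₀, map_natCast, map_multiset_sum, norm_div]
    simp only [Complex.norm_natCast]
    rw [div_le_one hc]
    exact h2
  have hlt1 : ‖K.val a‖ < 1 := by
    change ‖s.sum / s.card‖ < 1
    rw [norm_div, Complex.norm_natCast, div_lt_one hc]
    exact hlt
  have h3 : ‖∏ σ : K →ₐ[ℚ] ℂ, σ a‖ < 1 := by
    classical
    rw [norm_prod, ← Finset.mul_prod_erase Finset.univ (fun σ : K →ₐ[ℚ] ℂ => ‖σ a‖) (Finset.mem_univ K.val)]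
    have : ∏ σ ∈ Finset.univ.erase K.val, ‖σ a‖ ≤ 1 :=
      Finset.prod_le_one (fun _ _ => norm_nonneg _) (fun σ _ => hle σ)
    have h0 : 0 ≤ ∏ σ ∈ Finset.univ.erase K.val, ‖σ a‖ :=
      Finset.prod_nonneg (fun _ _ => norm_nonneg _)
    exact lt_of_le_of_lt (mul_le_of_le_one_right (norm_nonneg _) this) hlt1
  rw [← hp, ← hm] at h3
  have h4 : m = 0 := by
    simp only [eq_intCast, map_intCast, Complex.norm_intCast] at h3
    have : |m| < 1 := by exact_mod_cast h3
    exact Int.abs_lt_one_iff.1 this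
  rw [h4, map_zero] at hm
  have h5 := Algebra.norm_eq_zero_iff.1 hm.symm
  have h6 : s.sum / s.card = 0 := congrArg (algebraMap K ℂ) h5
  rcases div_eq_zero_iff.1 h6 with h7 | h7
  · exact hs h7
  · have : s.card = 0 := by exact_mod_cast h7
    omega

theorem rep_pow {n : ℕ} (ρ : G →* Matrix (Fin n) (Fin n) ℂ) (g : G) : ρ g ^ Nat.card G = 1 := by
  rw [← map_pow, pow_card_eq_one', map_one]

theorem eig_pow {n N : ℕ} (A : Matrix (Fin n) (Fin n) ℂ) (h : A ^ N = 1) {z : ℂ}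
    (hz : z ∈ A.charpoly.roots) : z ^ N = 1 := by
  have h1 : A.charpoly.IsRoot z := Polynomial.isRoot_of_mem_roots hz
  have h2 : z ∈ spectrum ℂ A := Matrix.mem_spectrum_of_isRoot_charpoly h1
  have h3 : z ^ N ∈ spectrum ℂ (A ^ N) := spectrum.pow_mem_pow A N h2
  rw [h] at h3
  by_contra hne
  apply h3
  have : algebraMap ℂ (Matrix (Fin n) (Fin n) ℂ) (z ^ N) - 1 = algebraMap ℂ _ (z ^ N - 1) := by
    rw [map_sub, map_one]
  change IsUnit _
  rw [this]
  exact (IsUnit.mk0 _ (sub_ne_zero.2 hne)).map (algebraMap ℂ (Matrix (Fin n) (Fin n) ℂ))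

theorem roots_card {n : ℕ} (A : Matrix (Fin n) (Fin n) ℂ) : A.charpoly.roots.card = n := by
  rw [IsAlgClosed.card_roots_eq_natDegree, Matrix.charpoly_natDegree_eq_dim, Fintype.card_fin]

theorem norm_trace_le {n : ℕ} (ρ : G →* Matrix (Fin n) (Fin n) ℂ) (g : G) :
    ‖(ρ g).trace‖ ≤ n := by
  rw [Matrix.trace_eq_sum_roots_charpoly]
  have := norm_sum_le _ (fun z hz => norm_root (Nat.card_pos (α := G)).ne' (eig_pow _ (rep_pow ρ g) hz))
  rwa [roots_card] at this

theorem scalar_of_norm {n : ℕ} (hn : 0 < n) (ρ : G →* Matrix (Fin n) (Fin n) ℂ) (g : G)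
    (h : ‖(ρ g).trace‖ = n) : ∃ c : ℂ, ρ g = c • 1 := by
  have hN := (Nat.card_pos (α := G)).ne'
  have hr := roots_card (ρ g)
  obtain ⟨c, hc0, hc⟩ := sum_eq_card (ρ g).charpoly.roots
    (fun z hz => norm_root hN (eig_pow _ (rep_pow ρ g) hz))
    (by rw [← Matrix.trace_eq_sum_roots_charpoly, h, hr]) (by rw [hr]; exact hn)
  have hrep : (ρ g).charpoly.roots = Multiset.replicate n c :=
    Multiset.eq_replicate.2 ⟨hr, hc⟩
  have hcp : (ρ g).charpoly = (Polynomial.X - Polynomial.C c) ^ n := by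
    have := (IsAlgClosed.splits (ρ g).charpoly).eq_prod_roots_of_monic (Matrix.charpoly_monic _)
    rw [hrep] at this
    simpa using this
  have hcN : c ^ Nat.card G = 1 := by
    apply eig_pow _ (rep_pow ρ g)
    rw [hrep, Multiset.mem_replicate]
    exact ⟨hn.ne', rfl⟩
  let P : Polynomial ℂ := Polynomial.X ^ Nat.card G - 1
  have hsep : P.Separable := by
    have := Polynomial.separable_X_pow_sub_C (1 : ℂ) (n := Nat.card G) (by exact_mod_cast hN) one_ne_zero
    simpa using this
  have hroot : P.IsRoot c := by simp [P, hcN]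
  obtain ⟨q, hq⟩ := Polynomial.dvd_iff_isRoot.2 hroot
  have hcop : IsCoprime (Polynomial.X - Polynomial.C c) q := by
    rw [hq] at hsep
    exact hsep.isCoprime
  have hcop' : IsCoprime ((Polynomial.X - Polynomial.C c) ^ n) q := hcop.pow_left
  obtain ⟨a, b, hab⟩ := hcop'
  have e1 : Polynomial.aeval (ρ g) ((Polynomial.X - Polynomial.C c) ^ n) = 0 := by
    rw [← hcp]; exact Matrix.aeval_self_charpoly _
  have e2 : Polynomial.aeval (ρ g) b * Polynomial.aeval (ρ g) q = 1 := by
    have := congrArg (Polynomial.aeval (ρ g)) hab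
    rwa [map_add, map_mul, map_mul, e1, mul_zero, zero_add, map_one] at this
  have e3 : Polynomial.aeval (ρ g) (q * (Polynomial.X - Polynomial.C c)) = 0 := by
    rw [mul_comm, ← hq]
    simp [P, rep_pow ρ g]
  rw [map_mul] at e3
  have e4 : Polynomial.aeval (ρ g) (Polynomial.X - Polynomial.C c) = 0 := by
    rw [← one_mul (Polynomial.aeval (ρ g) (Polynomial.X - Polynomial.C c)), ← e2, mul_assoc, e3,
      mul_zero]
  refine ⟨c, ?_⟩
  simp only [map_sub, Polynomial.aeval_X, Polynomial.aeval_C] at e4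
  rw [sub_eq_zero] at e4
  rw [e4, Algebra.algebraMap_eq_smul_one]

theorem one_of_trace {n : ℕ} (ρ : G →* Matrix (Fin n) (Fin n) ℂ) (g : G)
    (h : (ρ g).trace = n) : ρ g = 1 := by
  rcases Nat.eq_zero_or_pos n with rfl | hn
  · ext i; exact i.elim0
  obtain ⟨c, hc⟩ := scalar_of_norm hn ρ g (by rw [h]; simp)
  rw [hc, Matrix.trace_smul, Matrix.trace_one, Fintype.card_fin, smul_eq_mul] at h
  have h0 : (n : ℂ) ≠ 0 := by exact_mod_cast hn.ne'
  have : c = 1 := mul_right_cancel₀ h0 (by rw [h, one_mul])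
  rw [hc, this, one_smul]

theorem trace_integral {n : ℕ} (ρ : G →* Matrix (Fin n) (Fin n) ℂ) (g : G) :
    IsIntegral ℤ (ρ g).trace := by
  rw [Matrix.trace_eq_sum_roots_charpoly]
  apply IsIntegral.multiset_sum
  intro z hz
  have : IsIntegral ℤ (z ^ Nat.card G) := by
    rw [eig_pow _ (rep_pow ρ g) hz]; exact isIntegral_one
  exact this.of_pow Nat.card_pos

theorem burnside_trace {n : ℕ} (hn : 0 < n) (ρ : G →* Matrix (Fin n) (Fin n) ℂ) (g : G)
    (h : IsIntegral ℤ ((ρ g).trace / n)) : (ρ g).trace = 0 ∨ ∃ c : ℂ, ρ g = c • 1 := by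
  have h1 := integral_avg (Nat.card_pos (α := G)).ne' (ρ g).charpoly.roots
    (fun z hz => eig_pow _ (rep_pow ρ g) hz) (by rw [roots_card]; exact hn)
    (by rw [roots_card, ← Matrix.trace_eq_sum_roots_charpoly]; exact h)
  rw [← Matrix.trace_eq_sum_roots_charpoly, roots_card] at h1
  exact h1.imp id (scalar_of_norm hn ρ g)

end
end ACD

namespace ACD
open Matrix
section
variable {G : Type} [Group G] [Finite G]

theorem int_sum [Fintype G] {n : ℕ} (hn : 0 < n) (ρ : G →* Matrix (Fin n) (Fin n) ℂ)
    (h : ip (fun g => (ρ g).trace) (fun g => (ρ g).trace) = 1) (φ : G → ℂ)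
    (hφ : ∀ g k, φ (g * k * g⁻¹) = φ k) (hi : ∀ g, IsIntegral ℤ (φ g)) :
    IsIntegral ℤ ((∑ g, φ g * (ρ g).trace) / n) := by
  obtain ⟨c, hc⟩ := central_scalar ρ h id φ (fun g => (MulAut.conj g).toEquiv) (fun g k => rfl) hφ
  have hG : (Nat.card G : ℂ) ≠ 0 := by exact_mod_cast (Nat.card_pos (α := G)).ne'
  have hn0 : (n : ℂ) ≠ 0 := by exact_mod_cast hn.ne'
  set w : ℂ := Nat.card G * c with hw
  have hT : ∑ g, φ g • ρ g = w • (1 : Matrix (Fin n) (Fin n) ℂ) := by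
    rw [avg_eq] at hc
    rw [hw, mul_smul, ← hc, smul_smul, mul_inv_cancel₀ hG, one_smul]
    rfl
  have e : (∑ g, φ g * (ρ g).trace) / n = w := by
    have := congrArg Matrix.trace hT
    rw [Matrix.trace_sum] at this
    simp only [Matrix.trace_smul, Matrix.trace_one, Fintype.card_fin, smul_eq_mul] at this
    rw [this, mul_div_cancel_right₀ _ hn0]
  rw [e]
  let R := integralClosure ℤ ℂ
  let N : Submodule R (Matrix (Fin n) (Fin n) ℂ) := Submodule.span R (Set.range ρ)
  have h1 : IsIntegral R w := by
    refine isIntegral_of_smul_mem_submodule N ?_ (Submodule.fg_span (Set.finite_range ρ)) w ?_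
    · intro hb
      have : ρ 1 ∈ N := Submodule.subset_span ⟨1, rfl⟩
      rw [hb, Submodule.mem_bot, map_one] at this
      have h2 := congrFun (congrFun this ⟨0, hn⟩) ⟨0, hn⟩
      simp at h2
    · intro x hx
      induction hx using Submodule.span_induction with
      | mem x hx =>
        obtain ⟨y, rfl⟩ := hx
        have : w • ρ y = ∑ g, (⟨φ g, hi g⟩ : R) • ρ (y * g) := by
          have e2 : w • ρ y = ρ y * (∑ g, φ g • ρ g) := by rw [hT]; simp
          rw [e2, Finset.mul_sum]
          refine Finset.sum_congr rfl fun g _ => ?_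
          rw [mul_smul_comm, map_mul]; rfl
        rw [this]
        exact Submodule.sum_mem _ fun g _ => Submodule.smul_mem _ _ (Submodule.subset_span ⟨_, rfl⟩)
      | zero => simp
      | add a b _ _ ha hb => rw [smul_add]; exact N.add_mem ha hb
      | smul r a _ ha => rw [smul_comm]; exact N.smul_mem _ ha
  exact isIntegral_trans w h1

theorem int_of_integral {q : ℚ} (h : IsIntegral ℤ (q : ℂ)) : ∃ m : ℤ, q = m := by
  have h1 : IsIntegral ℤ (algebraMap ℚ ℂ q) := by simpa using h
  have h2 := (isIntegral_algebraMap_iff (algebraMap ℚ ℂ).injective).1 h1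
  obtain ⟨m, hm⟩ := IsIntegrallyClosed.isIntegral_iff.1 h2
  exact ⟨m, by rw [← hm]; simp⟩

theorem dvd_of_integral {a b : ℕ} (hb : 0 < b) (h : IsIntegral ℤ ((a : ℂ) / b)) : b ∣ a := by
  obtain ⟨m, hm⟩ := int_of_integral (q := (a : ℚ) / b) (by push_cast; exact h)
  have hb' : (b : ℚ) ≠ 0 := by exact_mod_cast hb.ne'
  rw [div_eq_iff hb'] at hm
  have : (a : ℤ) = m * b := by exact_mod_cast hm
  exact Int.natCast_dvd_natCast.1 ⟨m, by rw [this, mul_comm]⟩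

theorem deg_dvd_card {χ : G → ℂ} (h : χ ∈ IrrChar G) : charDeg χ ∣ Nat.card G := by
  cases nonempty_fintype G
  obtain ⟨n, ρ, rfl, h1, hn, hd⟩ := irr_rep h
  rw [hd]
  apply dvd_of_integral hn
  have h2 := int_sum hn ρ h1 (fun g => (ρ g⁻¹).trace) (fun g k => by
    have := (irr_isChar (irr_dual h)).conj g k
    simpa using this) (fun g => trace_integral ρ g⁻¹)
  have hG : (Nat.card G : ℂ) ≠ 0 := by exact_mod_cast (Nat.card_pos (α := G)).ne'
  rw [ip_comm, ip, avg_eq, smul_eq_mul, inv_mul_eq_one₀ hG] at h1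
  have h3 : ∑ g, (ρ g⁻¹).trace * (ρ g).trace = Nat.card G := by
    rw [h1]; exact Finset.sum_congr rfl fun g _ => mul_comm _ _
  rwa [h3] at h2

theorem class_integral {n : ℕ} (hn : 0 < n) (ρ : G →* Matrix (Fin n) (Fin n) ℂ)
    (h : ip (fun g => (ρ g).trace) (fun g => (ρ g).trace) = 1) (g : G) :
    IsIntegral ℤ (((Subgroup.centralizer {g}).index * (ρ g).trace) / n) := by
  classical
  cases nonempty_fintype G
  have h2 := int_sum hn ρ h (fun x => if IsConj g x then 1 else 0) (fun a k => by
    have : IsConj g (a * k * a⁻¹) ↔ IsConj g k := by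
      have h' : IsConj k (a * k * a⁻¹) := isConj_iff.2 ⟨a, rfl⟩
      exact ⟨fun x => x.trans h'.symm, fun x => x.trans h'⟩
    simp only [this]) (fun x => by split_ifs; exact isIntegral_one; exact isIntegral_zero)
  have h3 : ∑ x, (if IsConj g x then 1 else 0) * (ρ x).trace =
      (Subgroup.centralizer {g}).index * (ρ g).trace := by
    simp only [ite_mul, one_mul, zero_mul]
    rw [← Finset.sum_filter]
    have e1 : ∀ x ∈ Finset.univ.filter (fun x => IsConj g x), (ρ x).trace = (ρ g).trace := by
      intro x hx
      obtain ⟨a, rfl⟩ := isConj_iff.1 (Finset.mem_filter.1 hx).2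
      rw [map_mul, map_mul, Matrix.trace_mul_comm, ← mul_assoc, ← map_mul, inv_mul_cancel, map_one,
        one_mul]
    rw [Finset.sum_congr rfl e1, Finset.sum_const, nsmul_eq_mul]
    congr 2
    have e2 := MulAction.index_stabilizer (ConjAct G) g
    have e3 : (Subgroup.centralizer {g}).index = (MulAction.orbit (ConjAct G) g).ncard := by
      rw [← e2, Subgroup.centralizer_eq_comap_stabilizer]
      exact Subgroup.index_comap_of_surjective _ ConjAct.toConjAct.surjective
    rw [e3, ← Set.ncard_coe_finset]
    congr 1
    ext x
    simp only [Finset.coe_filter, Finset.mem_univ, true_and, Set.mem_ofPred_eq]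
    rw [ConjAct.mem_orbit_conjAct, isConj_comm]
  rwa [h3] at h2

theorem scalar_subgroup_aux {n : ℕ} (hn : 0 < n) (ρ : G →* Matrix (Fin n) (Fin n) ℂ)
    (h : ip (fun g => (ρ g).trace) (fun g => (ρ g).trace) = 1)
    (hN : ∀ N : Subgroup G, N.Normal → N = ⊥ ∨ N = ⊤) (hc : ∃ a b : G, a * b ≠ b * a)
    (hne : (fun g => (ρ g).trace) ≠ 1) {g : G} (hg : g ≠ 1) (hs : ∃ c : ℂ, ρ g = c • 1) : False := by
  obtain ⟨c, hc'⟩ := hs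
  have hker : ρ.ker = ⊥ := by
    rcases hN ρ.ker inferInstance with h1 | h1
    · exact h1
    · exfalso
      have h2 : ∀ x, ρ x = 1 := fun x => by
        have : x ∈ ρ.ker := by rw [h1]; trivial
        exact this
      simp only [h2, Matrix.trace_one, Fintype.card_fin] at h hne
      rw [ip] at h
      simp only [avg_const] at h
      have h3 : n * n = 1 := by exact_mod_cast h
      have h4 : n = 1 := Nat.eq_one_of_mul_eq_one_right h3
      apply hne
      ext; simp [h4]
  have hinj : Function.Injective ρ := (MonoidHom.ker_eq_bot_iff ρ).1 hker
  have hz : g ∈ Subgroup.center G := by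
    rw [Subgroup.mem_center_iff]
    intro x
    apply hinj
    rw [map_mul, map_mul, hc']; simp
  rcases hN (Subgroup.center G) inferInstance with h1 | h1
  · rw [h1] at hz; exact hg hz
  · obtain ⟨a, b, hab⟩ := hc
    have : b ∈ Subgroup.center G := by rw [h1]; trivial
    exact hab (Subgroup.mem_center_iff.1 this a)

theorem class_pow_not_simple (hN : ∀ N : Subgroup G, N.Normal → N = ⊥ ∨ N = ⊤)
    (hc : ∃ a b : G, a * b ≠ b * a) {g : G} (hg : g ≠ 1) {q b : ℕ} (hq : q.Prime)
    (hb : (Subgroup.centralizer {g}).index = q ^ b) : False := by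
  classical
  have key : ∀ χ ∈ IrrChar G, χ ≠ 1 → ¬ q ∣ charDeg χ → χ g = 0 := by
    intro χ hχ h1 hd
    obtain ⟨n, ρ, rfl, h2, hn, hdn⟩ := irr_rep hχ
    rw [hdn] at hd
    have h3 := class_integral hn ρ h2 g
    rw [hb] at h3
    have hcop : IsCoprime ((q ^ b : ℕ) : ℤ) n := by
      rw [Nat.isCoprime_iff_coprime]
      exact Nat.Coprime.pow_left _ ((Nat.Prime.coprime_iff_not_dvd hq).2 hd)
    obtain ⟨u, v, huv⟩ := hcop
    have hn0 : (n : ℂ) ≠ 0 := by exact_mod_cast hn.ne'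
    have h4 : (ρ g).trace / n = (u : ℂ) * (((q ^ b : ℕ) * (ρ g).trace) / n) + v * (ρ g).trace := by
      have : (u : ℂ) * (q ^ b : ℕ) + v * n = 1 := by exact_mod_cast huv
      field_simp
      linear_combination (-(ρ g).trace) * this
    have h5 : IsIntegral ℤ ((ρ g).trace / n) := by
      rw [h4]
      have hz : ∀ z : ℤ, IsIntegral ℤ (z : ℂ) := fun z => by
        simpa using isIntegral_algebraMap (R := ℤ) (A := ℂ) (x := z)
      exact ((hz u).mul h3).add ((hz v).mul (trace_integral ρ g))
    rcases burnside_trace hn ρ g h5 with h6 | h6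
    · exact h6
    · exact (scalar_subgroup_aux hn ρ h2 hN hc h1 hg h6).elim
  have hs := sum_irr_eq_reg g
  rw [regChar, if_neg hg, ← Finset.add_sum_erase _ _ (mem_Irr.2 irr_one)] at hs
  have hq0 : (q : ℂ) ≠ 0 := by exact_mod_cast hq.ne_zero
  have h7 : IsIntegral ℤ ((∑ χ ∈ (Irr G).erase 1, χ 1 * χ g) / q) := by
    rw [Finset.sum_div]
    apply IsIntegral.sum
    intro χ hχ
    have hχ1 := mem_Irr.1 (Finset.mem_of_mem_erase hχ)
    by_cases hd : q ∣ charDeg χ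
    · obtain ⟨k, hk⟩ := hd
      rw [(irr_isChar hχ1).one_eq, hk]
      obtain ⟨n, ρ, rfl, -⟩ := irr_rep hχ1
      have : ((q * k : ℕ) : ℂ) * (ρ g).trace / q = k * (ρ g).trace := by
        push_cast; field_simp
      rw [this]
      have hk : IsIntegral ℤ (k : ℂ) := by
        simpa using isIntegral_algebraMap (R := ℤ) (A := ℂ) (x := (k : ℤ))
      exact hk.mul (trace_integral ρ g)
    · rw [key χ hχ1 (Finset.ne_of_mem_erase hχ) hd, mul_zero, zero_div]
      exact isIntegral_zero
  have h8 : ∑ χ ∈ (Irr G).erase 1, χ 1 * χ g = -1 := by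
    simp only [Pi.one_apply, mul_one] at hs
    linear_combination hs
  rw [h8] at h7
  have h9 : IsIntegral ℤ (((1 : ℕ) : ℂ) / q) := by
    have := h7.neg
    rw [← neg_div, neg_neg] at this
    simpa using this
  have := dvd_of_integral hq.pos h9
  exact hq.one_lt.ne' (Nat.dvd_one.1 this)

theorem burnside_pq {p q : ℕ} (hp : p.Prime) (hq : q.Prime) : ∀ (m : ℕ) (G : Type) [Group G] [Finite G],
    Nat.card G = m → (∃ a b, Nat.card G = p ^ a * q ^ b) → Group.IsSolvable G := by
  intro m
  induction m using Nat.strong_induction_on with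
  | _ m ih =>
  intro G _ _ hm hab
  by_contra hns
  have hdv : ∀ d, d ∣ Nat.card G → ∃ a b, d = p ^ a * q ^ b := by
    intro d hd
    obtain ⟨a, b, hab⟩ := hab
    rw [hab] at hd
    obtain ⟨x, y, hx, hy, rfl⟩ := exists_dvd_and_dvd_of_dvd_mul hd
    obtain ⟨i, -, rfl⟩ := (Nat.dvd_prime_pow hp).1 hx
    obtain ⟨j, -, rfl⟩ := (Nat.dvd_prime_pow hq).1 hy
    exact ⟨i, j, rfl⟩
  have hN : ∀ N : Subgroup G, N.Normal → N = ⊥ ∨ N = ⊤ := by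
    intro N hN
    by_contra hcon
    push Not at hcon
    apply hns
    have h1 : Nat.card N < m := by
      rw [← hm]
      refine lt_of_le_of_ne (Subgroup.card_le_card_group N) fun h => hcon.2 (Subgroup.eq_top_of_card_eq N h)
    have h2 : Nat.card (G ⧸ N) < m := by
      have h3 : Nat.card G = Nat.card (G ⧸ N) * Nat.card N := Subgroup.card_eq_card_quotient_mul_card_subgroup N
      have h4 : 1 < Nat.card N := Subgroup.one_lt_card_iff_ne_bot N |>.2 hcon.1
      have h5 : 0 < Nat.card (G ⧸ N) := Nat.card_pos
      nlinarith
    have s1 : Group.IsSolvable N := ih _ h1 N rfl (hdv _ (Subgroup.card_subgroup_dvd_card N))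
    have s2 : Group.IsSolvable (G ⧸ N) := ih _ h2 (G ⧸ N) rfl (hdv _ (Subgroup.card_quotient_dvd_card N))
    exact Group.isSolvable_of_ker_le_range N.subtype (QuotientGroup.mk' N) (by simp)
  have hc : ∃ a b : G, a * b ≠ b * a := by
    by_contra hcon
    push Not at hcon
    exact hns (Group.isSolvable_of_comm hcon)
  have hcent : ∀ (p q : ℕ) (hp : p.Prime) (hq : q.Prime), (∃ a b, Nat.card G = p ^ a * q ^ b) →
      ¬ p ∣ Nat.card G := by
    intro p q hp hq ⟨a, b, hab⟩ hpd
    have : Fact p.Prime := ⟨hp⟩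
    obtain ⟨P⟩ : Nonempty (Sylow p G) := inferInstance
    have hPn : Nontrivial (P : Subgroup G) := by
      rw [← Finite.one_lt_card_iff_nontrivial, P.card_eq_multiplicity]
      apply Nat.one_lt_pow _ hp.one_lt
      exact (hp.factorization_pos_of_dvd Nat.card_pos.ne' hpd).ne'
    have hz := P.isPGroup'.center_nontrivial
    obtain ⟨⟨z, hz⟩, hz1⟩ := exists_ne (1 : Subgroup.center (P : Subgroup G))
    have hle : (P : Subgroup G) ≤ Subgroup.centralizer {(z : G)} := by
      intro x hx
      rw [Subgroup.mem_centralizer_singleton_iff]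
      have := Subgroup.mem_center_iff.1 hz ⟨x, hx⟩
      exact congrArg Subtype.val this
    have hd := Subgroup.index_dvd_of_le hle
    have hP : ¬ p ∣ (P : Subgroup G).index := P.not_dvd_index
    have h1 : (Subgroup.centralizer {(z : G)}).index ∣ q ^ b := by
      have h2 : (P : Subgroup G).index ∣ p ^ a * q ^ b := hab ▸ Subgroup.index_dvd_card _
      exact hd.trans (((Nat.Coprime.pow_left a ((Nat.Prime.coprime_iff_not_dvd hp).2 hP)).symm).dvd_of_dvd_mul_left h2)
    obtain ⟨j, -, hj⟩ := (Nat.dvd_prime_pow hq).1 h1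
    refine class_pow_not_simple hN hc (g := (z : G)) ?_ hq hj
    intro h
    apply hz1
    ext
    exact h
  have hp' := hcent p q hp hq hab
  have hq' := hcent q p hq hp (by obtain ⟨a, b, h⟩ := hab; exact ⟨b, a, by rw [h, mul_comm]⟩)
  obtain ⟨a, b, h⟩ := hab
  have ha : a = 0 := by
    by_contra h0
    exact hp' (by rw [h]; exact (dvd_pow_self p h0).mul_right _)
  have hb : b = 0 := by
    by_contra h0
    exact hq' (by rw [h]; exact (dvd_pow_self q h0).mul_left _)
  rw [ha, hb] at h
  have : Subsingleton G := (Nat.card_eq_one_iff_unique.1 (by simpa using h)).1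
  exact hns inferInstance

theorem exists_prime_ge_five (h : ¬ Group.IsSolvable G) : ∃ p, p.Prime ∧ 5 ≤ p ∧ p ∣ Nat.card G := by
  by_contra hcon
  push Not at hcon
  apply h
  apply burnside_pq Nat.prime_two Nat.prime_three _ G rfl
  have : ∀ n : ℕ, n ≠ 0 → (∀ p, p.Prime → p ∣ n → p < 5) → ∃ a b, n = 2 ^ a * 3 ^ b := by
    intro n
    induction n using Nat.strong_induction_on with
    | _ n ih =>
      intro h0 hp
      by_cases h1 : n = 1
      · exact ⟨0, 0, by simp [h1]⟩
      obtain ⟨p, hpp, k, rfl⟩ := Nat.exists_prime_and_dvd h1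
      have hk : k ≠ 0 := by rintro rfl; simp at h0
      obtain ⟨a, b, hab⟩ := ih k (by have := hpp.two_le; nlinarith [Nat.pos_of_ne_zero hk]) hk
        (fun q hq hd => hp q hq (hd.mul_left p))
      have h5 := hp p hpp (dvd_mul_right _ _)
      interval_cases p
      · exact absurd hpp (by decide)
      · exact absurd hpp (by decide)
      · exact ⟨a + 1, b, by rw [hab]; ring⟩
      · exact ⟨a, b + 1, by rw [hab]; ring⟩
      · exact absurd hpp (by decide)
  exact this _ Nat.card_pos.ne' (fun p hp hd => by
    by_contra h5
    exact hcon p hp (by omega) hd)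

end
end ACD

namespace ACD
open Matrix
open scoped Kronecker
section
variable {G : Type} [Group G] [Finite G]

theorem IsChar.rep {χ : G → ℂ} (h : IsChar χ) {d : ℕ} (hd : charDeg χ = d) :
    ∃ ρ : G →* Matrix (Fin d) (Fin d) ℂ, ∀ g, χ g = (ρ g).trace := by
  obtain ⟨n, ρ, hρ⟩ := h
  have h1 : χ 1 = n := by rw [hρ, map_one]; simp
  have h2 : charDeg χ = n := by
    rw [charDeg, h1]; simp
  have : n = d := by omega
  subst this
  exact ⟨ρ, hρ⟩

theorem perfect_hom (hG : commutator G = ⊤) (f : G →* ℂ) (g : G) : f g = 1 := by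
  have h1 : IsChar (fun g => f g) := by
    refine ⟨1, ?_, ?_⟩
    · exact { toFun := fun g => f g • 1, map_one' := by simp, map_mul' := by intro a b; simp [smul_smul, mul_comm] }
    · intro g; simp
  have := linear_eq_one hG h1 (by simp [charDeg])
  exact congrFun this g

theorem perfect_det (hG : commutator G = ⊤) {n : ℕ} (ρ : G →* Matrix (Fin n) (Fin n) ℂ) (g : G) :
    (ρ g).det = 1 :=
  perfect_hom hG (Matrix.detMonoidHom.comp ρ) g

theorem inv_eq_adj {n : ℕ} (ρ : G →* Matrix (Fin n) (Fin n) ℂ) (g : G) (h : (ρ g).det = 1) :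
    ρ g⁻¹ = (ρ g).adjugate := by
  have h1 : ρ g * ρ g⁻¹ = 1 := by rw [← map_mul]; simp
  have h2 : (ρ g).adjugate * ρ g = 1 := by rw [Matrix.adjugate_mul, h, one_smul]
  calc ρ g⁻¹ = (ρ g).adjugate * ρ g * ρ g⁻¹ := by rw [h2, one_mul]
    _ = _ := by rw [mul_assoc, h1, mul_one]

theorem deg2_dual (hG : commutator G = ⊤) {θ : G → ℂ} (h : IsChar θ) (hd : charDeg θ = 2) :
    dual θ = θ := by
  obtain ⟨ρ, hρ⟩ := h.rep hd
  ext g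
  rw [dual_apply, hρ, hρ, inv_eq_adj ρ g (perfect_det hG ρ g), Matrix.adjugate_fin_two,
    Matrix.trace_fin_two, Matrix.trace_fin_two]
  simp [add_comm]

theorem deg2_sq (hG : commutator G = ⊤) {θ : G → ℂ} (h : IsChar θ) (hd : charDeg θ = 2) (g : G) :
    θ (g * g) = θ g ^ 2 - 2 := by
  obtain ⟨ρ, hρ⟩ := h.rep hd
  have h1 := perfect_det hG ρ g
  rw [hρ, hρ, map_mul, Matrix.trace_fin_two, Matrix.trace_fin_two]
  rw [Matrix.det_fin_two] at h1
  simp only [Matrix.mul_apply, Fin.sum_univ_two]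
  linear_combination (-2) * h1

theorem deg3_sq (hG : commutator G = ⊤) {θ : G → ℂ} (h : IsChar θ) (hd : charDeg θ = 3) (g : G) :
    θ (g * g) = θ g ^ 2 - 2 * θ g⁻¹ := by
  obtain ⟨ρ, hρ⟩ := h.rep hd
  rw [hρ, hρ, hρ, inv_eq_adj ρ g (perfect_det hG ρ g), Matrix.adjugate_fin_three, map_mul,
    Matrix.trace_fin_three, Matrix.trace_fin_three, Matrix.trace_fin_three]
  simp only [Matrix.mul_apply, Fin.sum_univ_three, Matrix.of_apply, Matrix.cons_val]
  ring

theorem deg3_cube (hG : commutator G = ⊤) {θ : G → ℂ} (h : IsChar θ) (hd : charDeg θ = 3) :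
    ip (θ * θ) (dual θ) ≠ 0 := by
  obtain ⟨ρ, hρ⟩ := h.rep hd
  let σ : G →* Matrix (Fin 3 × (Fin 3 × Fin 3)) (Fin 3 × (Fin 3 × Fin 3)) ℂ :=
    { toFun := fun g => ρ g ⊗ₖ (ρ g ⊗ₖ ρ g)
      map_one' := by simp
      map_mul' := by intro a b; simp [Matrix.mul_kronecker_mul] }
  intro h0
  obtain ⟨r, hr, hr0⟩ := idem_trace_nat (avg fun g => σ g) (avg_rep_idem σ)
  have e1 : (avg fun g => σ g).trace = ip (θ * θ) (dual θ) := by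
    rw [avg_trace, ip]
    congr 1
    ext g
    simp [σ, Matrix.trace_kronecker, hρ, mul_assoc]
  rw [e1, h0] at hr
  have hE := hr0 (by exact_mod_cast hr.symm)
  have key : ∀ i j k : Fin 3, avg (fun g => ρ g i 0 * (ρ g j 1 * ρ g k 2)) = 0 := by
    intro i j k
    have := congrFun (congrFun hE (i, j, k)) (0, 1, 2)
    cases nonempty_fintype G
    rw [avg_eq] at this ⊢
    simpa [σ, Matrix.sum_apply] using this
  have h1 : avg (fun g => (ρ g).det) = 1 := by
    simp only [perfect_det hG ρ]
    exact avg_const 1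
  have h2 : (fun g => (ρ g).det) = fun g => (ρ g 0 0 * (ρ g 1 1 * ρ g 2 2) - ρ g 0 0 * (ρ g 2 1 * ρ g 1 2)
     - ρ g 1 0 * (ρ g 0 1 * ρ g 2 2) + ρ g 1 0 * (ρ g 2 1 * ρ g 0 2) + ρ g 2 0 * (ρ g 0 1 * ρ g 1 2)
     - ρ g 2 0 * (ρ g 1 1 * ρ g 0 2)) := by
    ext g; rw [Matrix.det_fin_three]; ring
  rw [h2, avg_sub, avg_add, avg_add, avg_sub, avg_sub] at h1
  simp only [key] at h1
  norm_num at h1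

theorem deg3_kernel_sq (hG : commutator G = ⊤) {θ : G → ℂ} (h : IsChar θ) (hd : charDeg θ = 3) {t : G}
    (ht : θ (t * t) = 3) : θ t = 3 ∨ θ t = -1 := by
  obtain ⟨ρ, hρ⟩ := h.rep hd
  have h1 : ρ (t * t) = 1 := one_of_trace ρ _ (by rw [← hρ, ht]; norm_num)
  have h2 : θ t⁻¹ = θ t := by
    rw [hρ, hρ]
    have : ρ t⁻¹ = ρ t := by
      calc ρ t⁻¹ = ρ (t * t) * ρ t⁻¹ := by rw [h1, one_mul]
        _ = ρ t := by rw [← map_mul]; simp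
    rw [this]
  have h3 := deg3_sq hG h hd t
  rw [ht, h2] at h3
  have : (θ t - 3) * (θ t + 1) = 0 := by linear_combination -h3
  rcases mul_eq_zero.1 this with h | h
  · left; linear_combination h
  · right; linear_combination h

theorem norm_le {χ : G → ℂ} (h : IsChar χ) (g : G) : ‖χ g‖ ≤ charDeg χ := by
  obtain ⟨ρ, hρ⟩ := h.rep rfl
  rw [hρ]; exact norm_trace_le ρ g

theorem eq_one_of_re {χ : G → ℂ} (h : IsChar χ) (g : G) (hr : (charDeg χ : ℝ) ≤ (χ g).re) :
    χ g = charDeg χ := by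
  have h1 := norm_le h g
  have h2 := Complex.re_le_norm (χ g)
  have h3 : (χ g).re = charDeg χ := by linarith
  have h4 : ‖χ g‖ = charDeg χ := by linarith
  have h5 := Complex.sq_norm (χ g)
  rw [Complex.normSq_apply, h4, h3] at h5
  have h6 : (χ g).im = 0 := by
    have : (χ g).im * (χ g).im = 0 := by nlinarith
    simpa using this
  apply Complex.ext
  · simp [h3]
  · simp [h6]

theorem ker_summand {χ ψ : G → ℂ} (h : IsChar χ) (h' : IsChar ψ) {g : G} (hk : (χ + ψ) g = (χ + ψ) 1) :
    χ g = χ 1 ∧ ψ g = ψ 1 := by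
  rw [Pi.add_apply, Pi.add_apply, h.one_eq, h'.one_eq] at hk
  have h1 := (Complex.re_le_norm _).trans (norm_le h g)
  have h2 := (Complex.re_le_norm _).trans (norm_le h' g)
  have h3 := congrArg Complex.re hk
  simp only [Complex.add_re, Complex.natCast_re] at h3
  rw [h.one_eq, h'.one_eq]
  exact ⟨eq_one_of_re h g (by linarith), eq_one_of_re h' g (by linarith)⟩

theorem ker_constituent {χ ψ : G → ℂ} (h : IsChar χ) (h' : ψ ∈ IrrChar G) (hne : ip χ ψ ≠ 0) {g : G}
    (hk : χ g = χ 1) : ψ g = ψ 1 := by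
  have h1 := h.peel h' hne
  exact (ker_summand h1 (irr_isChar h') (g := g) (by simpa using hk)).2

theorem perfect_deg (hG : commutator G = ⊤) {χ : G → ℂ} (h : χ ∈ IrrChar G) (h1 : χ ≠ 1) :
    2 ≤ charDeg χ := by
  have := irr_pos h
  rcases Nat.lt_or_ge 1 (charDeg χ) with h2 | h2
  · exact h2
  · exact absurd (linear_eq_one hG (irr_isChar h) (by omega)) h1

/-- `χχ* = 1 + A`. -/
theorem isChar_adj {χ : G → ℂ} (h : χ ∈ IrrChar G) : IsChar (χ * dual χ - 1) := by
  apply ((irr_isChar h).mul (irr_isChar h).dual).peel irr_one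
  rw [ip_mul_left, dual_dual, mul_one, irr_norm h]; exact one_ne_zero

theorem adj_ip_one {χ : G → ℂ} (h : χ ∈ IrrChar G) : ip (χ * dual χ - 1) 1 = 0 := by
  rw [ip_sub_left, ip_mul_left, dual_dual, mul_one, irr_norm h, irr_norm irr_one, sub_self]

theorem adj_deg {χ : G → ℂ} (h : χ ∈ IrrChar G) : charDeg (χ * dual χ - 1) + 1 = charDeg χ * charDeg χ := by
  have := (isChar_one (G := G)).charDeg_sub (isChar_adj h)
  rw [(irr_isChar h).charDeg_mul (irr_isChar h).dual, charDeg_dual, charDeg_one] at this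
  omega

theorem not_one_of_ip {χ ψ : G → ℂ} (h : ip χ 1 = 0) (hne : ip χ ψ ≠ 0) : ψ ≠ 1 := by
  rintro rfl; exact hne h

theorem odd_deg_three (hG : commutator G = ⊤) {θ : G → ℂ} (h : θ ∈ IrrChar G) (hd : charDeg θ = 3) :
    2 ∣ Nat.card G := by
  by_contra hodd
  have hodd' : Odd (Nat.card G) := by
    rw [← Nat.not_even_iff_odd, even_iff_two_dvd]; exact hodd
  have hdeg : ∀ ψ ∈ IrrChar G, ψ ≠ 1 → 3 ≤ charDeg ψ ∧ charDeg ψ % 2 = 1 := by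
    intro ψ hψ h1
    have h2 := perfect_deg hG hψ h1
    have h3 : Odd (charDeg ψ) := Odd.of_dvd_nat hodd' (deg_dvd_card hψ)
    have := Nat.odd_iff.1 h3
    omega
  set A := θ * dual θ - 1 with hA
  have cA : IsChar A := isChar_adj h
  have dA : charDeg A = 8 := by have := adj_deg h; rw [hd, ← hA] at this; omega
  have A1 : ip A 1 = 0 := adj_ip_one h
  obtain ⟨ψ, hψ, hne⟩ := cA.exists_constituent (by intro h0; rw [h0, charDeg_zero] at dA; omega)
  have hψ1 := hdeg ψ hψ (not_one_of_ip A1 hne)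
  have cB := cA.peel hψ hne
  have dB := (irr_isChar hψ).charDeg_sub cB
  have B1 : ip (A - ψ) 1 = 0 := by
    rw [ip_sub_left, A1, irr_ip_ne hψ irr_one (not_one_of_ip A1 hne), sub_zero]
  have hB0 : A - ψ ≠ 0 := by
    intro h0
    rw [h0, charDeg_zero] at dB
    omega
  have hB : A - ψ ∈ IrrChar G := by
    apply cB.irr_of_small hB0
    intro β hβ hne'
    have := hdeg β hβ (not_one_of_ip B1 hne')
    omega
  have hb := hdeg _ hB (by
    intro h1; rw [h1, irr_norm irr_one] at B1; exact one_ne_zero B1)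
  have hneq : ψ ≠ A - ψ := by
    intro he
    rw [← he] at dB
    omega
  have AA : ip A A = 2 := by
    have e : A = ψ + (A - ψ) := by simp
    rw [e, ip_add_left, ip_add_right, ip_add_right, irr_norm hψ, irr_norm hB, irr_ip_ne hψ hB hneq,
      irr_ip_ne hB hψ hneq.symm]
    norm_num
  have TT : ip (θ * dual θ) (θ * dual θ) = 3 := by
    have e : θ * dual θ = A + 1 := by simp [hA]
    rw [e, ip_add_left, ip_add_right, ip_add_right, AA, A1, ip_comm, A1, irr_norm irr_one]
    norm_num
  have bij : Function.Bijective (fun g : G => g * g) := by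
    have hcop : (Nat.card G).Coprime 2 := by
      rw [Nat.coprime_comm]; exact (Nat.Prime.coprime_iff_not_dvd Nat.prime_two).2 hodd
    have := (powCoprime hcop).bijective
    convert this using 2 with g
    simp [powCoprime, pow_two]
  have e1 : avg (fun g => (θ * dual θ) (g * g)) = 1 := by
    have h1 := avg_equiv (Equiv.ofBijective _ bij) (θ * dual θ)
    have h2 : avg (θ * dual θ) = 1 := by
      rw [← ip_one_right, ip_mul_left, dual_dual, mul_one, irr_norm h]
    rw [← h2, ← h1]; rfl
  obtain ⟨c, hc⟩ := (((irr_isChar h).mul (irr_isChar h)).mul (irr_isChar h)).avg_nat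
  have hc' : avg (fun g => θ g⁻¹ * θ g⁻¹ * θ g⁻¹) = c := by
    rw [← hc, ← avg_inv]; simp only [inv_inv]; rfl
  have e2 : (fun g => (θ * dual θ) (g * g)) = fun g => (θ g * θ g⁻¹ * (θ g⁻¹ * θ g) - 2 • (θ g * θ g * θ g))
      - 2 • (θ g⁻¹ * θ g⁻¹ * θ g⁻¹) + 4 • (θ g * θ g⁻¹) := by
    ext g
    have h1 := deg3_sq hG (irr_isChar h) hd g
    have h2 := deg3_sq hG (irr_isChar h) hd g⁻¹
    rw [inv_inv] at h2
    have h3 : (θ * dual θ) (g * g) = θ (g * g) * θ (g⁻¹ * g⁻¹) := by simp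
    rw [h3, h1, h2]
    simp only [nsmul_eq_mul]
    push_cast
    ring
  have e3 : avg (fun g => θ g * θ g⁻¹ * (θ g⁻¹ * θ g)) = 3 := by
    rw [← TT, ip]; congr 1; ext g; simp
  have e4 : avg (fun g => θ g * θ g⁻¹) = 1 := irr_norm h
  have e5 : avg (fun g => θ g * θ g * θ g) = c := hc
  have e6 : ∀ (k : ℕ) (f : G → ℂ), avg (fun g => k • f g) = k * avg f := by
    intro k f
    have := avg_smul (k : ℂ) f
    simpa using this
  rw [e2, avg_add, avg_sub, avg_sub, e6, e6, e6, e3, e4, e5, hc'] at e1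
  have e7 : (4 * c : ℂ) = 6 := by push_cast at e1; linear_combination -e1
  have : 4 * c = 6 := by exact_mod_cast e7
  omega

end
end ACD

namespace ACD
open Matrix
section
variable {G : Type} [Group G] [Finite G]

/-- `z` acts by the scalar `c`. -/
def Cen (z : G) (c : ℂ) (ψ : G → ℂ) : Prop := ∀ g, ψ (z * g) = c * ψ g

theorem Cen.mul {z : G} {a b : ℂ} {χ ψ : G → ℂ} (h : Cen z a χ) (h' : Cen z b ψ) :
    Cen z (a * b) (χ * ψ) := fun g => by
  rw [Pi.mul_apply, h, h', Pi.mul_apply]; ring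

theorem Cen.sub {z : G} {a : ℂ} {χ ψ : G → ℂ} (h : Cen z a χ) (h' : Cen z a ψ) :
    Cen z a (χ - ψ) := fun g => by
  rw [Pi.sub_apply, h, h', Pi.sub_apply]; ring

theorem cen_one (z : G) : Cen z 1 (1 : G → ℂ) := fun g => by simp

theorem Cen.ip {z : G} {a c : ℂ} {χ ψ : G → ℂ} (h : Cen z a χ) (h' : Cen z c ψ)
    (hz : ∀ g, z * g = g * z) (hne : ip χ ψ ≠ 0) : a = c := by
  have hc : ∀ g, ψ g = c * ψ (z⁻¹ * g) := fun g => by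
    have := h' (z⁻¹ * g); simpa using this
  have e : ACD.ip χ ψ * c = a * ACD.ip χ ψ := by
    have h1 : ACD.ip χ ψ = avg (fun g => χ (z * g) * ψ (z * g)⁻¹) := (avg_mul_left (fun g => χ g * ψ g⁻¹) z).symm
    have h2 : (fun g => c * (χ (z * g) * ψ (z * g)⁻¹)) = fun g => a * (χ g * ψ g⁻¹) := by
      ext g
      have e1 : (z * g)⁻¹ = z⁻¹ * g⁻¹ := by rw [hz g, _root_.mul_inv_rev]
      rw [e1, h g, hc g⁻¹]; ring
    calc ACD.ip χ ψ * c = c * ACD.ip χ ψ := mul_comm _ _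
      _ = avg (fun g => c * (χ (z * g) * ψ (z * g)⁻¹)) := by
        rw [h1]; exact (avg_smul c _).symm
      _ = a * ACD.ip χ ψ := by rw [h2]; exact avg_smul a _
  rw [mul_comm] at e
  exact (mul_right_cancel₀ hne e).symm

theorem commutator_hom (f : G →* ℂ) {z : G} (hz : z ∈ commutator G) : f z = 1 := by
  let f' : G →* ℂˣ := f.toHomUnits
  have h1 : f' z = 1 := by
    have := Abelianization.commutator_subset_ker f' hz
    exact this
  have := congrArg Units.val h1
  simpa [f'] using this

theorem central_root {z : G} (hzc : z ∈ commutator G) (hz : ∀ g, z * g = g * z) {ψ : G → ℂ}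
    (hψ : ψ ∈ IrrChar G) : ∃ c : ℂ, Cen z c ψ ∧ c ^ charDeg ψ = 1 ∧ ∀ k, z ^ k = 1 → c ^ k = 1 := by
  obtain ⟨n, ρ, rfl, h1, hn, hd⟩ := irr_rep hψ
  obtain ⟨c, hc⟩ := schur ρ h1 (ρ z) (fun g => by rw [← map_mul, ← map_mul, hz])
  refine ⟨c, fun g => ?_, ?_, ?_⟩
  · simp [hc]
  · have h2 : (ρ z).det = 1 := commutator_hom (Matrix.detMonoidHom.comp ρ) hzc
    rw [hc, Matrix.det_smul] at h2
    rw [hd]; simpa using h2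
  · intro k hk
    have h3 : ρ (z ^ k) = 1 := by rw [hk, map_one]
    rw [map_pow, hc, smul_pow, one_pow] at h3
    have := congrFun (congrFun h3 ⟨0, hn⟩) ⟨0, hn⟩
    simpa using this

theorem even_of_neg {z : G} (hzc : z ∈ commutator G) (hz : ∀ g, z * g = g * z) {A ψ : G → ℂ}
    (hA : Cen z (-1) A) (hψ : ψ ∈ IrrChar G) (hne : ip A ψ ≠ 0) :
    2 ∣ charDeg ψ ∧ Cen z (-1) ψ := by
  obtain ⟨c, h1, h2, -⟩ := central_root hzc hz hψ
  have := hA.ip h1 hz hne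
  subst this
  refine ⟨?_, h1⟩
  rcases Nat.even_or_odd (charDeg ψ) with h | h
  · exact even_iff_two_dvd.1 h
  · rw [h.neg_one_pow] at h2; norm_num at h2

theorem pos_sum {a b : ℕ} : (a : ℂ) + b = 0 → a = 0 := by
  intro h
  have : a + b = 0 := by exact_mod_cast h
  omega

/-! Perfect groups with a degree two character. -/

theorem P1 (hG : commutator G = ⊤) {θ : G → ℂ} (h : θ ∈ IrrChar G) (hd : charDeg θ = 2) :
    θ * θ - 1 ∈ IrrChar G ∧ charDeg (θ * θ - 1) = 3 := by
  have e := deg2_dual hG (irr_isChar h) hd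
  have c := isChar_adj h
  have d := adj_deg h
  have o := adj_ip_one h
  rw [e] at c d o
  rw [hd] at d
  refine ⟨c.irr_of_small ?_ ?_, by omega⟩
  · intro h0; rw [h0, charDeg_zero] at d; omega
  · intro ψ hψ hne
    have := perfect_deg hG hψ (not_one_of_ip o hne)
    omega

theorem irr_ne_deg {χ ψ : G → ℂ} (h : χ ∈ IrrChar G) (h' : ψ ∈ IrrChar G) (hd : charDeg χ ≠ charDeg ψ) :
    ip χ ψ = 0 := irr_ip_ne h h' (fun e => hd (by rw [e]))

theorem one_add_deg (hG : commutator G = ⊤) {A S : G → ℂ} (hA : IsChar A) (hS : S ∈ IrrChar G)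
    (hne : ip A S ≠ 0) (hd : charDeg A = charDeg S + 1) : A = S + 1 := by
  have h1 := hA.peel hS hne
  have h2 := (irr_isChar hS).charDeg_sub h1
  have h3 := linear_eq_one hG h1 (by omega)
  rw [← h3]; simp

theorem P2 (hG : commutator G = ⊤) {z : G} (hz : ∀ g, z * g = g * z)
    {θ : G → ℂ} (h : θ ∈ IrrChar G) (hd : charDeg θ = 2) (hθ : Cen z (-1) θ) :
    θ * (θ * θ - 1) - θ ∈ IrrChar G ∧ charDeg (θ * (θ * θ - 1) - θ) = 4 ∧
      Cen z (-1) (θ * (θ * θ - 1) - θ) := by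
  have e := deg2_dual hG (irr_isChar h) hd
  obtain ⟨hS, dS⟩ := P1 hG h hd
  set S := θ * θ - 1 with hSdef
  have e2 : θ * θ = S + 1 := by simp [hSdef]
  have S1 : ip S 1 = 0 := irr_ne_deg hS irr_one (by rw [dS, charDeg_one]; omega)
  have hi : ip (θ * S) θ = 1 := by
    rw [mul_comm, ip_mul_left, e, e2, ip_add_right, irr_norm hS, S1, add_zero]
  have cT : IsChar (θ * S - θ) := ((irr_isChar h).mul (irr_isChar hS)).peel h (by rw [hi]; exact one_ne_zero)
  have dT : charDeg (θ * S - θ) = 4 := by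
    have := (irr_isChar h).charDeg_sub cT
    rw [(irr_isChar h).charDeg_mul (irr_isChar hS), hd, dS] at this
    omega
  have nS : Cen z 1 S := by
    have := (hθ.mul hθ)
    norm_num at this
    exact this.sub (cen_one z)
  have nT : Cen z (-1) (θ * S - θ) := by
    have := hθ.mul nS
    rw [mul_one] at this
    exact this.sub hθ
  refine ⟨cT.irr_of_small ?_ ?_, dT, nT⟩
  · intro h0; rw [h0, charDeg_zero] at dT; omega
  · intro ψ hψ hne
    rw [dT]
    have ev := even_of_neg (by rw [hG]; trivial) hz nT hψ hne
    have := irr_pos hψ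
    by_contra hlt
    have d2 : charDeg ψ = 2 := by omega
    by_cases hψθ : ψ = θ
    · rw [hψθ, ip_sub_left, hi, irr_norm h, sub_self] at hne
      exact hne rfl
    · rw [ip_sub_left, irr_ip_ne h hψ (Ne.symm hψθ), sub_zero, mul_comm, ip_mul_left, e, ip_comm] at hne
      have h4 := one_add_deg hG ((irr_isChar h).mul (irr_isChar hψ)) hS hne
        (by rw [(irr_isChar h).charDeg_mul (irr_isChar hψ), hd, dS, d2])
      have h5 : ip (θ * ψ) 1 = 0 := by
        rw [ip_mul_left, mul_one, deg2_dual hG (irr_isChar hψ) d2, irr_ip_ne h hψ (Ne.symm hψθ)]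
      rw [h4, ip_add_left, S1, irr_norm irr_one] at h5
      norm_num at h5

theorem avg_sq (hG : commutator G = ⊤) {θ : G → ℂ} (h : θ ∈ IrrChar G) (hd : charDeg θ = 2) :
    avg (fun g => θ g * θ g) = 1 := by
  have := irr_norm h
  nth_rewrite 2 [← deg2_dual hG (irr_isChar h) hd] at this
  rw [← this, ip]; simp

theorem norm_sq (hG : commutator G = ⊤) {θ : G → ℂ} (h : θ ∈ IrrChar G) (hd : charDeg θ = 2) :
    ip (θ * θ) (θ * θ) = 2 := by
  obtain ⟨hS, dS⟩ := P1 hG h hd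
  have S1 : ip (θ * θ - 1) 1 = 0 := irr_ne_deg hS irr_one (by rw [dS, charDeg_one]; omega)
  have e2 : θ * θ = (θ * θ - 1) + 1 := by simp
  rw [e2, ip_add_left, ip_add_right, ip_add_right, irr_norm hS, S1, ip_comm, S1, irr_norm irr_one]
  norm_num

theorem P3 (hG : commutator G = ⊤) {z : G} (hz : ∀ g, z * g = g * z)
    {θ : G → ℂ} (h : θ ∈ IrrChar G) (hd : charDeg θ = 2) (hθ : Cen z (-1) θ) {S T : G → ℂ}
    (hSe : S = θ * θ - 1) (hTe : T = θ * S - θ) :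
    θ * T - S ∈ IrrChar G ∧ charDeg (θ * T - S) = 5 := by
  have e := deg2_dual hG (irr_isChar h) hd
  have hS := (P1 hG h hd).1
  have dS := (P1 hG h hd).2
  have hT := (P2 hG hz h hd hθ).1
  have dT := (P2 hG hz h hd hθ).2.1
  rw [← hSe] at hS dS hT dT
  rw [← hTe] at hT dT
  have e3 : θ * S = T + θ := by simp [hTe]
  have hi : ip (θ * T) S = 1 := by
    rw [mul_comm, ip_mul_left, e, e3, ip_add_right, irr_norm hT, irr_ne_deg hT h (by omega), add_zero]
  have cY : IsChar (θ * T - S) :=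
    ((irr_isChar h).mul (irr_isChar hT)).peel hS (by rw [hi]; exact one_ne_zero)
  have dY : charDeg (θ * T - S) = 5 := by
    have := (irr_isChar hS).charDeg_sub cY
    rw [(irr_isChar h).charDeg_mul (irr_isChar hT), hd, dT, dS] at this
    omega
  refine ⟨cY.irr_of_small ?_ ?_, dY⟩
  · intro h0; rw [h0, charDeg_zero] at dY; omega
  · intro δ hδ hne
    rw [dY]
    have Y1 : ip (θ * T - S) 1 = 0 := by
      rw [ip_sub_left, irr_ne_deg hS irr_one (by rw [dS, charDeg_one]; omega), sub_zero, mul_comm,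
        ip_mul_left, e, mul_one, irr_ne_deg hT h (by omega)]
    have := perfect_deg hG hδ (not_one_of_ip Y1 hne)
    by_contra hlt
    have d2 : charDeg δ = 2 := by omega
    rw [ip_sub_left, irr_ne_deg hS hδ (by omega), sub_zero, mul_comm, ip_mul_left, e, ip_comm] at hne
    have h4 : θ * δ = T := ((irr_isChar h).mul (irr_isChar hδ)).eq_of_deg hT hne
      (by rw [(irr_isChar h).charDeg_mul (irr_isChar hδ), hd, d2, dT])
    have h5 : ∀ g, θ g * δ g = θ g * (θ g ^ 2 - 2) := by
      intro g
      have := congrFun h4 g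
      rw [hTe, hSe] at this
      simp only [Pi.mul_apply, Pi.sub_apply, Pi.one_apply] at this
      linear_combination this
    have h6 : ∀ g, δ g * δ g = (θ g * θ g * (θ g * θ g) - 4 * (θ g * θ g)) + 4 := by
      intro g
      by_cases h0 : θ g = 0
      · have h7 := h5 (g * g)
        rw [deg2_sq hG (irr_isChar h) hd, deg2_sq hG (irr_isChar hδ) d2, h0] at h7
        rw [h0]
        linear_combination (-1/2) * h7
      · have h7 := mul_left_cancel₀ h0 (h5 g)
        rw [h7]; ring
    have h8 := avg_sq hG hδ d2
    simp only [h6] at h8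
    rw [avg_add, avg_sub, avg_const] at h8
    have h9 : avg (fun g => θ g * θ g * (θ g * θ g)) = 2 := by
      rw [← norm_sq hG h hd, ip]
      congr 1; ext g
      have := congrFun e g
      rw [dual_apply] at this
      simp [this]
    have h10 : avg (fun g => 4 * (θ g * θ g)) = 4 := by
      have := avg_smul (4 : ℂ) (fun g => θ g * θ g)
      rw [avg_sq hG h hd] at this
      simpa using this
    rw [h9, h10] at h8
    norm_num at h8

theorem P4 (hG : commutator G = ⊤) {z : G} (hz : ∀ g, z * g = g * z)
    {θ : G → ℂ} (h : θ ∈ IrrChar G) (hd : charDeg θ = 2) (hθ : Cen z (-1) θ) {S T Y : G → ℂ}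
    (hSe : S = θ * θ - 1) (hTe : T = θ * S - θ) (hYe : Y = θ * T - S) :
    θ * Y - T ∈ IrrChar G ∧ charDeg (θ * Y - T) = 6 ∧ Cen z (-1) (θ * Y - T) := by
  have e := deg2_dual hG (irr_isChar h) hd
  have hS := (P1 hG h hd).1
  have dS := (P1 hG h hd).2
  have hT := (P2 hG hz h hd hθ).1
  have dT := (P2 hG hz h hd hθ).2.1
  have nT := (P2 hG hz h hd hθ).2.2
  rw [← hSe] at hS dS hT dT nT
  rw [← hTe] at hT dT nT
  obtain ⟨hY, dY⟩ := P3 hG hz h hd hθ hSe hTe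
  rw [← hYe] at hY dY
  have e4 : θ * T = Y + S := by simp [hYe]
  have nS : Cen z 1 S := by
    have := (hθ.mul hθ)
    norm_num at this
    rw [hSe]
    exact this.sub (cen_one z)
  have nY : Cen z 1 Y := by
    have := (hθ.mul nT)
    norm_num at this
    rw [hYe]
    exact this.sub nS
  have nU : Cen z (-1) (θ * Y - T) := by
    have := hθ.mul nY
    rw [mul_one] at this
    exact this.sub nT
  have hi : ip (θ * Y) T = 1 := by
    rw [mul_comm, ip_mul_left, e, e4, ip_add_right, irr_norm hY, irr_ne_deg hY hS (by omega), add_zero]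
  have cU : IsChar (θ * Y - T) :=
    ((irr_isChar h).mul (irr_isChar hY)).peel hT (by rw [hi]; exact one_ne_zero)
  have dU : charDeg (θ * Y - T) = 6 := by
    have := (irr_isChar hT).charDeg_sub cU
    rw [(irr_isChar h).charDeg_mul (irr_isChar hY), hd, dY, dT] at this
    omega
  refine ⟨cU.irr_of_small ?_ ?_, dU, nU⟩
  · intro h0; rw [h0, charDeg_zero] at dU; omega
  · intro ψ hψ hne
    rw [dU]
    have ev := even_of_neg (by rw [hG]; trivial) hz nU hψ hne
    have := irr_pos hψ
    by_contra hlt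
    have d2 : charDeg ψ = 2 := by omega
    rw [ip_sub_left, irr_ne_deg hT hψ (by omega), sub_zero, mul_comm, ip_mul_left, e, ip_comm] at hne
    have := ((irr_isChar h).mul (irr_isChar hψ)).deg_le hY hne
    rw [(irr_isChar h).charDeg_mul (irr_isChar hψ)] at this
    rw [hd, d2, dY] at this
    omega

theorem P5 (hG : commutator G = ⊤) {θ η : G → ℂ} (h : θ ∈ IrrChar G) (hd : charDeg θ = 2)
    (h' : η ∈ IrrChar G) (hd' : charDeg η = 2) (hne : θ ≠ η) : θ * η ∈ IrrChar G := by
  have c := (irr_isChar h).mul (irr_isChar h')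
  have d : charDeg (θ * η) = 4 := by rw [(irr_isChar h).charDeg_mul (irr_isChar h'), hd, hd']
  have o : ip (θ * η) 1 = 0 := by
    rw [ip_mul_left, mul_one, deg2_dual hG (irr_isChar h') hd', irr_ip_ne h h' hne]
  apply c.irr_of_small
  · intro h0; rw [h0, charDeg_zero] at d; omega
  · intro α hα hne'
    rw [d]
    have := perfect_deg hG hα (not_one_of_ip o hne')
    by_contra hlt
    have dα : charDeg α = 2 := by omega
    have cβ := c.peel hα hne'
    have dβ : charDeg (θ * η - α) = 2 := by
      have := (irr_isChar hα).charDeg_sub cβ; omega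
    obtain ⟨k, hk⟩ := (irr_isChar hα).ip_nat cβ
    set β := θ * η - α with hβ
    have e1 : ∀ g, α g * β g⁻¹ = (θ g * θ g + η g * η g) - 4 := by
      intro g
      have h1 := deg2_sq hG (irr_isChar hα) dα g
      have h2 := deg2_sq hG cβ dβ g
      have h3 := deg2_sq hG (irr_isChar h) hd g
      have h4 := deg2_sq hG (irr_isChar h') hd' g
      have h5 : ∀ x, θ x * η x = α x + β x := by intro x; simp [hβ]
      have h6 := h5 (g * g)
      have h7 := h5 g
      rw [h1, h2, h3, h4] at h6
      have h8 : β g⁻¹ = β g := congrFun (deg2_dual hG cβ dβ) g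
      rw [h8]
      linear_combination (1/2) * h6 - (1/2) * (θ g * η g + α g + β g) * h7
    rw [ip] at hk
    simp only [e1] at hk
    rw [avg_sub, avg_add, avg_sq hG h hd, avg_sq hG h' hd', avg_const] at hk
    have : (k : ℂ) + (2 : ℕ) = 0 := by push_cast; linear_combination -hk
    have : k + 2 = 0 := by exact_mod_cast this
    omega

theorem P6 (hG : commutator G = ⊤) {z : G} (hz : ∀ g, z * g = g * z)
    {θ η : G → ℂ} (h : θ ∈ IrrChar G) (hd : charDeg θ = 2) (hθ : Cen z (-1) θ)
    (h' : η ∈ IrrChar G) (hd' : charDeg η = 2) (hη : Cen z (-1) η) (hne : θ ≠ η) :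
    (θ * θ - 1) * η ∈ IrrChar G := by
  obtain ⟨hS, dS⟩ := P1 hG h hd
  have c := (irr_isChar hS).mul (irr_isChar h')
  have d : charDeg ((θ * θ - 1) * η) = 6 := by rw [(irr_isChar hS).charDeg_mul (irr_isChar h'), dS, hd']
  have n : Cen z (-1) ((θ * θ - 1) * η) := by
    have := (hθ.mul hθ)
    norm_num at this
    have := (this.sub (cen_one z)).mul hη
    rwa [one_mul] at this
  apply c.irr_of_small
  · intro h0; rw [h0, charDeg_zero] at d; omega
  · intro ψ hψ hn
    rw [d]
    have ev := even_of_neg (by rw [hG]; trivial) hz n hψ hn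
    have := irr_pos hψ
    by_contra hlt
    have d2 : charDeg ψ = 2 := by omega
    rw [ip_mul_left, deg2_dual hG (irr_isChar h') hd', ip_comm] at hn
    have h4 := one_add_deg hG ((irr_isChar h').mul (irr_isChar hψ)) hS hn
        (by rw [(irr_isChar h').charDeg_mul (irr_isChar hψ), hd', dS, d2])
    have h5 : ψ = η := by
      by_contra hcon
      have h6 : ip (η * ψ) 1 = 0 := by
        rw [ip_mul_left, mul_one, deg2_dual hG (irr_isChar hψ) d2, irr_ip_ne h' hψ (Ne.symm hcon)]
      rw [h4, ip_add_left, irr_ne_deg hS irr_one (by rw [dS, charDeg_one]; omega), irr_norm irr_one] at h6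
      norm_num at h6
    rw [h5] at h4
    have h6 : η * η = θ * θ := by rw [h4]; simp
    have h7 := irr_norm (P5 hG h hd h' hd' hne)
    have h8 : ip (θ * θ) (η * η) = 1 := by
      rw [← h7]
      simp only [ip]
      congr 1
      ext g
      have a1 := congrFun (deg2_dual hG (irr_isChar h) hd) g
      have a2 := congrFun (deg2_dual hG (irr_isChar h') hd') g
      simp only [dual_apply] at a1 a2
      simp only [Pi.mul_apply, a1, a2]
      ring
    rw [h6, norm_sq hG h hd] at h8
    norm_num at h8

theorem P7 (hG : commutator G = ⊤) {z : G} (hz : ∀ g, z * g = g * z)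
    {θ η ζ : G → ℂ} (h : θ ∈ IrrChar G) (hd : charDeg θ = 2) (hθ : Cen z (-1) θ)
    (h' : η ∈ IrrChar G) (hd' : charDeg η = 2) (hη : Cen z (-1) η) (hne : θ ≠ η)
    (h'' : ζ ∈ IrrChar G) (hd'' : charDeg ζ = 2)
    (he : (θ * θ - 1) * η = (θ * θ - 1) * ζ) : η = ζ := by
  by_contra hcon
  have hi := P5 hG h' hd' h'' hd'' hcon
  have di : charDeg (η * ζ) = 4 := by rw [(irr_isChar h').charDeg_mul (irr_isChar h''), hd', hd'']
  obtain ⟨hS, dS⟩ := P1 hG h hd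
  have hn := irr_norm (P6 hG hz h hd hθ h' hd' hη hne)
  obtain ⟨hY, dY⟩ := P3 hG hz h hd hθ rfl rfl
  set S := θ * θ - 1 with hSe
  set T := θ * S - θ with hTe
  set Y := θ * T - S with hYe
  have dS' : dual S = S := by
    rw [hSe, dual_sub, dual_mul, dual_one, deg2_dual hG (irr_isChar h) hd]
  have e1 : S * S = (1 + S) + Y := by
    rw [hYe, hTe, hSe]; ring
  nth_rewrite 2 [he] at hn
  have h1 : ip (S * S) (η * ζ) = 1 := by
    rw [← hn]
    simp only [ip]
    congr 1
    ext g
    have a1 := congrFun dS' g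
    have a2 := congrFun (deg2_dual hG (irr_isChar h') hd') g
    simp only [dual_apply] at a1 a2
    simp only [Pi.mul_apply, a1, a2]
    ring
  rw [e1, ip_add_left, ip_add_left, irr_ne_deg irr_one hi (by rw [charDeg_one]; omega),
    irr_ne_deg hS hi (by omega), irr_ne_deg hY hi (by omega)] at h1
  norm_num at h1

end
end ACD

namespace ACD
open Matrix
section
variable {G : Type} [Group G] [Finite G]

theorem derived_perfect {N : Type} [Group N] (hN : commutator N = ⊤) (n : ℕ) : derivedSeries N n = ⊤ := by
  induction n with
  | zero => rfl
  | succ n ih => rw [derivedSeries_succ, ih]; exact hN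

theorem perfect_solv {N H : Type} [Group N] [Group H] (hN : commutator N = ⊤)
    (hH : Group.IsSolvable H) (f : N →* H) (n : N) : f n = 1 := by
  obtain ⟨k, hk⟩ := hH
  have h1 := map_derivedSeries_le_derivedSeries f k
  rw [derived_perfect hN, hk] at h1
  have : f n ∈ (⊥ : Subgroup H) := h1 ⟨n, trivial, rfl⟩
  simpa using this

theorem perm_solv {X : Type} [Finite X] (h : Nat.card X ≤ 4) : Group.IsSolvable (Equiv.Perm X) := by
  apply burnside_pq Nat.prime_two Nat.prime_three _ _ rfl
  rw [Nat.card_perm]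
  interval_cases Nat.card X
  · exact ⟨0, 0, by decide⟩
  · exact ⟨0, 0, by decide⟩
  · exact ⟨1, 0, by decide⟩
  · exact ⟨1, 1, by decide⟩
  · exact ⟨3, 1, by decide⟩

theorem abelian_deg (hc : ∀ a b : G, a * b = b * a) {l : G → ℂ} (h : l ∈ IrrChar G) : charDeg l = 1 := by
  obtain ⟨n, ρ, rfl, h1, hn, hd⟩ := irr_rep h
  rw [hd]
  have h2 : ∀ g, ∃ c : ℂ, ρ g = c • 1 := fun g =>
    schur ρ h1 (ρ g) (fun x => by rw [← map_mul, ← map_mul, hc])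
  choose c hc using h2
  have h3 : ∀ g, (ρ g).trace * (ρ g⁻¹).trace = (n : ℂ) * n := by
    intro g
    have e1 : ρ g * ρ g⁻¹ = 1 := by rw [← map_mul]; simp
    rw [hc g, hc g⁻¹] at e1
    have e2 := congrFun (congrFun e1 ⟨0, hn⟩) ⟨0, hn⟩
    simp at e2
    rw [hc g, hc g⁻¹]
    simp
    linear_combination (n * n : ℂ) * e2
  rw [ip] at h1
  simp only [h3] at h1
  rw [avg_const] at h1
  have : n * n = 1 := by exact_mod_cast h1
  exact Nat.eq_one_of_mul_eq_one_left this

theorem ip_res_cj {M : Subgroup G} [M.Normal] {χ : G → ℂ} (h : IsChar χ) (g : G) (l : M → ℂ) :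
    ip (res M χ) (cj g l) = ip (res M χ) l := by
  have := ip_surj (MulAut.conjNormal g : M ≃* M).toMonoidHom (MulAut.conjNormal g).surjective (res M χ) l
  rw [← this]
  simp only [ip]
  congr 1
  ext m
  simp [res, cj, h.conj]

theorem cj_cj {M : Subgroup G} [M.Normal] (g h : G) (l : M → ℂ) : cj g (cj h l) = cj (h * g) l := by
  ext m; simp [cj]

theorem perfect_fix {N M : Subgroup G} [M.Normal] (hN : commutator N = ⊤) {χ : G → ℂ} (hχ : IsChar χ)
    (hd : charDeg χ ≤ 4) {l : M → ℂ} (hl : l ∈ IrrChar M) (hne : ip (res M χ) l ≠ 0) (n : N) :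
    cj (n : G) l = l := by
  let X := {l : M → ℂ // l ∈ IrrChar M ∧ ip (res M χ) l ≠ 0}
  have hfin : ({l : M → ℂ | l ∈ IrrChar M ∧ ip (res M χ) l ≠ 0}).Finite :=
    irr_finite.subset fun l h => h.1
  have : Finite X := hfin
  have hcard : Nat.card X ≤ 4 := by
    classical
    have h1 : Nat.card X = ((Irr M).filter (fun l => ip (res M χ) l ≠ 0)).card := by
      rw [← Nat.card_eq_finsetCard]
      exact Nat.card_congr (Equiv.subtypeEquivRight (fun l => by simp))
    rw [h1]
    refine le_trans ?_ hd
    rw [← charDeg_res M χ, (hχ.res M).deg_eq_sum, Finset.card_eq_sum_ones]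
    refine le_trans (Finset.sum_le_sum (g := fun l => mu (res M χ) l * charDeg l) ?_)
      (Finset.sum_le_sum_of_subset (Finset.filter_subset _ _))
    intro l hl
    simp only [Finset.mem_filter, mem_Irr] at hl
    have := (mu_ne_zero (hχ.res M) (irr_isChar hl.1)).2 hl.2
    have h3 := irr_pos hl.1
    exact Nat.one_le_iff_ne_zero.2 (Nat.mul_ne_zero this h3.ne')
  let act : N → X → X := fun n l => ⟨cj (n : G)⁻¹ l.1, irr_cj _ l.2.1, by rw [ip_res_cj hχ]; exact l.2.2⟩
  let _ : MulAction N X :=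
    { smul := act
      one_smul := by
        intro l; apply Subtype.ext
        change cj _ _ = _
        ext m; simp [cj]
      mul_smul := by
        intro a b l; apply Subtype.ext
        change cj _ _ = cj _ (cj _ _)
        rw [cj_cj]; simp }
  have h1 := perfect_solv hN (perm_solv hcard) (MulAction.toPermHom N X) n⁻¹
  have h2 := DFunLike.congr_fun h1 ⟨l, hl, hne⟩
  have h3 := congrArg Subtype.val h2
  change cj (((n⁻¹ : N) : G))⁻¹ l = l at h3
  simpa using h3

theorem scalar_on {N M : Subgroup G} [M.Normal] [N.Normal] (hN : commutator N = ⊤) (hMN : M ≤ N)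
    (hM : ∀ a b : M, a * b = b * a) {n : ℕ} (ρ : G →* Matrix (Fin n) (Fin n) ℂ)
    (hn : n ≤ 4) (h0 : 0 < n)
    (hr : res N (fun g => (ρ g).trace) ∈ IrrChar N) :
    ∀ m ∈ M, ∃ c : ℂ, ρ m = c • 1 := by
  set χ : G → ℂ := fun g => (ρ g).trace with hχe
  have hχ : IsChar χ := ⟨n, ρ, fun g => rfl⟩
  have hχi := irr_of_res hχ hr
  have hd : charDeg χ = n := by
    have := hχ.one_eq
    rw [hχe] at this
    simp at this
    exact_mod_cast this.symm
  obtain ⟨l, hl, hne⟩ := (hχ.res M).exists_constituent (isChar_res_ne hχi)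
  obtain ⟨f, hf⟩ := (irr_isChar hl).linear (abelian_deg hM hl)
  have hfix := perfect_fix hN hχ (by omega) hl hne
  obtain ⟨c, hc⟩ := central_scalar (G := N) (K := M) (ρ.comp N.subtype) (irr_norm hr)
    (fun m => ⟨m, hMN m.2⟩) (fun m => l m⁻¹) (fun g => (MulAut.conjNormal (g : G)).toEquiv)
    (by intro g k; apply Subtype.ext; simp)
    (by
      intro g k
      have := congrFun (hfix g) k⁻¹
      simpa [cj] using this)
  have hc' : avg (fun m : M => l m⁻¹ • ρ (m : G)) = c • 1 := hc
  have hc0 : c ≠ 0 := by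
    rintro rfl
    apply hne
    have := congrArg Matrix.trace hc'
    rw [avg_trace] at this
    simp only [Matrix.trace_smul, smul_eq_mul, zero_mul] at this
    rw [ip, ← this]
    congr 1
    ext m
    simp [res, hχe, mul_comm]
  intro m hm
  refine ⟨l ⟨m, hm⟩, ?_⟩
  have h1 : ρ m * avg (fun m : M => l m⁻¹ • ρ (m : G)) = l ⟨m, hm⟩ • avg (fun m : M => l m⁻¹ • ρ (m : G)) := by
    rw [avg_mulLeft, ← avg_smul, ← avg_mul_left (fun k : M => l ⟨m, hm⟩ • l k⁻¹ • ρ (k : G)) (⟨m, hm⟩ : M)]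
    congr 1
    ext1 k
    rw [Matrix.mul_smul, ← map_mul]
    simp only [hf, smul_smul]
    simp
    congr 1
    have := Units.ne_zero (f ⟨m, hm⟩)
    field_simp
  rw [hc', Matrix.mul_smul, mul_one, smul_comm] at h1
  exact smul_right_injective _ hc0 h1

theorem central_case {M N : Subgroup G} [M.Normal] [N.Normal] (hN : commutator N = ⊤) (hMN : M ≤ N)
    (hM : ∀ a b : M, a * b = b * a)
    (hmin : ∀ K : Subgroup G, K.Normal → K ≤ M → K = ⊥ ∨ K = M)
    {χ : G → ℂ} (hχ : χ ∈ IrrChar G) (ht : ¬ Triv M χ) (hd : charDeg χ = 2 ∨ charDeg χ = 3) :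
    ∃ z : G, z ≠ 1 ∧ M = Subgroup.zpowers z ∧ (∀ g, z * g = g * z) ∧ orderOf z = charDeg χ := by
  have hp : (charDeg χ).Prime := by rcases hd with h | h <;> rw [h] <;> norm_num
  have htN : ¬ Triv N χ := fun h => ht fun m hm => h m (hMN hm)
  have hr := res_irr_of_prime hN hχ htN hp
  obtain ⟨n, ρ, he, h1, hn, hdn⟩ := irr_rep hχ
  have hsc := scalar_on hN hMN hM ρ (by omega) hn (by rw [← he]; exact hr)
  choose! c hc using hsc
  have hK : ∀ m ∈ M, ρ m = 1 → m = 1 := by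
    let K : Subgroup G := M ⊓ ρ.ker
    rcases hmin K inferInstance inf_le_left with h | h
    · intro m hm h2
      have : m ∈ K := ⟨hm, h2⟩
      rw [h] at this; simpa using this
    · exfalso; apply ht
      intro m hm
      rw [← h] at hm
      have h3 : ρ m = 1 := hm.2
      rw [he]; simp [h3]
  have hcen : ∀ m ∈ M, ∀ g, m * g = g * m := by
    intro m hm g
    have h2 := hK (g * m * g⁻¹ * m⁻¹) (M.mul_mem ((inferInstance : M.Normal).conj_mem m hm g) (M.inv_mem hm)) (by
      rw [map_mul, map_mul, map_mul, hc m hm, Matrix.mul_smul, mul_one, Matrix.smul_mul, ← map_mul,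
        mul_inv_cancel, map_one, ← hc m hm, ← map_mul, mul_inv_cancel, map_one])
    rw [mul_inv_eq_one, mul_inv_eq_iff_eq_mul] at h2
    exact h2.symm
  have hpow : ∀ m ∈ M, m ^ charDeg χ = 1 := by
    intro m hm
    apply hK _ (M.pow_mem hm _)
    have h2 := perfect_det hN (ρ.comp N.subtype) ⟨m, hMN hm⟩
    change (ρ m).det = 1 at h2
    rw [hc m hm, Matrix.det_smul] at h2
    simp at h2
    rw [map_pow, hc m hm, smul_pow, one_pow, hdn, h2, one_smul]
  have hne : ∃ z ∈ M, z ≠ 1 := by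
    by_contra hcon
    push Not at hcon
    exact ht fun m hm => by rw [hcon m hm]
  obtain ⟨z, hz, hz1⟩ := hne
  refine ⟨z, hz1, ?_, hcen z hz, ?_⟩
  · have hnorm : (Subgroup.zpowers z).Normal := by
      constructor
      intro x hx g
      have : x ∈ M := (Subgroup.zpowers_le.2 hz) hx
      rw [← hcen x this g]
      simpa using hx
    rcases hmin _ hnorm (Subgroup.zpowers_le.2 hz) with h | h
    · simp at h; exact absurd h hz1
    · exact h.symm
  · rcases (Nat.dvd_prime hp).1 (orderOf_dvd_of_pow_eq_one (hpow z hz)) with h | h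
    · rw [orderOf_eq_one_iff] at h; exact absurd h hz1
    · exact h

end
end ACD

namespace ACD
open Matrix
section
variable {G : Type} [Group G] [Finite G]

/-- Nontrivial irreducible characters on `M`. -/
noncomputable def NT (M : Subgroup G) : Finset (G → ℂ) := by
  classical exact (Irr G).filter (fun χ => ¬ Triv M χ)

theorem mem_NT {M : Subgroup G} {χ : G → ℂ} : χ ∈ NT M ↔ χ ∈ IrrChar G ∧ ¬ Triv M χ := by
  simp [NT]

/-- Irreducible characters trivial on `M`. -/
noncomputable def TR (M : Subgroup G) : Finset (G → ℂ) := by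
  classical exact (Irr G).filter (fun χ => Triv M χ)

theorem mem_TR {M : Subgroup G} {χ : G → ℂ} : χ ∈ TR M ↔ χ ∈ IrrChar G ∧ Triv M χ := by
  simp [TR]

/-- Linear characters. -/
noncomputable def Lin (G : Type) [Group G] [Finite G] : Finset (G → ℂ) := by
  classical exact (Irr G).filter (fun χ => charDeg χ = 1)

theorem mem_Lin {χ : G → ℂ} : χ ∈ Lin G ↔ χ ∈ IrrChar G ∧ charDeg χ = 1 := by
  simp [Lin]

theorem sum_split (M : Subgroup G) (F : (G → ℂ) → ℤ) :
    ∑ χ ∈ Irr G, F χ = ∑ χ ∈ TR M, F χ + ∑ χ ∈ NT M, F χ := by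
  classical
  rw [TR, NT]
  exact (Finset.sum_filter_add_sum_filter_not _ _ _).symm

theorem fiber_count (X Y : Finset (G → ℂ)) (hX : ∀ χ ∈ X, χ ∈ IrrChar G)
    (hY : ∀ ψ ∈ Y, IsChar ψ) {B : G → ℂ} (hB : IsChar B)
    (h : ∀ χ ∈ X, ∃ ψ ∈ Y, ip (ψ * B) χ ≠ 0) {c : ℕ} (hc : ∀ χ ∈ X, c ≤ charDeg χ) :
    c * X.card ≤ charDeg B * ∑ ψ ∈ Y, charDeg ψ := by
  classical
  choose! f hf hf' using h
  rw [Finset.card_eq_sum_card_fiberwise hf, Finset.mul_sum, Finset.mul_sum]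
  refine Finset.sum_le_sum fun ψ hψ => ?_
  have hp := (hY ψ hψ).mul hB
  rw [mul_comm (charDeg B), ← (hY ψ hψ).charDeg_mul hB, hp.deg_eq_sum, mul_comm, Finset.card_eq_sum_ones,
    Finset.sum_mul]
  refine le_trans (Finset.sum_le_sum (g := fun χ => mu (ψ * B) χ * charDeg χ) ?_)
      (Finset.sum_le_sum_of_subset ?_)
  · intro χ hχ
    simp only [Finset.mem_filter] at hχ
    rw [one_mul]
    have h1 := hf' χ hχ.1
    rw [hχ.2] at h1
    have h2 := Nat.pos_of_ne_zero ((mu_ne_zero hp (irr_isChar (hX χ hχ.1))).2 h1)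
    have h3 := hc χ hχ.1
    nlinarith
  · intro χ hχ
    simp only [Finset.mem_filter] at hχ
    exact mem_Irr.2 (hX χ hχ.1)

theorem lift_step {χ B D C : G → ℂ} (hχ : IsChar χ) (hB : B ∈ IrrChar G) (hD : D ∈ IrrChar G)
    (hC : IsChar C) (e : dual χ * B = D + C) : IsChar (χ * D - B) := by
  apply (hχ.mul (irr_isChar hD)).peel hB
  rw [mul_comm, ip_mul_left, e, ip_add_right, irr_norm hD, (irr_isChar hD).ip_eq hC]
  intro h
  have : 1 + mu D C = 0 := by exact_mod_cast h
  omega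

theorem commutator_sub {N : Subgroup G} (hN : commutator N = ⊤) {z : G} (hz : z ∈ N) : z ∈ commutator G := by
  have h1 : (commutator N).map N.subtype ≤ commutator G := by
    rw [commutator_def, Subgroup.map_commutator]
    exact Subgroup.commutator_mono le_top le_top
  rw [hN] at h1
  exact h1 ⟨⟨z, hz⟩, trivial, rfl⟩

theorem Cen.pow {z : G} {c : ℂ} {χ : G → ℂ} (h : Cen z c χ) (k : ℕ) (g : G) : χ (z ^ k * g) = c ^ k * χ g := by
  induction k with
  | zero => simp
  | succ k ih => rw [pow_succ', mul_assoc, h, ih]; ring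

theorem Cen.triv {z : G} {χ : G → ℂ} (h : Cen z 1 χ) : Triv (Subgroup.zpowers z) χ := by
  intro m hm
  obtain ⟨k, rfl⟩ := Submonoid.mem_powers_iff _ _ |>.1 (mem_powers_iff_mem_zpowers.2 hm)
  have := h.pow k 1
  simpa using this

theorem Cen.not_triv {z : G} {c : ℂ} {χ : G → ℂ} (hχ : χ ∈ IrrChar G) (h : Cen z c χ) (hc : c ≠ 1) :
    ¬ Triv (Subgroup.zpowers z) χ := by
  intro ht
  have h1 := ht z (Subgroup.mem_zpowers z)
  have h2 := h 1
  rw [mul_one, h1] at h2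
  have h3 : χ 1 ≠ 0 := by
    rw [(irr_isChar hχ).one_eq]; exact_mod_cast (irr_pos hχ).ne'
  apply hc
  have : (c - 1) * χ 1 = 0 := by linear_combination -h2
  rcases mul_eq_zero.1 this with h | h
  · exact sub_eq_zero.1 h
  · exact absurd h h3

theorem lin_triv {N : Subgroup G} (hN : commutator N = ⊤) {l : G → ℂ} (h : l ∈ Lin G) : Triv N l :=
  linear_triv hN (irr_isChar (mem_Lin.1 h).1) (mem_Lin.1 h).2

theorem case_two {N : Subgroup G} [N.Normal] (hN : commutator N = ⊤) {z : G} (hzN : z ∈ N)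
    (hz : ∀ g, z * g = g * z) (ho : z ^ 2 = 1) :
    0 ≤ ∑ χ ∈ NT (Subgroup.zpowers z), (5 * (charDeg χ : ℤ) - 16) := by
  classical
  have hzc := commutator_sub hN hzN
  have hcen : ∀ χ ∈ NT (Subgroup.zpowers z), Cen z (-1) χ ∧ 2 ∣ charDeg χ := by
    intro χ hχ
    obtain ⟨h1, h2⟩ := mem_NT.1 hχ
    obtain ⟨c, h3, h4, h5⟩ := central_root hzc hz h1
    have h6 := h5 2 ho
    have h7 : c = 1 ∨ c = -1 := by
      rcases mul_eq_zero.1 (show (c - 1) * (c + 1) = 0 by linear_combination h6) with h | h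
      · exact Or.inl (sub_eq_zero.1 h)
      · exact Or.inr (eq_neg_of_add_eq_zero_left h)
    rcases h7 with rfl | rfl
    · exact absurd h3.triv h2
    · have : ip χ χ ≠ 0 := by rw [irr_norm h1]; exact one_ne_zero
      exact ⟨h3, (even_of_neg hzc hz h3 h1 this).1⟩
  set X := (NT (Subgroup.zpowers z)).filter (fun χ => charDeg χ = 2) with hXdef
  set E := (NT (Subgroup.zpowers z)).filter (fun χ => charDeg χ = 6) with hEdef
  have key : X.card ≤ 2 * E.card := by
    by_cases hX : X = ∅
    · rw [hX]; simp
    obtain ⟨χ, hχ⟩ := Finset.nonempty_iff_ne_empty.2 hX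
    have hr : ∀ χ ∈ X, χ ∈ IrrChar G ∧ charDeg χ = 2 ∧ Cen z (-1) χ ∧ res N χ ∈ IrrChar N ∧
        Cen (⟨z, hzN⟩ : N) (-1) (res N χ) := by
      intro χ hχ
      obtain ⟨h1, h2⟩ := Finset.mem_filter.1 hχ
      have h3 := (hcen χ h1).1
      refine ⟨(mem_NT.1 h1).1, h2, h3, ?_, fun g => h3 g⟩
      refine res_irr_of_prime hN (mem_NT.1 h1).1 (fun ht => (mem_NT.1 h1).2 fun m hm => ht m ?_)
        (by rw [h2]; exact Nat.prime_two)
      exact (Subgroup.zpowers_le.2 hzN) hm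
    obtain ⟨h1, hd, hc, hθ, hcθ⟩ := hr χ hχ
    have hzN' : ∀ g : N, (⟨z, hzN⟩ : N) * g = g * ⟨z, hzN⟩ := fun g => Subtype.ext (hz g)
    set θ := res N χ with hθe
    have dθ : charDeg θ = 2 := hd
    have eθ : dual θ = θ := deg2_dual hN (irr_isChar hθ) dθ
    obtain ⟨hS, dS⟩ := P1 hN hθ dθ
    obtain ⟨hT, dT, -⟩ := P2 hN hzN' hθ dθ hcθ
    obtain ⟨hY, dY⟩ := P3 hN hzN' hθ dθ hcθ rfl rfl
    obtain ⟨hU, dU, cU⟩ := P4 hN hzN' hθ dθ hcθ rfl rfl rfl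
    set S := θ * θ - 1 with hSe
    set T := θ * S - θ with hTe
    set Y := θ * T - S with hYe
    set U := θ * Y - T with hUe
    set S' := χ * dual χ - 1 with hS'e
    set T' := χ * S' - χ with hT'e
    set Y' := dual χ * T' - S' with hY'e
    set U' := χ * Y' - T' with hU'e
    have rS : res N S' = S := by rw [hS'e, res_sub, res_mul, res_dual, res_one, ← hθe, eθ]
    have rT : res N T' = T := by rw [hT'e, res_sub, res_mul, rS]
    have rY : res N Y' = Y := by rw [hY'e, res_sub, res_mul, res_dual, rS, rT, ← hθe, eθ]
    have rU : res N U' = U := by rw [hU'e, res_sub, res_mul, rY, rT]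
    have cS' := isChar_adj h1
    rw [← hS'e] at cS'
    have iS : S' ∈ IrrChar G := irr_of_res cS' (by rw [rS]; exact hS)
    have cT' : IsChar T' := lift_step (irr_isChar h1) h1 iS isChar_one (by rw [hS'e]; ring)
    have iT : T' ∈ IrrChar G := irr_of_res cT' (by rw [rT]; exact hT)
    have cY' : IsChar Y' := lift_step (irr_isChar h1).dual iS iT (irr_isChar h1) (by
      rw [dual_dual, hT'e]; ring)
    have iY : Y' ∈ IrrChar G := irr_of_res cY' (by rw [rY]; exact hY)
    have cU' : IsChar U' := lift_step (irr_isChar h1) iT iY cS' (by rw [hY'e]; ring)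
    have hE : ∀ A : G → ℂ, IsChar A → res N A ∈ IrrChar N → charDeg A = 6 →
        A z = - A 1 → A ∈ E := by
      intro A hA hr hd hz1
      refine Finset.mem_filter.2 ⟨mem_NT.2 ⟨irr_of_res hA hr, fun ht => ?_⟩, hd⟩
      have h2 := ht z (Subgroup.mem_zpowers z)
      rw [hz1, hA.one_eq, hd] at h2
      norm_num at h2
    have hlE : (Lin G).card ≤ E.card := by
      apply Finset.card_le_card_of_injOn (fun l => l * U')
      · intro l hl
        have hl' := mem_Lin.1 (Finset.mem_coe.1 hl)
        apply hE
        · exact (irr_isChar hl'.1).mul cU'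
        · rw [res_mul, rU]
          exact linear_mul_irr ((irr_isChar hl'.1).res N) hl'.2 hU
        · rw [(irr_isChar hl'.1).charDeg_mul cU', hl'.2, ← charDeg_res N U', rU, dU]
        · have e1 := lin_triv hN (Finset.mem_coe.1 hl) z hzN
          have e2 := cU 1
          rw [← rU, mul_one] at e2
          change U' z = -1 * U' 1 at e2
          change l z * U' z = - (l 1 * U' 1)
          rw [e1, e2]; ring
      · intro l hl l' hl' he
        have a1 := Finset.mem_coe.1 hl
        have a2 := Finset.mem_coe.1 hl'
        exact gallagher_inj cU' (by rw [rU]; exact hU) (mem_Lin.1 a1).1 (lin_triv hN a1)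
          (mem_Lin.1 a2).1 (lin_triv hN a2) he
    have hX1 : (X.filter (fun η => res N η = θ)).card ≤ (Lin G).card := by
      refine (Finset.card_le_card (t := (Lin G).image (fun l => l * χ)) ?_).trans Finset.card_image_le
      intro η hη
      obtain ⟨h3, h4⟩ := Finset.mem_filter.1 hη
      obtain ⟨l, hl, hl1, -, he⟩ := same_res (irr_isChar h1) (irr_isChar (hr η h3).1) hθ h4
      exact Finset.mem_image.2 ⟨l, mem_Lin.2 ⟨hl, hl1⟩, he.symm⟩
    have hX2 : (X.filter (fun η => ¬ res N η = θ)).card ≤ E.card := by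
      apply Finset.card_le_card_of_injOn (fun η => S' * η)
      · intro η hη
        obtain ⟨h3, h4⟩ := Finset.mem_filter.1 (Finset.mem_coe.1 hη)
        obtain ⟨b1, b2, b3, b4, b5⟩ := hr η h3
        apply hE
        · exact cS'.mul (irr_isChar b1)
        · rw [res_mul, rS]
          exact P6 hN hzN' hθ dθ hcθ b4 b2 b5 (Ne.symm h4)
        · rw [cS'.charDeg_mul (irr_isChar b1), b2, ← charDeg_res N S', rS, dS]
        · have e1 : S' z = S' 1 := by
            have a1 := hc 1
            have a2 := hc z⁻¹
            rw [mul_one] at a1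
            rw [mul_inv_cancel] at a2
            rw [hS'e]
            simp only [Pi.sub_apply, Pi.mul_apply, dual_apply, Pi.one_apply, inv_one, a1]
            linear_combination -(χ 1) * a2
          have e2 := b3 1
          rw [mul_one] at e2
          change S' z * η z = - (S' 1 * η 1)
          rw [e1, e2]; ring
      · intro η hη η' hη' he
        obtain ⟨h3, h4⟩ := Finset.mem_filter.1 (Finset.mem_coe.1 hη)
        obtain ⟨b1, b2, b3, b4, b5⟩ := hr η h3
        obtain ⟨h3', h4'⟩ := Finset.mem_filter.1 (Finset.mem_coe.1 hη')
        obtain ⟨b1', b2', b3', b4', b5'⟩ := hr η' h3'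
        have he1 := congrArg (res N) he
        simp only [res_mul, rS] at he1
        have he2 := P7 hN hzN' hθ dθ hcθ b4 b2 b5 (Ne.symm h4) b4' b2' he1
        obtain ⟨l, hl, hl1, hlt, he3⟩ := same_res (irr_isChar b1) (irr_isChar b1') b4 he2.symm
        have he4 : 1 * (S' * η) = l * (S' * η) := by
          change S' * η = S' * η' at he
          calc 1 * (S' * η) = S' * η' := by rw [one_mul, he]
            _ = l * (S' * η) := by rw [he3]; ring
        have := gallagher_inj (cS'.mul (irr_isChar b1)) (by
          rw [res_mul, rS]
          exact P6 hN hzN' hθ dθ hcθ b4 b2 b5 (Ne.symm h4)) irr_one (triv_one N) hl hlt he4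
        rw [he3, ← this, one_mul]
    have := Finset.card_filter_add_card_filter_not (s := X) (fun η => res N η = θ)
    omega
  have hpt : ∀ χ ∈ NT (Subgroup.zpowers z), -6 * (if charDeg χ = 2 then (1:ℤ) else 0) +
      14 * (if charDeg χ = 6 then (1:ℤ) else 0) ≤ 5 * (charDeg χ : ℤ) - 16 := by
    intro χ hχ
    have h1 := (hcen χ hχ).2
    have h2 := irr_pos (mem_NT.1 hχ).1
    split_ifs <;> omega
  refine le_trans ?_ (Finset.sum_le_sum hpt)
  rw [Finset.sum_add_distrib, ← Finset.mul_sum, ← Finset.mul_sum, Finset.sum_boole, Finset.sum_boole,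
    ← hXdef, ← hEdef]
  omega

end
end ACD

namespace ACD
open Matrix
section
variable {G : Type} [Group G] [Finite G]

theorem add_constituent {A B ψ : G → ℂ} (hA : IsChar A) (hB : IsChar B) (hψ : ψ ∈ IrrChar G)
    (hne : ip A ψ ≠ 0) : ip (A + B) ψ ≠ 0 := by
  rw [ip_add_left, hA.ip_eq' hψ, hB.ip_eq' hψ]
  rw [hA.ip_eq' hψ] at hne
  intro h
  apply hne
  exact_mod_cast (by have : mu A ψ + mu B ψ = 0 := by exact_mod_cast h
                     omega : mu A ψ = 0)

theorem sub_constituent {A B ψ : G → ℂ} (hA : IsChar (A - B)) (hB : IsChar B) (hψ : ψ ∈ IrrChar G)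
    (hne : ip (A - B) ψ ≠ 0) : ip A ψ ≠ 0 := by
  have := add_constituent hA hB hψ hne
  simpa using this

theorem peel3 {A : G → ℂ} (hA : IsChar A) (hd : charDeg A = 9)
    (h : ∀ ψ ∈ IrrChar G, ip A ψ ≠ 0 → charDeg ψ = 3) :
    ∃ a ∈ IrrChar G, ∃ b ∈ IrrChar G, ∃ c ∈ IrrChar G, A = a + b + c ∧ ip A a ≠ 0 ∧ ip A b ≠ 0 ∧
      ip A c ≠ 0 := by
  obtain ⟨a, ha, hna⟩ := hA.exists_constituent (by intro h; rw [h, charDeg_zero] at hd; omega)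
  have h1 := hA.peel ha hna
  have d1 := (irr_isChar ha).charDeg_sub h1
  have e1 := h a ha hna
  obtain ⟨b, hb, hnb⟩ := h1.exists_constituent (by intro h; rw [h, charDeg_zero] at d1; omega)
  have h2 := h1.peel hb hnb
  have d2 := (irr_isChar hb).charDeg_sub h2
  have hnb' := sub_constituent h1 (irr_isChar ha) hb hnb
  have e2 := h b hb hnb'
  obtain ⟨c, hc, hnc⟩ := h2.exists_constituent (by intro h; rw [h, charDeg_zero] at d2; omega)
  have hnc' := sub_constituent h1 (irr_isChar ha) hc (sub_constituent h2 (irr_isChar hb) hc hnc)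
  have e3 := h c hc hnc'
  have h3 := h2.eq_of_deg hc hnc (by omega)
  exact ⟨a, ha, b, hb, c, hc, by rw [← h3]; ring, hna, hnb', hnc'⟩

theorem ip_ge {A a : G → ℂ} (hA : IsChar A) (ha : a ∈ IrrChar G) (h : ip A a ≠ 0) : 1 ≤ mu A a :=
  Nat.pos_of_ne_zero ((mu_ne_zero hA (irr_isChar ha)).2 h)

theorem peel3_norm {A : G → ℂ} (hA : IsChar A) (hd : charDeg A = 9)
    (h : ∀ ψ ∈ IrrChar G, ip A ψ ≠ 0 → charDeg ψ = 3) : 3 ≤ mu A A := by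
  obtain ⟨a, ha, b, hb, c, hc, e, h1, h2, h3⟩ := peel3 hA hd h
  have e1 : ip A A = ip A a + ip A b + ip A c := by
    nth_rewrite 2 [e]
    rw [ip_add_right, ip_add_right]
  rw [hA.ip_eq hA, hA.ip_eq' ha, hA.ip_eq' hb, hA.ip_eq' hc] at e1
  have e2 : mu A A = mu A a + mu A b + mu A c := by exact_mod_cast e1
  have := ip_ge hA ha h1
  have := ip_ge hA hb h2
  have := ip_ge hA hc h3
  omega

theorem norm3 {A : G → ℂ} (hA : IsChar A) (hd : charDeg A = 9)
    (h : ∀ ψ ∈ IrrChar G, ip A ψ ≠ 0 → 3 ∣ charDeg ψ) (hn : 3 ≤ mu A A) :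
    ∀ ψ ∈ IrrChar G, ip A ψ ≠ 0 → charDeg ψ = 3 := by
  intro a ha hna
  by_contra hcon
  have h0 := irr_pos ha
  have hdv := h a ha hna
  have h1 := hA.peel ha hna
  have d1 := (irr_isChar ha).charDeg_sub h1
  have key : ip A A = 1 ∨ ip A A = 2 := by
    by_cases hz : A - a = 0
    · left; rw [sub_eq_zero.1 hz]; exact irr_norm ha
    · right
      obtain ⟨b, hb, hnb⟩ := h1.exists_constituent hz
      have hnb' := sub_constituent h1 (irr_isChar ha) hb hnb
      have hdv' := h b hb hnb'
      have := h1.deg_le hb hnb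
      have h0' := irr_pos hb
      have h3 := h1.eq_of_deg hb hnb (by omega)
      have e : A = a + b := by rw [← h3]; ring
      rw [e, ip_add_left, ip_add_right, ip_add_right, irr_norm ha, irr_norm hb,
        irr_ne_deg ha hb (by omega), irr_ne_deg hb ha (by omega)]
      norm_num
  rw [hA.ip_eq hA] at key
  rcases key with h | h
  · have : mu A A = 1 := by exact_mod_cast h
    omega
  · have : mu A A = 2 := by exact_mod_cast h
    omega

theorem ip_prod (α β : G → ℂ) : ip (α * β) (α * β) = ip (α * dual α) (β * dual β) := by
  simp only [ip]
  congr 1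
  ext g
  simp only [Pi.mul_apply, dual_apply, inv_inv]
  ring

/-- If `χ * dual χ = 1 + (irreducible)`. -/
theorem adj_two {χ η : G → ℂ} (hχ : χ ∈ IrrChar G) (hd : charDeg χ = 3) (hη : η ∈ IrrChar G)
    (hd' : charDeg η = 3)
    (hn : mu (χ * dual χ) (χ * dual χ) ≤ 2) : mu (χ * η) (χ * η) ≤ 2 := by
  have hD := (irr_isChar hχ).mul (irr_isChar hχ).dual
  have hD' := (irr_isChar hη).mul (irr_isChar hη).dual
  have hR := isChar_adj hχ
  have dR := adj_deg hχ
  have oR := adj_ip_one hχ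
  set R := χ * dual χ - 1 with hRe
  have e : χ * dual χ = R + 1 := by rw [hRe]; ring
  have iR : R ∈ IrrChar G := by
    refine mem_irr_iff.2 ⟨hR, ?_⟩
    have h1 := hD.ip_eq hD
    rw [e, ip_add_left, ip_add_right, ip_add_right, oR, ip_comm 1 R, oR, irr_norm irr_one,
      hR.ip_eq hR, ← e] at h1
    have h2 : mu R R + 1 = mu (χ * dual χ) (χ * dual χ) := by
      have : (mu R R : ℂ) + 1 = mu (χ * dual χ) (χ * dual χ) := by linear_combination h1
      exact_mod_cast this
    have h3 : mu R R ≠ 0 := by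
      intro h0
      have := hR.norm_eq_zero (by rw [hR.ip_eq hR, h0]; simp)
      rw [this, charDeg_zero, hd] at dR
      omega
    rw [hR.ip_eq hR, show mu R R = 1 by omega]; simp
  have hp := (irr_isChar hχ).mul (irr_isChar hη)
  have h1 := ip_prod χ η
  have h0 : ip (η * dual η) 1 = 1 := by rw [ip_mul_left, dual_dual, mul_one, irr_norm hη]
  rw [e, ip_add_left, ip_comm 1, h0, hp.ip_eq hp, ip_comm R, hD'.ip_eq' iR] at h1
  have h2 : mu (χ * η) (χ * η) = mu (η * dual η) R + 1 := by exact_mod_cast h1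
  have h3 := hD'.mu_mul_le iR
  rw [(irr_isChar hη).charDeg_mul (irr_isChar hη).dual, charDeg_dual, hd'] at h3
  rw [hd] at dR
  have : charDeg R = 8 := by omega
  rw [this] at h3
  omega

theorem perfect_quotient {N : Type} [Group N] (hN : commutator N = ⊤) (K : Subgroup N) [K.Normal] :
    commutator (N ⧸ K) = ⊤ := by
  have h := Subgroup.map_commutator ⊤ ⊤ (QuotientGroup.mk' K)
  rw [← commutator_def, hN, ← MonoidHom.range_eq_map, MonoidHom.range_eq_top.2 (QuotientGroup.mk'_surjective K)] at h
  rw [commutator_def]; exact h.symm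

/-- An involution modulo the kernel. -/
theorem exists_inv {N : Type} [Group N] [Finite N] (hN : commutator N = ⊤) {θ : N → ℂ} (h : θ ∈ IrrChar N)
    (hd : charDeg θ = 3) : ∃ t, θ (t * t) = 3 ∧ θ t = -1 := by
  obtain ⟨ρ, hρ⟩ := (irr_isChar h).rep hd
  have hk : ∀ m, ρ m = 1 ↔ θ m = 3 := fun m => by
    constructor
    · intro h1; rw [hρ, h1]; simp
    · intro h1; apply one_of_trace; rw [← hρ, h1]; simp
  have h1 : θ 1 = 3 := by rw [(irr_isChar h).one_eq, hd]; norm_num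
  have ht : Triv ρ.ker θ := fun m hm => by rw [h1]; exact (hk m).1 hm
  obtain ⟨ψ, hψ, he⟩ := irr_quotient h ht
  have dψ : charDeg ψ = 3 := by
    have : charDeg θ = charDeg ψ := by rw [he]; simp [charDeg]
    rw [← this, hd]
  have h2 := odd_deg_three (perfect_quotient hN ρ.ker) hψ dψ
  obtain ⟨x, hx⟩ := exists_prime_orderOf_dvd_card' 2 h2
  obtain ⟨t, rfl⟩ := QuotientGroup.mk'_surjective ρ.ker x
  have h3 : θ (t * t) = 3 := by
    rw [← hk]
    have := pow_orderOf_eq_one (QuotientGroup.mk' ρ.ker t)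
    rw [hx, pow_two, ← map_mul] at this
    exact (QuotientGroup.eq_one_iff _).1 this
  refine ⟨t, h3, ?_⟩
  rcases deg3_kernel_sq hN (irr_isChar h) hd h3 with h4 | h4
  · exfalso
    have : QuotientGroup.mk' ρ.ker t = 1 := (QuotientGroup.eq_one_iff _).2 ((hk t).2 h4)
    rw [this, orderOf_one] at hx
    omega
  · exact h4

theorem cube_root {c : ℂ} (h : c ^ 3 = 1) (h1 : c ≠ 1) {d : ℕ} (hd : c ^ d = 1) : 3 ∣ d := by
  have : orderOf c = 3 := orderOf_eq_prime h h1
  rw [← this]; exact orderOf_dvd_of_pow_eq_one hd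

theorem cube_root_eq {c d : ℂ} (h : c ^ 3 = 1) (h1 : c ≠ 1) (h' : d ^ 3 = 1) (h1' : d ≠ 1) :
    d = c ∨ d * c = 1 := by
  have a : c ^ 2 + c + 1 = 0 := by
    have : (c - 1) * (c ^ 2 + c + 1) = 0 := by linear_combination h
    exact (mul_eq_zero.1 this).resolve_left (sub_ne_zero.2 h1)
  have b : d ^ 2 + d + 1 = 0 := by
    have : (d - 1) * (d ^ 2 + d + 1) = 0 := by linear_combination h'
    exact (mul_eq_zero.1 this).resolve_left (sub_ne_zero.2 h1')
  have : (d - c) * (d + c + 1) = 0 := by linear_combination b - a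
  rcases mul_eq_zero.1 this with h2 | h2
  · exact Or.inl (sub_eq_zero.1 h2)
  · right
    linear_combination c * h2 - a

theorem case_three {N : Subgroup G} [N.Normal] (hN : commutator N = ⊤) {z : G} (hzN : z ∈ N)
    (hz : ∀ g, z * g = g * z) (ho : z ^ 3 = 1) :
    0 ≤ ∑ χ ∈ NT (Subgroup.zpowers z), (5 * (charDeg χ : ℤ) - 16) := by
  classical
  have hzc := commutator_sub hN hzN
  have hcen : ∀ χ ∈ NT (Subgroup.zpowers z), ∃ c : ℂ, Cen z c χ ∧ c ^ 3 = 1 ∧ c ≠ 1 ∧ 3 ∣ charDeg χ := by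
    intro χ hχ
    obtain ⟨h1, h2⟩ := mem_NT.1 hχ
    obtain ⟨c, h3, h4, h5⟩ := central_root hzc hz h1
    have h6 := h5 3 ho
    have h7 : c ≠ 1 := by rintro rfl; exact h2 h3.triv
    exact ⟨c, h3, h6, h7, cube_root h6 h7 h4⟩
  have hcon : ∀ {A : G → ℂ} {c : ℂ}, Cen z c A → c ≠ 1 → ∀ ψ ∈ IrrChar G, ip A ψ ≠ 0 →
      ψ ∈ NT (Subgroup.zpowers z) := by
    intro A c hA hc ψ hψ hne
    obtain ⟨d, h3, -, -⟩ := central_root hzc hz hψ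
    have := hA.ip h3 hz hne
    exact mem_NT.2 ⟨hψ, h3.not_triv hψ (this ▸ hc)⟩
  set X := (NT (Subgroup.zpowers z)).filter (fun χ => charDeg χ = 3) with hXdef
  set Y := (NT (Subgroup.zpowers z)).filter (fun χ => ¬ charDeg χ = 3) with hYdef
  have hX : ∀ χ ∈ X, χ ∈ IrrChar G ∧ charDeg χ = 3 := fun χ h =>
    ⟨(mem_NT.1 (Finset.mem_filter.1 h).1).1, (Finset.mem_filter.1 h).2⟩
  have key : X.card ≤ 2 * ∑ ψ ∈ Y, charDeg ψ := by
    by_cases hA : ∃ χ ∈ X, mu (χ * dual χ) (χ * dual χ) ≤ 2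
    · obtain ⟨χ, hχ, hn⟩ := hA
      obtain ⟨c, h1, h2, h3, -⟩ := hcen χ (Finset.mem_filter.1 hχ).1
      obtain ⟨iχ, dχ⟩ := hX χ hχ
      set X1 := X.filter (fun η => Cen z c η) with hX1
      have e1 : X1.card ≤ ∑ ψ ∈ Y, charDeg ψ := by
        have := fiber_count X1 Y (fun η hη => (hX η (Finset.mem_filter.1 hη).1).1)
          (fun ψ hψ => irr_isChar (mem_NT.1 (Finset.mem_filter.1 hψ).1).1) (irr_isChar iχ).dual (c := 3) ?_ ?_
        · rw [charDeg_dual, dχ] at this; omega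
        · intro η hη
          obtain ⟨hη1, hη2⟩ := Finset.mem_filter.1 hη
          obtain ⟨iη, dη⟩ := hX η hη1
          by_contra hno
          push Not at hno
          have hc2 : c * c ≠ 1 := by
            intro h; apply h3; have : c = c ^ 3 := by linear_combination -c * h
            rw [this, h2]
          have hp := (irr_isChar iχ).mul (irr_isChar iη)
          have := peel3_norm hp
            (by rw [(irr_isChar iχ).charDeg_mul (irr_isChar iη), dχ, dη]) (by
              intro ψ hψ hne
              by_contra hd
              have hY : ψ ∈ Y := Finset.mem_filter.2 ⟨hcon (h1.mul hη2) hc2 ψ hψ hne, hd⟩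
              have := hno ψ hY
              rw [ip_mul_left, dual_dual, ip_comm] at this
              exact hne this)
          have := adj_two iχ dχ iη dη hn
          omega
        · intro η hη; exact (hX η (Finset.mem_filter.1 hη).1).2.ge
      have e2 : (X.filter (fun η => ¬ Cen z c η)).card ≤ X1.card := by
        apply Finset.card_le_card_of_injOn dual
        · intro η hη
          obtain ⟨hη1, hη2⟩ := Finset.mem_filter.1 (Finset.mem_coe.1 hη)
          obtain ⟨iη, dη⟩ := hX η hη1
          obtain ⟨d, a1, a2, a3, -⟩ := hcen η (Finset.mem_filter.1 hη1).1
          have a4 : d * c = 1 := by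
            rcases cube_root_eq h2 h3 a2 a3 with rfl | h
            · exact absurd a1 hη2
            · exact h
          have a5 : Cen z c (dual η) := by
            intro g
            have := a1 (z⁻¹ * g⁻¹)
            rw [mul_inv_cancel_left] at this
            rw [dual_apply, dual_apply, hz g, _root_.mul_inv_rev, this]
            linear_combination -(η (z⁻¹ * g⁻¹)) * a4
          apply Finset.mem_coe.2
          refine Finset.mem_filter.2 ⟨Finset.mem_filter.2 ⟨mem_NT.2 ⟨irr_dual iη, a5.not_triv (irr_dual iη) h3⟩, ?_⟩, a5⟩
          rw [charDeg_dual, dη]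
        · intro a _ b _ h
          have := congrArg dual h
          simpa using this
      have := Finset.card_filter_add_card_filter_not (s := X) (fun η => Cen z c η)
      rw [← hX1] at this
      omega
    · push Not at hA
      rcases X.eq_empty_or_nonempty with h0 | h0
      · rw [h0]; simp
      exfalso
      let k : (G → ℂ) → ℕ := fun χ => Nat.card {n : N // χ n = 3}
      obtain ⟨χ, hχ, hmax⟩ := X.exists_max_image k h0
      obtain ⟨c, h1, h2, h3, -⟩ := hcen χ (Finset.mem_filter.1 hχ).1
      obtain ⟨iχ, dχ⟩ := hX χ hχ
      have hc2 : c * c ≠ 1 := by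
        intro h; apply h3; have : c = c ^ 3 := by linear_combination -c * h
        rw [this, h2]
      have hp := (irr_isChar iχ).mul (irr_isChar iχ)
      have hA' : 3 ≤ mu (χ * χ) (χ * χ) := by
        have a := hA χ hχ
        have b := ip_prod χ χ
        have hD := (irr_isChar iχ).mul (irr_isChar iχ).dual
        rw [hp.ip_eq hp, hD.ip_eq hD] at b
        have : mu (χ * χ) (χ * χ) = mu (χ * dual χ) (χ * dual χ) := by exact_mod_cast b
        omega
      have dp : charDeg (χ * χ) = 9 := by rw [(irr_isChar iχ).charDeg_mul (irr_isChar iχ), dχ]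
      have hmemNT := hcon (h1.mul h1) hc2
      have hall := norm3 hp dp (fun ψ hψ hne => by
        obtain ⟨d, _, _, _, h⟩ := hcen ψ (hmemNT ψ hψ hne)
        exact h) hA'
      have hXmem : ∀ ψ ∈ IrrChar G, ip (χ * χ) ψ ≠ 0 → ψ ∈ X := fun ψ hψ hne =>
        Finset.mem_filter.2 ⟨hmemNT ψ hψ hne, hall ψ hψ hne⟩
      have hsubN : ∀ χ ∈ X, res N χ ∈ IrrChar N := by
        intro χ hχ
        have h4 := mem_NT.1 (Finset.mem_filter.1 hχ).1
        refine res_irr_of_prime hN h4.1 (fun ht => h4.2 fun m hm => ht m ?_)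
          (by rw [(hX χ hχ).2]; exact Nat.prime_three)
        exact (Subgroup.zpowers_le.2 hzN) hm
      obtain ⟨t, ht1, ht2⟩ := exists_inv hN (hsubN χ hχ) dχ
      have one3 : ∀ χ ∈ X, χ 1 = 3 := fun χ h => by
        rw [(irr_isChar (hX χ h).1).one_eq, (hX χ h).2]; norm_num
      have hker : ∀ ψ ∈ IrrChar G, ip (χ * χ) ψ ≠ 0 → ∀ g, χ g = 3 → ψ g = 3 := by
        intro ψ hψ hne g hg
        have := ker_constituent hp hψ hne (g := g) (by
          rw [Pi.mul_apply, Pi.mul_apply, hg, one3 χ hχ])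
        rw [this, one3 ψ (hXmem ψ hψ hne)]
      have hval : ∀ ψ ∈ IrrChar G, ip (χ * χ) ψ ≠ 0 → ψ (t : G) = -1 := by
        intro ψ hψ hne
        have hψX := hXmem ψ hψ hne
        have a1 := hker ψ hψ hne ((t : G) * t) ht1
        rcases deg3_kernel_sq hN (irr_isChar (hsubN ψ hψX)) (hX ψ hψX).2 (t := t) a1 with h | h
        · exfalso
          have := hmax ψ hψX
          have hlt : k χ < k ψ := by
            have e : {n : N | χ n = 3} ⊂ {n : N | ψ n = 3} := by
              refine ⟨fun n hn => hker ψ hψ hne n hn, fun hsub => ?_⟩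
              have a2 : χ t = 3 := hsub h
              have a3 : χ t = -1 := ht2
              rw [a2] at a3; norm_num at a3
            exact Set.ncard_lt_ncard e (Set.toFinite _)
          omega
        · exact h
      obtain ⟨a, ha, b, hb, c', hc', e, n1, n2, n3⟩ := peel3 hp dp hall
      have e2 := congrFun e (t : G)
      have a3 : χ t = -1 := ht2
      simp only [Pi.mul_apply, Pi.add_apply, hval a ha n1, hval b hb n2, hval c' hc' n3, a3] at e2
      norm_num at e2
  rw [← Finset.sum_filter_add_sum_filter_not _ (fun χ => charDeg χ = 3), ← hXdef, ← hYdef]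
  have s1 : ∑ χ ∈ X, (5 * (charDeg χ : ℤ) - 16) = - X.card := by
    rw [Finset.sum_congr rfl (g := fun _ => (-1 : ℤ)) (fun χ hχ => by rw [(hX χ hχ).2]; norm_num)]
    simp
  have s2 : ∑ χ ∈ Y, (2 * (charDeg χ : ℤ)) ≤ ∑ χ ∈ Y, (5 * (charDeg χ : ℤ) - 16) := by
    refine Finset.sum_le_sum fun χ hχ => ?_
    obtain ⟨h1, h2⟩ := Finset.mem_filter.1 hχ
    obtain ⟨_, _, _, _, h⟩ := hcen χ h1
    have := irr_pos (mem_NT.1 h1).1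
    omega
  rw [← Finset.mul_sum] at s2
  have : (X.card : ℤ) ≤ 2 * ∑ ψ ∈ Y, (charDeg ψ : ℤ) := by exact_mod_cast key
  linarith

end
end ACD

namespace ACD
open Matrix
open scoped commutatorElement
section
variable {G : Type} [Group G] [Finite G]

/-- minimal normal subgroups -/
def MinN (M : Subgroup G) : Prop :=
  M ≠ ⊥ ∧ ∀ K : Subgroup G, K.Normal → K ≤ M → K = ⊥ ∨ K = M

theorem exists_min (N : Subgroup G) (hn : N.Normal) (h0 : N ≠ ⊥) : ∃ M : Subgroup G, M.Normal ∧ MinN M ∧ M ≤ N := by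
  have hf : ({K : Subgroup G | K.Normal ∧ K ≠ ⊥ ∧ K ≤ N}).Finite := Set.toFinite _
  obtain ⟨M, hM⟩ := hf.exists_minimal ⟨N, hn, h0, le_rfl⟩
  refine ⟨M, hM.prop.1, ⟨hM.prop.2.1, fun K hK hle => ?_⟩, hM.prop.2.2⟩
  by_cases hb : K = ⊥
  · exact Or.inl hb
  · exact Or.inr (le_antisymm hle (hM.le_of_le ⟨hK, hb, hle.trans hM.prop.2.2⟩ hle))

theorem case_abelian {M N : Subgroup G} [M.Normal] [N.Normal] (hN : commutator N = ⊤) (hMN : M ≤ N)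
    (hM : ∀ a b : M, a * b = b * a) (hmin : MinN M) :
    0 ≤ ∑ χ ∈ NT M, (5 * (charDeg χ : ℤ) - 16) := by
  by_cases hex : ∃ χ ∈ NT M, charDeg χ = 2 ∨ charDeg χ = 3
  · obtain ⟨χ, hχ, hd⟩ := hex
    rw [mem_NT] at hχ
    obtain ⟨z, hz1, hzM, hzc, ho⟩ := central_case hN hMN hM hmin.2 hχ.1 hχ.2 hd
    have hzN : z ∈ N := hMN (hzM ▸ Subgroup.mem_zpowers z)
    have hp := pow_orderOf_eq_one z
    rw [ho] at hp
    rcases hd with hd | hd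
    · rw [hd] at hp
      rw [hzM]
      exact case_two hN hzN hzc hp
    · rw [hd] at hp
      rw [hzM]
      exact case_three hN hzN hzc hp
  · push Not at hex
    refine Finset.sum_nonneg fun χ hχ => ?_
    have h1 := hex χ hχ
    rw [mem_NT] at hχ
    have h2 := irr_pos hχ.1
    have h3 : charDeg χ ≠ 1 := fun h => hχ.2 fun m hm => linear_triv hN (irr_isChar hχ.1) h m (hMN hm)
    omega

theorem min_perfect {M : Subgroup G} [hn : M.Normal] (hmin : MinN M) (hM : ¬ ∀ a b : M, a * b = b * a) :
    commutator M = ⊤ ∧ ∀ a : M, (∀ b, a * b = b * a) → a = 1 := by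
  constructor
  · have h1 : ((commutator M).map M.subtype).Normal := inferInstance
    rcases hmin.2 _ h1 (Subgroup.map_subtype_le _) with h | h
    · exfalso; apply hM
      rw [Subgroup.map_eq_bot_iff_of_injective _ M.subtype_injective] at h
      intro a b
      have : ⁅a, b⁆ ∈ commutator M := Subgroup.commutator_mem_commutator (Subgroup.mem_top _) (Subgroup.mem_top _)
      rw [h, Subgroup.mem_bot] at this
      exact commutatorElement_eq_one_iff_mul_comm.1 this
    · rw [eq_top_iff]
      intro x _
      have : (x : G) ∈ (commutator M).map M.subtype := by rw [h]; exact x.2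
      obtain ⟨y, hy, he⟩ := this
      have : y = x := Subtype.ext he
      exact this ▸ hy
  · have h1 : ((Subgroup.center M).map M.subtype).Normal := inferInstance
    rcases hmin.2 _ h1 (Subgroup.map_subtype_le _) with h | h
    · rw [Subgroup.map_eq_bot_iff_of_injective _ M.subtype_injective] at h
      intro a ha
      have : a ∈ Subgroup.center M := Subgroup.mem_center_iff.2 fun g => (ha g).symm
      rw [h] at this
      simpa using this
    · exfalso; apply hM
      intro a b
      have : (a : G) ∈ (Subgroup.center M).map M.subtype := by rw [h]; exact a.2
      obtain ⟨y, hy, he⟩ := this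
      have hya : y = a := Subtype.ext he
      exact (Subgroup.mem_center_iff.1 (hya ▸ hy) b).symm

theorem faith_min {S : Subgroup G} [S.Normal] (hmin : MinN S) {n : ℕ} (ρ : G →* Matrix (Fin n) (Fin n) ℂ)
    (ht : ¬ Triv S (fun g => (ρ g).trace)) {s : G} (hs : s ∈ S) (h1 : ρ s = 1) : s = 1 := by
  have hk : (S ⊓ ρ.ker).Normal := inferInstance
  rcases hmin.2 _ hk inf_le_left with h | h
  · have : s ∈ S ⊓ ρ.ker := ⟨hs, h1⟩
    rw [h] at this
    simpa using this
  · exfalso; apply ht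
    intro m hm
    have : m ∈ S ⊓ ρ.ker := h.symm ▸ hm
    have h2 : ρ m = 1 := this.2
    simp only [h2, map_one]

theorem scalar_central {S : Subgroup G} [hn : S.Normal] (hmin : MinN S) {n : ℕ} (ρ : G →* Matrix (Fin n) (Fin n) ℂ)
    (ht : ¬ Triv S (fun g => (ρ g).trace)) {s : G} (hs : s ∈ S) {c : ℂ} (h1 : ρ s = c • 1) (x : G) :
    s * x = x * s := by
  have h2 : s * x * s⁻¹ * x⁻¹ = 1 := by
    apply faith_min hmin ρ ht
    · have := S.mul_mem hs (hn.conj_mem _ (S.inv_mem hs) x)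
      simpa [mul_assoc] using this
    · have e : ρ s * ρ x = ρ x * ρ s := by rw [h1]; simp
      rw [map_mul, map_mul, map_mul, e, mul_assoc (ρ x), ← map_mul ρ s, mul_inv_cancel, map_one, mul_one, ← map_mul, mul_inv_cancel, map_one]
  have := mul_inv_eq_one.1 h2
  exact (mul_inv_eq_iff_eq_mul.1 this)

theorem top_perfect (hG : commutator G = ⊤) : commutator (⊤ : Subgroup G) = ⊤ := by
  have h1 := Subgroup.map_subtype_commutator (⊤ : Subgroup G)
  rw [eq_top_iff]
  intro x _
  have h2 : (x : G) ∈ (commutator (⊤ : Subgroup G)).map (⊤ : Subgroup G).subtype := by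
    rw [h1]; change (x : G) ∈ commutator G; rw [hG]; trivial
  obtain ⟨y, hy, he⟩ := h2
  have : y = x := Subtype.ext he
  exact this ▸ hy

theorem min_small (hG : commutator G = ⊤) (hZ : ∀ a : G, (∀ b, a * b = b * a) → a = 1)
    {S : Subgroup G} [S.Normal] (hmin : MinN S) {θ : G → ℂ} (hθ : θ ∈ IrrChar G)
    (hd : charDeg θ = 2 ∨ charDeg θ = 3) (ht : ¬ Triv S θ) :
    commutator S = ⊤ ∧ res S θ ∈ IrrChar S := by
  have hna : ¬ ∀ a b : S, a * b = b * a := by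
    intro hab
    obtain ⟨z, hz1, -, hzc, -⟩ := central_case (top_perfect hG) le_top hab hmin.2 hθ ht hd
    exact hz1 (hZ z hzc)
  have h1 := (min_perfect hmin hna).1
  refine ⟨h1, res_irr_of_prime h1 hθ ht ?_⟩
  rcases hd with hd | hd <;> rw [hd] <;> norm_num

theorem no_two_aux (hG : commutator G = ⊤) (hZ : ∀ a : G, (∀ b, a * b = b * a) → a = 1)
    {S : Subgroup G} [S.Normal] (hmin : MinN S) {θ : G → ℂ} (hθ : θ ∈ IrrChar G)
    (hd : charDeg θ = 2) (ht : ¬ Triv S θ) : False := by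
  obtain ⟨hS, hr⟩ := min_small hG hZ hmin hθ (Or.inl hd) ht
  have hdr : charDeg (res S θ) = 2 := by rw [charDeg_res, hd]
  have h2 : 2 ∣ Nat.card S := by have := deg_dvd_card hr; rwa [hdr] at this
  obtain ⟨t, ho⟩ := exists_prime_orderOf_dvd_card' 2 h2
  have htt : (t : G) * t = 1 := by
    have := pow_orderOf_eq_one t
    rw [ho, pow_two] at this
    exact_mod_cast this
  have ht1 : (t : G) ≠ 1 := by
    intro h
    have : t = 1 := by exact_mod_cast h
    rw [this] at ho; simp at ho
  have h4 := deg2_sq hG (irr_isChar hθ) hd t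
  rw [htt, (irr_isChar hθ).one_eq, hd] at h4
  obtain ⟨n, ρ, rfl, hn1, hn, hdn⟩ := irr_rep hθ
  have hn2 : n = 2 := by omega
  have h5 : ‖(ρ (t : G)).trace‖ = n := by
    have h6 : ‖(ρ (t : G)).trace‖ ^ 2 = 4 := by
      rw [← norm_pow]
      have : (ρ (t : G)).trace ^ 2 = 4 := by push_cast at h4; linear_combination -h4
      rw [this]; norm_num
    have : (n : ℝ) = 2 := by rw [hn2]; norm_num
    rw [this]
    nlinarith [norm_nonneg (ρ (t : G)).trace]
  obtain ⟨c, hc⟩ := scalar_of_norm hn ρ t h5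
  exact ht1 (hZ t (scalar_central hmin ρ ht t.2 hc))

/-- elements of `M` all of whose conjugates are in the kernel -/
theorem cj_ker {M : Subgroup G} [hn : M.Normal] (hmin : MinN M) {θ : M → ℂ} (hθ : θ ∈ IrrChar M)
    {s : M} (hs : s ≠ 1) (h : ∀ g : G, cj g θ s = θ 1) : ∀ m, θ m = θ 1 := by
  obtain ⟨n, ρ, rfl, hn1, hn0, hdn⟩ := irr_rep hθ
  let K : Subgroup G := ρ.ker.map M.subtype
  have hK : (K.normalCore).Normal := inferInstance
  have hKM : K.normalCore ≤ M := (Subgroup.normalCore_le K).trans (Subgroup.map_subtype_le _)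
  have hsK : (s : G) ∈ K.normalCore := by
    intro g
    refine ⟨MulAut.conjNormal g s, ?_, by simp⟩
    change ρ _ = 1
    have := h g
    simp only [cj, map_one, Matrix.trace_one, Fintype.card_fin] at this
    exact one_of_trace ρ _ this
  rcases hmin.2 _ hK hKM with e | e
  · exfalso; apply hs
    rw [e, Subgroup.mem_bot] at hsK
    exact_mod_cast hsK
  · intro m
    have : (m : G) ∈ K := Subgroup.normalCore_le K (e.symm ▸ m.2)
    obtain ⟨y, hy, he⟩ := this
    have hym : y = m := Subtype.ext he
    have : ρ m = 1 := hym ▸ hy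
    simp only [this, map_one]

theorem not_triv_self {θ : G → ℂ} (hθ : θ ∈ IrrChar G) (hd : 2 ≤ charDeg θ) : ¬ ∀ m, θ m = θ 1 := by
  intro h
  have h1 := irr_norm hθ
  have h2 : ip θ θ = (charDeg θ : ℂ) * charDeg θ := by
    simp only [ip]
    have : (fun g => θ g * θ g⁻¹) = fun _ => (charDeg θ : ℂ) * charDeg θ := by
      ext g; rw [h g, h g⁻¹, (irr_isChar hθ).one_eq]
    rw [this, avg_const]
  rw [h1] at h2
  have h3 : 1 = charDeg θ * charDeg θ := by exact_mod_cast h2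
  nlinarith

theorem no_two {M : Subgroup G} [M.Normal] (hmin : MinN M) (hM : commutator M = ⊤)
    (hZ : ∀ a : M, (∀ b, a * b = b * a) → a = 1) {θ : M → ℂ} (hθ : θ ∈ IrrChar M) : charDeg θ ≠ 2 := by
  intro hd
  have h0 : (⊤ : Subgroup M) ≠ ⊥ := by
    intro e
    apply hmin.1
    rw [eq_bot_iff]
    intro x hx
    have : (⟨x, hx⟩ : M) ∈ (⊥ : Subgroup M) := e ▸ Subgroup.mem_top _
    simpa using this
  obtain ⟨S, hSn, hS, -⟩ := exists_min (⊤ : Subgroup M) inferInstance h0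
  obtain ⟨⟨s, hs⟩, hs1⟩ := (Subgroup.ne_bot_iff_exists_ne_one).1 hS.1
  have : ∃ g : G, ¬ Triv S (cj g θ) := by
    by_contra hcon
    push Not at hcon
    refine not_triv_self hθ (by omega) (cj_ker hmin hθ (s := s) ?_ fun g => ?_)
    · intro e; exact hs1 (Subtype.ext e)
    · rw [hcon g s hs]; simp [cj]
  obtain ⟨g, hg⟩ := this
  exact no_two_aux hM hZ hS (irr_cj g hθ) (by rw [charDeg_cj, hd]) hg

theorem min_simple {M : Subgroup G} [hn : M.Normal] (hmin : MinN M) (hM : commutator M = ⊤)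
    (hZ : ∀ a : M, (∀ b, a * b = b * a) → a = 1) {χ : G → ℂ} (hχ : χ ∈ IrrChar G)
    (ht : ¬ Triv M χ) (hd : charDeg χ = 3) (K : Subgroup M) (hK : K.Normal) : K = ⊥ ∨ K = ⊤ := by
  have hr := res_irr_of_prime hM hχ ht (by rw [hd]; norm_num)
  obtain ⟨n, ρ, rfl, hn1, hn0, hdn⟩ := irr_rep hχ
  by_cases hKb : K = ⊥
  · exact Or.inl hKb
  right
  obtain ⟨S, hSn, hS, hSK⟩ := exists_min K hK hKb
  obtain ⟨⟨s, hs⟩, hs1⟩ := (Subgroup.ne_bot_iff_exists_ne_one).1 hS.1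
  have hs1 : s ≠ 1 := fun e => hs1 (Subtype.ext e)
  have htS : ¬ Triv S (res M (fun g => (ρ g).trace)) := by
    intro h
    have h1 := h s hs
    simp only [res, OneMemClass.coe_one, map_one, Matrix.trace_one, Fintype.card_fin] at h1
    have h2 := one_of_trace ρ _ h1
    exact hs1 (Subtype.ext (faith_min hmin ρ ht s.2 h2))
  obtain ⟨hSp, hSr⟩ := min_small hM hZ hS hr (Or.inr (by rw [charDeg_res, hd])) htS
  have hcen : ∀ m : M, (∀ x ∈ S, m * x = x * m) → m = 1 := by
    intro m hm
    let ρS : S →* Matrix (Fin n) (Fin n) ℂ := ρ.comp (M.subtype.comp S.subtype)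
    obtain ⟨c, hc⟩ := schur ρS (irr_norm hSr) (ρ m) (fun x => by
      have := hm x x.2
      change ρ ((x : M) : G) * ρ (m : G) = ρ (m : G) * ρ ((x : M) : G)
      rw [← map_mul, ← map_mul, ← Subgroup.coe_mul, ← Subgroup.coe_mul, this])
    exact hZ m fun b => Subtype.ext (scalar_central hmin ρ ht m.2 hc b)
  have hconj : ∀ (g : G), ∀ x ∈ S, MulAut.conjNormal g x ∈ S := by
    intro g
    let T : Subgroup M := S.comap (MulAut.conjNormal g : M ≃* M).toMonoidHom
    have hT : T.Normal := inferInstance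
    have hTS : (T ⊓ S).Normal := inferInstance
    rcases hS.2 _ hTS inf_le_right with e | e
    · exfalso
      apply hs1
      have hx0 : ∃ x ∈ T, MulAut.conjNormal g x = s :=
        ⟨(MulAut.conjNormal g).symm s, by simpa [T] using hs, by simp⟩
      obtain ⟨x, hx, hxs⟩ := hx0
      have : x = 1 := by
        apply hcen
        intro y hy
        have : x * y * x⁻¹ * y⁻¹ ∈ T ⊓ S := by
          constructor
          · have := T.mul_mem hx (hT.conj_mem _ (T.inv_mem hx) y)
            simpa [mul_assoc] using this
          · exact S.mul_mem (hSn.conj_mem _ hy x) (S.inv_mem hy)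
        rw [e, Subgroup.mem_bot] at this
        exact mul_inv_eq_iff_eq_mul.1 (mul_inv_eq_one.1 this)
      rw [← hxs, this, map_one]
    · intro x hx
      have : x ∈ T ⊓ S := e.symm ▸ hx
      exact this.1
  have hSG : (S.map M.subtype).Normal := by
    constructor
    rintro _ ⟨x, hx, rfl⟩ g
    exact ⟨MulAut.conjNormal g x, hconj g x hx, by simp⟩
  rcases hmin.2 _ hSG (Subgroup.map_subtype_le _) with h | h
  · rw [Subgroup.map_eq_bot_iff_of_injective _ M.subtype_injective] at h
    exact absurd h hS.1
  · rw [eq_top_iff]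
    intro x _
    have : (x : G) ∈ S.map M.subtype := by rw [h]; exact x.2
    obtain ⟨y, hy, he⟩ := this
    have : y = x := Subtype.ext he
    exact hSK (this ▸ hy)

theorem min_invol {M : Subgroup G} [hn : M.Normal] (hmin : MinN M) (hM : commutator M = ⊤)
    (hZ : ∀ a : M, (∀ b, a * b = b * a) → a = 1) {χ : G → ℂ} (hχ : χ ∈ IrrChar G)
    (ht : ¬ Triv M χ) (hd : charDeg χ = 3) :
    ∃ t : M, ∀ φ ∈ IrrChar M, charDeg φ = 3 → φ t = -1 := by
  have hr := res_irr_of_prime hM hχ ht (by rw [hd]; norm_num)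
  have h2 := odd_deg_three hM hr (by rw [charDeg_res, hd])
  obtain ⟨t, ho⟩ := exists_prime_orderOf_dvd_card' 2 h2
  have htt : t * t = 1 := by
    have := pow_orderOf_eq_one t
    rwa [ho, pow_two] at this
  have ht1 : t ≠ 1 := by
    intro h
    rw [h] at ho; simp at ho
  refine ⟨t, fun φ hφ h3 => ?_⟩
  have h5 : φ (t * t) = 3 := by rw [htt, (irr_isChar hφ).one_eq, h3]; norm_num
  rcases deg3_kernel_sq hM (irr_isChar hφ) h3 h5 with h | h
  · exfalso
    have hnt := not_triv_self hφ (by omega)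
    obtain ⟨n, ρ, rfl, hn1, hn0, hdn⟩ := irr_rep hφ
    have hn3 : n = 3 := by omega
    have h6 : ρ t = 1 := one_of_trace ρ t (by simp only at h; rw [h, hn3]; norm_num)
    rcases min_simple hmin hM hZ hχ ht hd ρ.ker inferInstance with e | e
    · have : t ∈ ρ.ker := h6
      rw [e] at this
      exact ht1 (by simpa using this)
    · apply hnt
      intro m
      have : m ∈ ρ.ker := e ▸ Subgroup.mem_top m
      have : ρ m = 1 := this
      simp only [this, map_one]
  · exact h

theorem residual (h : ¬ Group.IsSolvable G) : ∃ N : Subgroup G, N.Normal ∧ N ≠ ⊥ ∧ commutator N = ⊤ := by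
  have hst : ∃ n, derivedSeries G (n + 1) = derivedSeries G n := by
    by_contra hcon
    push Not at hcon
    have hlt : StrictAnti (derivedSeries G) := strictAnti_nat_of_succ_lt fun n =>
      lt_of_le_of_ne (derivedSeries_antitone G (Nat.le_succ n)) (hcon n)
    exact not_injective_infinite_finite _ hlt.injective
  obtain ⟨n, hn⟩ := hst
  refine ⟨derivedSeries G n, inferInstance, fun hb => h ⟨n, hb⟩, ?_⟩
  rw [derivedSeries_succ] at hn
  rw [eq_top_iff]
  intro x _
  have h1 := Subgroup.map_subtype_commutator (derivedSeries G n)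
  rw [hn] at h1
  have : (x : G) ∈ (commutator (derivedSeries G n)).map (derivedSeries G n).subtype := by
    rw [h1]; exact x.2
  obtain ⟨y, hy, he⟩ := this
  have : y = x := Subtype.ext he
  exact this ▸ hy

end
end ACD

namespace ACD
open Matrix
section
variable {G : Type} [Group G] [Finite G]

theorem lift_constituent {A : G → ℂ} (hA : IsChar A) (H : Subgroup G) {η : H → ℂ}
    (hne : ip (res H A) η ≠ 0) : ∃ ψ ∈ IrrChar G, ip A ψ ≠ 0 ∧ ip (res H ψ) η ≠ 0 := by
  by_contra hcon
  push Not at hcon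
  apply hne
  rw [hA.eq_sum, res_sum, ip_sum_left]
  refine Finset.sum_eq_zero fun ψ hψ => ?_
  rw [res_smul, ip_smul_left]
  by_cases h : ip A ψ = 0
  · rw [h, zero_mul]
  · rw [hcon ψ (mem_Irr.1 hψ) h, mul_zero]

theorem avg_ind {M : Type} [Group M] [Finite M] (P : Subgroup M) (f : M → ℂ) :
    avg (fun m => (P : Set M).indicator 1 m * f m) = ((Nat.card P : ℂ) / Nat.card M) * avg (res P f) := by
  classical
  have := Fintype.ofFinite M
  have iP := Fintype.ofFinite P
  rw [avg_eq, avg_eq, smul_eq_mul, smul_eq_mul]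
  have h0 : (Nat.card P : ℂ) ≠ 0 := by exact_mod_cast Nat.card_pos.ne'
  have h1 : ∑ m, (P : Set M).indicator (1 : M → ℂ) m * f m = ∑ p : P, res P f p := by
    have h2 := Finset.sum_subtype (p := fun x => x ∈ P) (F := iP) (Finset.univ.filter (· ∈ P)) (by simp) f
    change _ = ∑ p : P, f p
    rw [← h2, Finset.sum_filter]
    refine Finset.sum_congr rfl fun m _ => ?_
    by_cases h : m ∈ P <;> simp [h]
  rw [h1]
  field_simp

theorem avg_inv_class {M : Subgroup G} [M.Normal] (P : Subgroup M) {ψ : G → ℂ} (hψ : IsChar ψ) :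
    avg (fun m : M => avg (fun g : G => (P : Set M).indicator 1 (MulAut.conjNormal g m)) * ψ m)
      = ((Nat.card P : ℂ) / Nat.card M) * avg (res P (res M ψ)) := by
  rw [← avg_ind]
  have h1 : ∀ m : M, avg (fun g : G => (P : Set M).indicator (1 : M → ℂ) (MulAut.conjNormal g m)) * ψ m
      = avg (fun g : G => (P : Set M).indicator (1 : M → ℂ) (MulAut.conjNormal g m) * ψ m) := by
    intro m
    rw [mul_comm, ← smul_eq_mul, ← avg_smul]
    congr 1; ext g; rw [smul_eq_mul, mul_comm]
  simp only [h1]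
  rw [avg_comm]
  have h2 : ∀ g : G, avg (fun m : M => (P : Set M).indicator (1 : M → ℂ) (MulAut.conjNormal g m) * ψ m)
      = avg (fun m : M => (P : Set M).indicator 1 m * res M ψ m) := by
    intro g
    rw [← avg_equiv (MulAut.conjNormal g : M ≃* M).toEquiv
      (fun m : M => (P : Set M).indicator (1 : M → ℂ) m * res M ψ m)]
    congr 1; ext m
    simp [res, hψ.conj]
  simp only [h2]
  rw [avg_const]

theorem q_const {M : Subgroup G} [M.Normal] (P : Subgroup M) {ψ χ : G → ℂ} (hψ : ψ ∈ IrrChar G)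
    (hχ : χ ∈ IrrChar G) {θ : M → ℂ} (hθ : θ ∈ IrrChar M) (h1 : ip (res M ψ) θ ≠ 0)
    (h2 : ip (res M χ) θ ≠ 0) :
    mu (res P (res M ψ)) 1 * charDeg χ = mu (res P (res M χ)) 1 * charDeg ψ := by
  let φ : M → ℂ := fun m => avg (fun g : G => (P : Set M).indicator 1 (MulAut.conjNormal g m))
  have hφ : ∀ (g : G) (m : M), φ (MulAut.conjNormal g m) = φ m := by
    intro g m
    change avg _ = avg _
    rw [← avg_mul_right (fun x : G => (P : Set M).indicator (1 : M → ℂ) (MulAut.conjNormal x m)) g]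
    congr 1; ext x
    rw [map_mul]; rfl
  have e1 := central_eq hψ hθ h1 φ hφ
  have e2 := central_eq hχ hθ h2 φ hφ
  rw [avg_inv_class P (irr_isChar hψ)] at e1
  rw [avg_inv_class P (irr_isChar hχ)] at e2
  have n1 := (((irr_isChar hψ).res M).res P).ip_eq isChar_one
  have n2 := (((irr_isChar hχ).res M).res P).ip_eq isChar_one
  rw [ip_one_right] at n1 n2
  rw [n1, (irr_isChar hψ).one_eq] at e1
  rw [n2, (irr_isChar hχ).one_eq] at e2
  have hP : (Nat.card P : ℂ) ≠ 0 := by exact_mod_cast Nat.card_pos.ne'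
  have hM : (Nat.card M : ℂ) ≠ 0 := by exact_mod_cast Nat.card_pos.ne'
  have hθ1 : θ 1 ≠ 0 := by rw [(irr_isChar hθ).one_eq]; exact_mod_cast (irr_pos hθ).ne'
  have hc : (Nat.card P : ℂ) / Nat.card M * θ 1 ≠ 0 := mul_ne_zero (div_ne_zero hP hM) hθ1
  have : (mu (res P (res M ψ)) 1 * charDeg χ : ℂ) = mu (res P (res M χ)) 1 * charDeg ψ := by
    apply mul_left_cancel₀ hc
    linear_combination (charDeg χ : ℂ) * e1 - (charDeg ψ : ℂ) * e2
  exact_mod_cast this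

/-- characters trivial on `M` restrict irreducibly to supplements -/
theorem res_supp {M H : Subgroup G} [M.Normal] (hHM : ∀ g : G, ∃ h ∈ H, ∃ m ∈ M, g = h * m) :
    Function.Surjective ((QuotientGroup.mk' M).comp H.subtype) := by
  intro q
  obtain ⟨g, rfl⟩ := QuotientGroup.mk_surjective q
  obtain ⟨h, hh, m, hm, rfl⟩ := hHM g
  refine ⟨⟨h, hh⟩, ?_⟩
  simp only [MonoidHom.comp_apply, QuotientGroup.mk'_apply, Subgroup.subtype_apply]
  rw [QuotientGroup.eq]
  simpa using hm

theorem fam_S1 {M H : Subgroup G} [M.Normal] (hHM : ∀ g : G, ∃ h ∈ H, ∃ m ∈ M, g = h * m)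
    (P : Subgroup M) (hPH : ∀ x ∈ P, (x : G) ∈ H) {p : ℕ} {χ : G → ℂ} (hχ : χ ∈ NT M)
    (hχH : ip (res H χ) 1 ≠ 0) (hp : p * mu (res P (res M χ)) 1 ≤ charDeg χ) :
    ∃ X : Finset (G → ℂ), X ⊆ NT M ∧ (∀ ψ ∈ X, p ≤ charDeg ψ) ∧
      p * ∑ β ∈ TR M, charDeg β ≤ ∑ ψ ∈ X, charDeg ψ := by
  classical
  rw [mem_NT] at hχ
  have hsurj := res_supp hHM
  have hirr : ∀ β ∈ TR M, res H β ∈ IrrChar H := by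
    intro β hβ
    rw [mem_TR] at hβ
    obtain ⟨ψ, hψ, rfl⟩ := irr_quotient hβ.1 hβ.2
    exact irr_surj _ hsurj hψ
  have hinj : Set.InjOn (res H) (TR M : Set (G → ℂ)) := by
    intro β hβ β' hβ' he
    rw [Finset.mem_coe, mem_TR] at hβ hβ'
    obtain ⟨ψ, hψ, rfl⟩ := irr_quotient hβ.1 hβ.2
    obtain ⟨ψ', hψ', rfl⟩ := irr_quotient hβ'.1 hβ'.2
    ext g
    obtain ⟨h, hh⟩ := hsurj (QuotientGroup.mk' M g)
    have := congrFun he h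
    change ψ _ = ψ' _ at this
    rw [← hh]
    exact this
  -- lower bound on fixed points
  let inc : P →* H := ⟨⟨fun x => ⟨x, hPH x x.2⟩, rfl⟩, fun _ _ => rfl⟩
  have hlow : ∀ ψ ∈ IrrChar G, ∑ β ∈ (TR M).filter (fun β => ip (res H ψ) (res H β) ≠ 0), charDeg β
      ≤ mu (res P (res M ψ)) 1 := by
    intro ψ hψ
    have hψH := (irr_isChar hψ).res H
    have e1 : mu (res P (res M ψ)) 1 = ∑ η ∈ Irr H, mu (res H ψ) η * mu (fun x => η (inc x)) 1 := by
      have h1 : (mu (res P (res M ψ)) 1 : ℂ) = ∑ η ∈ Irr H, (mu (res H ψ) η * mu (fun x => η (inc x)) 1 : ℂ) := by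
        rw [← (((irr_isChar hψ).res M).res P).ip_eq isChar_one]
        have h2 : res P (res M ψ) = ∑ η ∈ Irr H, ip (res H ψ) η • (fun x => η (inc x)) := by
          ext x
          have := congrFun hψH.eq_sum (inc x)
          change ψ _ = _
          change ψ _ = _ at this
          rw [Finset.sum_apply] at this ⊢
          exact this
        rw [h2, ip_sum_left]
        refine Finset.sum_congr rfl fun η hη => ?_
        rw [mem_Irr] at hη
        rw [ip_smul_left, hψH.ip_eq' hη, ((irr_isChar hη).comp inc).ip_eq isChar_one]
      exact_mod_cast h1
    rw [e1]
    have e2 : ∑ β ∈ (TR M).filter (fun β => ip (res H ψ) (res H β) ≠ 0), charDeg β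
        ≤ ∑ β ∈ (TR M).filter (fun β => ip (res H ψ) (res H β) ≠ 0),
          mu (res H ψ) (res H β) * mu (fun x => (res H β) (inc x)) 1 := by
      refine Finset.sum_le_sum fun β hβ => ?_
      rw [Finset.mem_filter] at hβ
      have h1 := (mu_ne_zero hψH (irr_isChar (hirr β hβ.1))).2 hβ.2
      have hb := mem_TR.1 hβ.1
      have h2 : mu (fun x => (res H β) (inc x)) 1 = charDeg β := by
        have h3 : (mu (fun x => (res H β) (inc x)) 1 : ℂ) = charDeg β := by
          rw [← (((irr_isChar hb.1).res H).comp inc).ip_eq isChar_one, ip_one_right]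
          have : (fun x => (res H β) (inc x)) = fun _ => (charDeg β : ℂ) := by
            ext x
            rw [← (irr_isChar hb.1).one_eq]
            exact hb.2 _ (x : M).2
          rw [this, avg_const]
        exact_mod_cast h3
      rw [h2]
      exact Nat.le_mul_of_pos_left _ (Nat.pos_of_ne_zero h1)
    refine e2.trans ?_
    rw [← Finset.sum_image (f := fun η => mu (res H ψ) η * mu (fun x => η (inc x)) 1) (g := res H)]
    · refine Finset.sum_le_sum_of_subset fun η hη => ?_
      rw [Finset.mem_image] at hη
      obtain ⟨β, hβ, rfl⟩ := hη
      exact mem_Irr.2 (hirr β (Finset.mem_filter.1 hβ).1)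
    · exact fun a ha b hb h => hinj (Finset.mem_filter.1 ha).1 (Finset.mem_filter.1 hb).1 h
  -- each beta occurs
  let X := (NT M).filter (fun ψ => 0 < mu (res P (res M ψ)) 1 ∧ p * mu (res P (res M ψ)) 1 ≤ charDeg ψ)
  have hocc : ∀ β ∈ TR M, ∃ ψ ∈ X, ip (res H ψ) (res H β) ≠ 0 := by
    intro β hβ
    have hb := mem_TR.1 hβ
    have hbH := hirr β hβ
    have hA : IsChar (β * χ) := (irr_isChar hb.1).mul (irr_isChar hχ.1)
    have hne : ip (res H (β * χ)) (res H β) ≠ 0 := by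
      have h1 := ((irr_isChar hχ.1).res H).peel irr_one hχH
      have h2 : res H (β * χ) = res H β * (res H χ - 1) + res H β := by rw [res_mul]; ring
      rw [h2, ip_add_left, irr_norm hbH]
      obtain ⟨r, hr⟩ := ((irr_isChar hbH).mul h1).ip_nat (irr_isChar hbH)
      rw [hr]
      exact_mod_cast Nat.succ_ne_zero r
    obtain ⟨ψ, hψ, h1, h2⟩ := lift_constituent hA H hne
    have hψM : ∃ θ ∈ IrrChar M, ip (res M ψ) θ ≠ 0 ∧ ip (res M χ) θ ≠ 0 := by
      obtain ⟨θ, hθ, h3⟩ := ((irr_isChar hψ).res M).exists_constituent (isChar_res_ne hψ)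
      refine ⟨θ, hθ, h3, ?_⟩
      have h4 : IsChar (β * χ - ψ) := hA.peel hψ h1
      have h5 : ip (res M (β * χ)) θ ≠ 0 := by
        have : β * χ = (β * χ - ψ) + ψ := by ring
        rw [this, res_add, ip_add_left, (h4.res M).ip_eq' hθ, ((irr_isChar hψ).res M).ip_eq' hθ]
        have := (mu_ne_zero ((irr_isChar hψ).res M) (irr_isChar hθ)).2 h3
        norm_cast
        omega
      have h6 : res M (β * χ) = β 1 • res M χ := by
        ext m
        simp only [res, Pi.mul_apply, Pi.smul_apply, smul_eq_mul]
        rw [hb.2 m m.2]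
      rw [h6, ip_smul_left] at h5
      exact right_ne_zero_of_mul h5
    obtain ⟨θ, hθ, h3, h4⟩ := hψM
    refine ⟨ψ, Finset.mem_filter.2 ⟨mem_NT.2 ⟨hψ, ?_⟩, ?_, ?_⟩, h2⟩
    · intro ht
      have h5 := Triv.constituent (M := (⊤ : Subgroup M)) ((irr_isChar hψ).res M) (fun m _ => ht m m.2) hθ h3
      apply hχ.2
      have h6 : θ = 1 := by
        by_contra hne
        have h7 := irr_ip_ne hθ irr_one hne
        rw [ip_one_right] at h7
        have h8 : avg θ = θ 1 := by
          have : θ = fun _ => θ 1 := by ext m; exact h5 m trivial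
          rw [this, avg_const]
        rw [h8, (irr_isChar hθ).one_eq] at h7
        exact (irr_pos hθ).ne' (by exact_mod_cast h7)
      by_contra hcon
      rw [h6] at h4
      exact h4 (irr_not_triv hχ.1 hcon)
    · have h5 := hlow ψ hψ
      have h6 : charDeg β ≤ ∑ β ∈ (TR M).filter (fun β => ip (res H ψ) (res H β) ≠ 0), charDeg β :=
        Finset.single_le_sum (f := fun β => charDeg β) (fun _ _ => Nat.zero_le _) (Finset.mem_filter.2 ⟨hβ, h2⟩)
      have := irr_pos hb.1
      omega
    · have h5 := q_const P hψ hχ.1 hθ h3 h4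
      have h6 := irr_pos hχ.1
      have h7 : p * mu (res P (res M ψ)) 1 * charDeg χ ≤ charDeg ψ * charDeg χ := by
        rw [mul_assoc, h5]
        nlinarith
      exact Nat.le_of_mul_le_mul_right h7 h6
  refine ⟨X, Finset.filter_subset _ _, fun ψ hψ => ?_, ?_⟩
  · have h := (Finset.mem_filter.1 hψ).2
    nlinarith
  · have e1 : ∑ β ∈ TR M, charDeg β ≤ ∑ ψ ∈ X, mu (res P (res M ψ)) 1 := by
      calc ∑ β ∈ TR M, charDeg β ≤ ∑ β ∈ TR M, ∑ ψ ∈ X, if ip (res H ψ) (res H β) ≠ 0 then charDeg β else 0 := by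
            refine Finset.sum_le_sum fun β hβ => ?_
            obtain ⟨ψ, hψ, h⟩ := hocc β hβ
            have h2 := Finset.single_le_sum (f := fun ψ => if ip (res H ψ) (res H β) ≠ 0 then charDeg β else 0) (fun _ _ => Nat.zero_le _) hψ
            simp only [if_pos h] at h2
            exact h2
        _ = ∑ ψ ∈ X, ∑ β ∈ TR M, if ip (res H ψ) (res H β) ≠ 0 then charDeg β else 0 := Finset.sum_comm
        _ ≤ _ := by
            refine Finset.sum_le_sum fun ψ hψ => ?_
            rw [← Finset.sum_filter]
            exact hlow ψ (mem_NT.1 (Finset.mem_filter.1 hψ).1).1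
    calc p * ∑ β ∈ TR M, charDeg β ≤ p * ∑ ψ ∈ X, mu (res P (res M ψ)) 1 := Nat.mul_le_mul_left _ e1
      _ = ∑ ψ ∈ X, p * mu (res P (res M ψ)) 1 := Finset.mul_sum _ _ _
      _ ≤ _ := Finset.sum_le_sum fun ψ hψ => (Finset.mem_filter.1 hψ).2.2

end
end ACD

namespace ACD
open Matrix
section
variable {G : Type} [Group G] [Finite G]

/-- permutation character -/
noncomputable def perm (G Ω : Type) [Group G] [MulAction G Ω] : G → ℂ :=
  fun g : G => (Nat.card {x : Ω // g • x = x} : ℂ)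

theorem perm_avg {Ω : Type} [Finite Ω] [MulAction G Ω] :
    avg (perm G Ω) = (Nat.card (MulAction.orbitRel.Quotient G Ω) : ℂ) := by
  classical
  have := Fintype.ofFinite G
  have := Fintype.ofFinite Ω
  have := Fintype.ofFinite (Quotient (MulAction.orbitRel G Ω))
  have h := MulAction.sum_card_fixedBy_eq_card_orbits_mul_card_group G Ω
  rw [avg_eq]
  have h0 : (Nat.card G : ℂ) ≠ 0 := by exact_mod_cast Nat.card_pos.ne'
  have h1 : ∑ g : G, perm G Ω g = (Nat.card (MulAction.orbitRel.Quotient G Ω) : ℂ) * Nat.card G := by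
    have h2 : (Nat.card (MulAction.orbitRel.Quotient G Ω)) = Fintype.card (Quotient (MulAction.orbitRel G Ω)) :=
      Nat.card_eq_fintype_card
    rw [h2, Nat.card_eq_fintype_card (α := G), ← Nat.cast_mul, ← h]
    push_cast
    refine Finset.sum_congr rfl fun g _ => ?_
    rw [← Nat.card_eq_fintype_card]
    rfl
  rw [h1, smul_eq_mul]
  field_simp

theorem recip {Ω : Type} [Finite Ω] [MulAction G Ω] [MulAction.IsPretransitive G Ω] {χ : G → ℂ} (hχ : IsChar χ)
    (hne : ip (perm G Ω) χ ≠ 0) (x0 : Ω) : ip (res (MulAction.stabilizer G x0) χ) 1 ≠ 0 := by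
  classical
  have := Fintype.ofFinite Ω
  have h1 : ip (perm G Ω) χ = ∑ x : Ω, avg (fun g : G => (MulAction.stabilizer G x : Set G).indicator 1 g * dual χ g) := by
    rw [← avg_finset_sum]
    rw [ip]
    congr 1; ext g
    rw [← Finset.sum_mul]
    congr 1
    simp only [perm]
    rw [Nat.card_eq_fintype_card, Fintype.card_subtype, Finset.card_filter]
    push_cast
    refine Finset.sum_congr rfl fun x _ => ?_
    by_cases h : g • x = x <;> simp [h]
  have h2 : ∀ x : Ω, avg (fun g : G => (MulAction.stabilizer G x : Set G).indicator 1 g * dual χ g)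
      = avg (fun g : G => (MulAction.stabilizer G x0 : Set G).indicator 1 g * dual χ g) := by
    intro x
    obtain ⟨k, rfl⟩ := MulAction.exists_smul_eq G x0 x
    rw [← avg_conj _ k]
    congr 1; ext g
    rw [hχ.dual.conj]
    congr 1
    have : (k * g * k⁻¹) ∈ MulAction.stabilizer G (k • x0) ↔ g ∈ MulAction.stabilizer G x0 := by
      simp [MulAction.mem_stabilizer_iff, mul_smul]
    by_cases h : g ∈ MulAction.stabilizer G x0
    · rw [Set.indicator_of_mem (this.2 h), Set.indicator_of_mem h]; rfl
    · rw [Set.indicator_of_notMem (fun h' => h (this.1 h')), Set.indicator_of_notMem h]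
  intro h0
  apply hne
  rw [h1]
  refine Finset.sum_eq_zero fun x _ => ?_
  rw [h2 x, avg_ind]
  rw [ip_one_right] at h0
  have h3 : avg (res (MulAction.stabilizer G x0) (dual χ)) = avg (res (MulAction.stabilizer G x0) χ) := by
    rw [← avg_inv]
    congr 1; ext g
    simp [res, dual]
  rw [h3, h0, mul_zero]

theorem orbit_bound {p : ℕ} [hp : Fact p.Prime] (hG : IsPGroup p G) {Ω : Type} [Finite Ω] [MulAction G Ω] (x0 : Ω)
    (hx0 : ∀ x : Ω, (∀ g : G, g • x = x) ↔ x = x0) :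
    p * Nat.card (MulAction.orbitRel.Quotient G Ω) + 1 ≤ Nat.card Ω + p := by
  classical
  have := Fintype.ofFinite (MulAction.orbitRel.Quotient G Ω)
  have hc : Nat.card Ω = ∑ ω : MulAction.orbitRel.Quotient G Ω, Nat.card (MulAction.orbit G (Quotient.out ω)) := by
    rw [Nat.card_congr (MulAction.selfEquivSigmaOrbits G Ω), Nat.card_sigma]
  let ω0 : MulAction.orbitRel.Quotient G Ω := Quotient.mk'' x0
  have hb : ∀ ω, ω ≠ ω0 → p ≤ Nat.card (MulAction.orbit G (Quotient.out ω)) := by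
    intro ω hω
    obtain ⟨n, hn⟩ := hG.card_orbit (Quotient.out ω)
    rw [hn]
    rcases Nat.eq_zero_or_pos n with rfl | h
    · exfalso; apply hω
      rw [pow_zero] at hn
      have hs : Subsingleton (MulAction.orbit G (Quotient.out ω)) := (Nat.card_eq_one_iff_unique.1 hn).1
      have : Quotient.out ω = x0 := by
        rw [← hx0]
        intro g
        exact congrArg Subtype.val (hs.elim ⟨g • Quotient.out ω, MulAction.mem_orbit _ g⟩ ⟨Quotient.out ω, MulAction.mem_orbit_self _⟩)
      rw [← Quotient.out_eq ω, this]
    · exact Nat.le_self_pow h.ne' p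
  have h1 : Nat.card (MulAction.orbitRel.Quotient G Ω) = (Finset.univ.erase ω0).card + 1 := by
    rw [Finset.card_erase_add_one (Finset.mem_univ _), Nat.card_eq_fintype_card]; rfl
  rw [hc, h1, ← Finset.sum_erase_add _ _ (Finset.mem_univ ω0)]
  have h2 : (Finset.univ.erase ω0).card * p ≤ ∑ ω ∈ Finset.univ.erase ω0, Nat.card (MulAction.orbit G (Quotient.out ω)) := by
    rw [← smul_eq_mul]
    exact Finset.card_nsmul_le_sum _ _ _ fun ω hω => hb ω (Finset.ne_of_mem_erase hω)
  have h3 : 0 < Nat.card (MulAction.orbit G (Quotient.out ω0)) :=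
    Nat.card_pos_iff.2 ⟨⟨⟨_, MulAction.mem_orbit_self _⟩⟩, inferInstance⟩
  nlinarith

/-- counting lemma -/
theorem fixed_sum {A : G → ℂ} (hA : IsChar A) {K : Type} [Group K] [Finite K] (f : K →* G) :
    mu (fun k => A (f k)) 1 = ∑ ψ ∈ Irr G, mu A ψ * mu (fun k => ψ (f k)) 1 := by
  have h1 : (mu (fun k => A (f k)) 1 : ℂ) = ∑ ψ ∈ Irr G, (mu A ψ * mu (fun k => ψ (f k)) 1 : ℂ) := by
    rw [← (hA.comp f).ip_eq isChar_one]
    have h2 : (fun k => A (f k)) = ∑ ψ ∈ Irr G, ip A ψ • (fun k => ψ (f k)) := by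
      ext k
      have := congrFun hA.eq_sum (f k)
      rw [Finset.sum_apply] at this ⊢
      exact this
    rw [h2, ip_sum_left]
    refine Finset.sum_congr rfl fun η hη => ?_
    rw [mem_Irr] at hη
    rw [ip_smul_left, hA.ip_eq' hη, ((irr_isChar hη).comp f).ip_eq isChar_one]
  exact_mod_cast h1

theorem exists_good {M : Subgroup G} [M.Normal] (P : Subgroup M) {Ω : Type} [Finite Ω] [MulAction G Ω] [MulAction.IsPretransitive G Ω]
    {p : ℕ} (hM : avg (res M (perm G Ω)) = 1) (h1 : 1 < Nat.card Ω) {r : ℕ}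
    (hP : avg (res P (res M (perm G Ω))) = r) (hr : p * r + 1 ≤ Nat.card Ω + p) :
    ∃ χ ∈ NT M, ip (perm G Ω) χ ≠ 0 ∧ p * mu (res P (res M χ)) 1 ≤ charDeg χ := by
  classical
  have hπ : IsChar (perm G Ω) := isChar_perm
  have hπd : charDeg (perm G Ω) = Nat.card Ω := by
    have := hπ.one_eq
    simp only [perm, one_smul] at this
    have e : Nat.card {x : Ω // True} = Nat.card Ω := Nat.card_congr (Equiv.subtypeUnivEquiv fun _ => trivial)
    rw [e] at this
    exact_mod_cast this.symm
  have hone : mu (perm G Ω) 1 = 1 := by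
    have : (mu (perm G Ω) 1 : ℂ) = 1 := by
      rw [← hπ.ip_eq isChar_one, ip_one_right, perm_avg]
      have hs := (MulAction.pretransitive_iff_subsingleton_quotient G Ω).1 inferInstance
      have hne : Nonempty Ω := by
        by_contra hcon
        rw [not_nonempty_iff] at hcon
        simp at h1
      have : Nat.card (MulAction.orbitRel.Quotient G Ω) = 1 :=
        Nat.card_eq_one_iff_unique.2 ⟨hs, ⟨Quotient.mk'' hne.some⟩⟩
      rw [this]; norm_num
    exact_mod_cast this
  have hm1 : mu (res M (perm G Ω)) 1 = 1 := by
    have : (mu (res M (perm G Ω)) 1 : ℂ) = 1 := by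
      rw [← (hπ.res M).ip_eq isChar_one, ip_one_right, hM]
    exact_mod_cast this
  have hPr : mu (res P (res M (perm G Ω))) 1 = r := by
    have : (mu (res P (res M (perm G Ω))) 1 : ℂ) = r := by
      rw [← ((hπ.res M).res P).ip_eq isChar_one, ip_one_right, hP]
    exact_mod_cast this
  have h1T : (1 : G → ℂ) ∈ TR M := mem_TR.2 ⟨irr_one, fun _ _ => rfl⟩
  have hT : ∀ F : (G → ℂ) → ℕ, ∑ ψ ∈ TR M, mu (perm G Ω) ψ * F ψ = F 1 := by
    have e := hπ.mu_res_one M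
    rw [hm1] at e
    have e' : 1 = ∑ ψ ∈ TR M, mu (perm G Ω) ψ * charDeg ψ := by rw [e]; unfold TR; congr
    intro F
    rw [← Finset.add_sum_erase _ _ h1T] at e' ⊢
    rw [hone] at e' ⊢
    rw [charDeg_one] at e'
    have e2 : ∑ ψ ∈ (TR M).erase 1, mu (perm G Ω) ψ * charDeg ψ = 0 := by omega
    rw [Finset.sum_eq_zero_iff] at e2
    rw [Finset.sum_eq_zero fun ψ hψ => ?_]
    · ring
    · have := e2 ψ hψ
      have h3 := irr_pos (mem_TR.1 (Finset.mem_of_mem_erase hψ)).1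
      rcases Nat.mul_eq_zero.1 this with h | h
      · rw [h, zero_mul]
      · omega
  have hsplit : ∀ F : (G → ℂ) → ℕ, ∑ ψ ∈ Irr G, mu (perm G Ω) ψ * F ψ = F 1 + ∑ ψ ∈ NT M, mu (perm G Ω) ψ * F ψ := by
    intro F
    have := sum_split M (fun ψ => ((mu (perm G Ω) ψ * F ψ : ℕ) : ℤ))
    rw [← hT F]
    exact_mod_cast this
  have s1 := hπ.deg_eq_sum
  rw [hsplit, hπd, charDeg_one] at s1
  have s2 : r = _ := hPr.symm.trans (fixed_sum hπ (M.subtype.comp P.subtype))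
  rw [hsplit] at s2
  have s3 : mu (fun k : P => (1 : G → ℂ) ((M.subtype.comp P.subtype) k)) 1 = 1 := by
    have : (mu (fun k : P => (1 : G → ℂ) ((M.subtype.comp P.subtype) k)) 1 : ℂ) = 1 := by
      rw [← (isChar_one.comp (M.subtype.comp P.subtype)).ip_eq isChar_one, ip_one_right]
      exact avg_const _
    exact_mod_cast this
  rw [s3] at s2
  by_contra hcon
  push Not at hcon
  have h4 : ∀ ψ ∈ NT M, mu (perm G Ω) ψ * charDeg ψ ≤ p * (mu (perm G Ω) ψ * mu (fun k : P => ψ ((M.subtype.comp P.subtype) k)) 1) := by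
    intro ψ hψ
    by_cases h : mu (perm G Ω) ψ = 0
    · simp [h]
    · have := hcon ψ hψ ((mu_ne_zero hπ (irr_isChar (mem_NT.1 hψ).1)).1 h)
      have e : mu (fun k : P => ψ ((M.subtype.comp P.subtype) k)) 1 = mu (res P (res M ψ)) 1 := rfl
      rw [e]
      nlinarith
  have h5 : ∃ ψ ∈ NT M, mu (perm G Ω) ψ * charDeg ψ < p * (mu (perm G Ω) ψ * mu (fun k : P => ψ ((M.subtype.comp P.subtype) k)) 1) := by
    have : ∑ ψ ∈ NT M, mu (perm G Ω) ψ * charDeg ψ ≠ 0 := by omega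
    obtain ⟨ψ, hψ, h⟩ := Finset.exists_ne_zero_of_sum_ne_zero this
    refine ⟨ψ, hψ, ?_⟩
    have h0 : mu (perm G Ω) ψ ≠ 0 := left_ne_zero_of_mul h
    have := hcon ψ hψ ((mu_ne_zero hπ (irr_isChar (mem_NT.1 hψ).1)).1 h0)
    have e : mu (fun k : P => ψ ((M.subtype.comp P.subtype) k)) 1 = mu (res P (res M ψ)) 1 := rfl
    rw [e]
    have h0 := Nat.pos_of_ne_zero h0
    nlinarith
  have h6 := Finset.sum_lt_sum h4 h5
  rw [← Finset.mul_sum] at h6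
  rw [s2] at hr
  rw [mul_add] at hr
  omega

theorem fam_S2 {M : Subgroup G} [M.Normal] (hmin : MinN M) (hM : commutator M = ⊤) :
    ∃ X : Finset (G → ℂ), X ⊆ NT M ∧ (∀ ψ ∈ X, 5 ≤ charDeg ψ) ∧
      5 * ∑ β ∈ TR M, charDeg β ≤ ∑ ψ ∈ X, charDeg ψ := by
  have hns : ¬ Group.IsSolvable M := by
    intro hs
    apply hmin.1
    rw [eq_bot_iff]
    intro x hx
    have := perfect_solv hM hs (MonoidHom.id M) ⟨x, hx⟩
    simpa using this
  obtain ⟨p, hp, hp5, hpd⟩ := exists_prime_ge_five hns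
  have hpf : Fact p.Prime := ⟨hp⟩
  let P : Sylow p M := default
  have hT0 : ∀ x y : Sylow p M, ∃ m : M, MulAut.conj m • x = y := fun x y => MulAction.exists_smul_eq M x y
  have hF0 : ∀ x : Sylow p M, (∀ g : (P : Subgroup M), MulAut.conj (g : M) • x = x) ↔ x = P := by
    intro x
    have h := P.isPGroup'.sylow_mem_fixedPoints_iff (Q := x)
    rw [MulAction.mem_fixedPoints] at h
    refine Iff.trans h ?_
    exact ⟨fun h => Sylow.ext (P.is_maximal' x.isPGroup' h), fun h => by rw [h]⟩
  let Ω := Sylow p M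
  let act : MulAction G Ω := MulAction.compHom Ω (MulAut.conjNormal : G →* MulAut M)
  have hact : ∀ (m : M) (x : Ω), (m : G) • x = MulAut.conj m • x := by
    intro m x
    change (MulAut.conjNormal (m : G) : MulAut M) • x = MulAut.conj m • x
    rw [MulAut.conjNormal_val]
  have htrM : MulAction.IsPretransitive M Ω := ⟨fun x y => by
    obtain ⟨m, hm⟩ := hT0 x y
    exact ⟨m, (hact m x).trans hm⟩⟩
  have htr : MulAction.IsPretransitive G Ω := ⟨fun x y => by
    obtain ⟨m, hm⟩ := hT0 x y
    exact ⟨m, by rw [hact, hm]⟩⟩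
  have hresM : res M (perm G Ω) = perm M Ω := rfl
  have hresP : res (P : Subgroup M) (perm M Ω) = perm (P : Subgroup M) Ω := rfl
  have hfix : ∀ x : Ω, (∀ g : (P : Subgroup M), g • x = x) ↔ x = P := by
    intro x
    rw [← hF0 x]
    exact forall_congr' fun g => by rw [← hact]; rfl
  have hbound := orbit_bound P.isPGroup' P hfix
  have hcard : 1 < Nat.card Ω := by
    by_contra hle
    have hpos : 0 < Nat.card Ω := Nat.card_pos_iff.2 ⟨⟨P⟩, inferInstance⟩
    have h1 : Nat.card Ω = 1 := by omega
    have hs : Subsingleton (Sylow p M) := (Nat.card_eq_one_iff_unique.1 h1).1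
    have hn : (P : Subgroup M).Normal := Sylow.normal_of_subsingleton P
    have hch : (P : Subgroup M).Characteristic := Sylow.characteristic_of_normal P hn
    have hnn : ((P : Subgroup M).map M.subtype).Normal := inferInstance
    rcases hmin.2 _ hnn (Subgroup.map_subtype_le _) with h | h
    · rw [Subgroup.map_eq_bot_iff_of_injective _ M.subtype_injective] at h
      exact P.ne_bot_of_dvd_card hpd h
    · apply hns
      have htop : (P : Subgroup M) = ⊤ := by
        rw [eq_top_iff]
        intro x _
        have : (x : G) ∈ (P : Subgroup M).map M.subtype := by rw [h]; exact x.2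
        obtain ⟨y, hy, he⟩ := this
        have : y = x := Subtype.ext he
        exact this ▸ hy
      have hpg : IsPGroup p M := by
        intro x
        have hx : x ∈ (P : Subgroup M) := htop ▸ Subgroup.mem_top x
        obtain ⟨k, hk⟩ := P.isPGroup' ⟨x, hx⟩
        exact ⟨k, by simpa using congrArg Subtype.val hk⟩
      obtain ⟨k, hk⟩ := hpg.exists_card_eq
      exact burnside_pq hp Nat.prime_two _ _ rfl ⟨k, 0, by simpa using hk⟩
  have hM1 : avg (res M (perm G Ω)) = 1 := by
    rw [hresM, perm_avg]
    have hs := (MulAction.pretransitive_iff_subsingleton_quotient M Ω).1 htrM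
    have : Nat.card (MulAction.orbitRel.Quotient M Ω) = 1 :=
      Nat.card_eq_one_iff_unique.2 ⟨hs, ⟨Quotient.mk'' P⟩⟩
    rw [this]; norm_num
  have hPr : avg (res (P : Subgroup M) (res M (perm G Ω))) = (Nat.card (MulAction.orbitRel.Quotient (P : Subgroup M) Ω) : ℂ) := by
    rw [hresM, hresP, perm_avg]
  obtain ⟨χ, hχ, hne, hle⟩ := exists_good (P : Subgroup M) hM1 hcard hPr hbound
  have hH := recip (irr_isChar (mem_NT.1 hχ).1) hne P
  have hA : ∀ g : G, ∃ h ∈ MulAction.stabilizer G (P : Ω), ∃ m ∈ M, g = h * m := by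
    intro g
    obtain ⟨m, hm⟩ := hT0 P (g⁻¹ • P : Ω)
    refine ⟨g * m, ?_, (m : G)⁻¹, M.inv_mem m.2, by group⟩
    rw [MulAction.mem_stabilizer_iff, mul_smul, hact, hm, smul_inv_smul]
  have hB : ∀ x ∈ (P : Subgroup M), (x : G) ∈ MulAction.stabilizer G (P : Ω) := by
    intro x hx
    rw [MulAction.mem_stabilizer_iff]
    exact (hfix P).2 rfl ⟨x, hx⟩
  obtain ⟨X, hX1, hX2, hX3⟩ := fam_S1 (M := M) hA (P : Subgroup M) hB hχ hH hle
  refine ⟨X, hX1, fun ψ hψ => hp5.trans (hX2 ψ hψ), le_trans ?_ hX3⟩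
  exact Nat.mul_le_mul_right _ hp5

end
end ACD

namespace ACD
open Matrix
section
variable {G : Type} [Group G] [Finite G]

/-- the Gallagher family of a character -/
noncomputable def fam (M : Subgroup G) (χ : G → ℂ) : Finset (G → ℂ) := by
  classical exact (TR M).image (fun β => β * χ)

theorem mem_fam {M : Subgroup G} {χ ψ : G → ℂ} : ψ ∈ fam M χ ↔ ∃ β ∈ TR M, β * χ = ψ := by
  classical
  simp [fam]

theorem fam_sub {M : Subgroup G} [M.Normal] {χ : G → ℂ} (hχ : χ ∈ NT M) (hr : res M χ ∈ IrrChar M) :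
    fam M χ ⊆ NT M := by
  intro ψ hψ
  obtain ⟨β, hβ, rfl⟩ := mem_fam.1 hψ
  rw [mem_TR] at hβ
  rw [mem_NT] at hχ ⊢
  exact ⟨gallagher_irr (irr_isChar hχ.1) hr hβ.1 hβ.2, gallagher_not_triv (irr_isChar hχ.1) hr hχ.2 hβ.1 hβ.2⟩

theorem fam_sum {M : Subgroup G} [M.Normal] {χ : G → ℂ} (hχ : IsChar χ) (hr : res M χ ∈ IrrChar M) (F : ℕ → ℤ) :
    ∑ ψ ∈ fam M χ, F (charDeg ψ) = ∑ β ∈ TR M, F (charDeg β * charDeg χ) := by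
  classical
  rw [fam, Finset.sum_image]
  · refine Finset.sum_congr rfl fun β hβ => ?_
    rw [(irr_isChar (mem_TR.1 hβ).1).charDeg_mul hχ]
  · intro a ha b hb h
    rw [Finset.mem_coe, mem_TR] at ha hb
    exact gallagher_inj hχ hr ha.1 ha.2 hb.1 hb.2 h

theorem fam_deg {M : Subgroup G} [M.Normal] {χ ψ : G → ℂ} (hχ : IsChar χ) (h : ψ ∈ fam M χ) : charDeg χ ∣ charDeg ψ := by
  obtain ⟨β, hβ, rfl⟩ := mem_fam.1 h
  rw [(irr_isChar (mem_TR.1 hβ).1).charDeg_mul hχ]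
  exact Dvd.intro_left _ rfl

theorem lin_TR {M : Subgroup G} (hM : commutator M = ⊤) {l : G → ℂ} (h : l ∈ Lin G) : l ∈ TR M :=
  mem_TR.2 ⟨(mem_Lin.1 h).1, lin_triv hM h⟩

theorem lin_bound {M : Subgroup G} (hM : commutator M = ⊤) (F : ℕ → ℤ) (hF : ∀ d, 2 ≤ d → 0 ≤ F d) :
    F 1 * (Lin G).card ≤ ∑ β ∈ TR M, F (charDeg β) := by
  classical
  have h1 : Lin G ⊆ TR M := fun l hl => lin_TR hM hl
  rw [← Finset.sum_sdiff h1]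
  have h2 : ∑ l ∈ Lin G, F (charDeg l) = F 1 * (Lin G).card := by
    rw [Finset.sum_congr rfl fun l hl => by rw [(mem_Lin.1 hl).2], Finset.sum_const, nsmul_eq_mul, mul_comm]
  have h3 : 0 ≤ ∑ l ∈ TR M \ Lin G, F (charDeg l) := by
    refine Finset.sum_nonneg fun l hl => hF _ ?_
    rw [Finset.mem_sdiff] at hl
    have h4 := mem_TR.1 hl.1
    have h5 := irr_pos h4.1
    have : charDeg l ≠ 1 := fun h => hl.2 (mem_Lin.2 ⟨h4.1, h⟩)
    omega
  linarith

theorem nt_ge {M : Subgroup G} [M.Normal] (hM : commutator M = ⊤) (h2 : ∀ θ ∈ IrrChar M, charDeg θ ≠ 2)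
    {χ : G → ℂ} (hχ : χ ∈ NT M) : 3 ≤ charDeg χ := by
  rw [mem_NT] at hχ
  have h1 := irr_pos hχ.1
  have h3 : charDeg χ ≠ 1 := fun h => hχ.2 (linear_triv hM (irr_isChar hχ.1) h)
  have h4 : charDeg χ ≠ 2 := by
    intro h
    have := res_irr_of_prime hM hχ.1 hχ.2 (by rw [h]; norm_num)
    exact h2 _ this (by rw [charDeg_res, h])
  omega

theorem nt_res {M : Subgroup G} [M.Normal] (hM : commutator M = ⊤) (h2 : ∀ θ ∈ IrrChar M, charDeg θ ≠ 2)
    {χ : G → ℂ} (hχ : χ ∈ NT M) (hd : charDeg χ ≤ 5) : res M χ ∈ IrrChar M := by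
  have h3 := nt_ge hM h2 hχ
  rw [mem_NT] at hχ
  refine res_irr_of_deg hM hχ.1 hχ.2 fun θ hθ hdv => ?_
  have := h2 θ hθ
  have h5 := irr_pos hθ
  have h6 := Nat.le_of_dvd (by omega) hdv
  interval_cases h7 : charDeg χ <;> interval_cases h8 : charDeg θ <;> omega

theorem lin_mul_NT {M : Subgroup G} [M.Normal] (hM : commutator M = ⊤) {l ψ : G → ℂ} (hl : l ∈ Lin G) (hψ : ψ ∈ NT M) :
    l * ψ ∈ NT M ∧ charDeg (l * ψ) = charDeg ψ := by
  have hl' := mem_Lin.1 hl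
  have ht := lin_triv hM hl
  rw [mem_NT] at hψ ⊢
  have hd := linear_mul_dual (irr_isChar hl'.1) hl'.2
  refine ⟨⟨linear_mul_irr (irr_isChar hl'.1) hl'.2 hψ.1, fun h => hψ.2 ?_⟩, ?_⟩
  · have e : ψ = dual l * (l * ψ) := by rw [← mul_assoc, mul_comm (dual l), hd, one_mul]
    rw [e]
    exact ht.dual.mul h
  · rw [(irr_isChar hl'.1).charDeg_mul (irr_isChar hψ.1), hl'.2, one_mul]

theorem lin_mul_fam {M : Subgroup G} [M.Normal] (hM : commutator M = ⊤) {l ψ D : G → ℂ} (hl : l ∈ Lin G)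
    (hψ : l * ψ ∈ fam M D) : ψ ∈ fam M D := by
  have hl' := mem_Lin.1 hl
  have ht := lin_triv hM hl
  have hd := linear_mul_dual (irr_isChar hl'.1) hl'.2
  obtain ⟨β, hβ, e⟩ := mem_fam.1 hψ
  rw [mem_TR] at hβ
  refine mem_fam.2 ⟨dual l * β, mem_TR.2 ⟨linear_mul_irr (irr_isChar hl'.1).dual (by rw [charDeg_dual, hl'.2]) hβ.1, ht.dual.mul hβ.2⟩, ?_⟩
  rw [mul_assoc, e, ← mul_assoc, mul_comm (dual l), hd, one_mul]

theorem lin_orbit {M : Subgroup G} [M.Normal] (hM : commutator M = ⊤) {ψ : G → ℂ} (hψ : IsChar ψ)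
    (hr : res M ψ ∈ IrrChar M) (Q : Finset (G → ℂ)) (h : ∀ l ∈ Lin G, l * ψ ∈ Q) : (Lin G).card ≤ Q.card := by
  classical
  refine Finset.card_le_card_of_injOn (fun l => l * ψ) (fun l hl => h l hl) ?_
  intro a ha b hb e
  have ha' := mem_TR.1 (lin_TR hM ha)
  have hb' := mem_TR.1 (lin_TR hM hb)
  exact gallagher_inj hψ hr ha'.1 ha'.2 hb'.1 hb'.2 e

theorem Q_lemma {M : Subgroup G} [M.Normal] (hM : commutator M = ⊤) (h2 : ∀ θ ∈ IrrChar M, charDeg θ ≠ 2)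
    {C D : G → ℂ} (hD : D ∈ NT M) (hD5 : charDeg D = 5) (hC : IsChar C)
    (hex : ∃ ψ ∈ NT M, ψ ∉ fam M D ∧ 4 ≤ charDeg ψ ∧ ip (D * C) ψ ≠ 0) :
    ∃ Q : Finset (G → ℂ), Q ⊆ NT M ∧ Disjoint Q (fam M D) ∧ (∀ ψ ∈ Q, 4 ≤ charDeg ψ) ∧
      (4 * ((Lin G).card : ℤ) ≤ ∑ ψ ∈ Q, (5 * (charDeg ψ : ℤ) - 16) ∨
        35 * ((Lin G).card : ℤ) ≤ 3 * charDeg C * ∑ ψ ∈ Q, (5 * (charDeg ψ : ℤ) - 16)) := by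
  classical
  have hrD := nt_res hM h2 hD (by omega)
  let Q := (NT M).filter (fun ψ => ψ ∉ fam M D ∧ 4 ≤ charDeg ψ ∧ ∃ l ∈ Lin G, ip (l * (D * C)) ψ ≠ 0)
  have hlin : ∀ l ∈ Lin G, ∀ A ψ : G → ℂ, ip (l * A) (l * ψ) = ip A ψ := by
    intro l hl A ψ
    have hl' := mem_Lin.1 hl
    have hd := linear_mul_dual (irr_isChar hl'.1) hl'.2
    rw [mul_comm l A, ip_mul_left, ← mul_assoc, mul_comm (dual l), hd, one_mul]
  have hQ4 : ∀ ψ ∈ Q, 4 ≤ charDeg ψ := fun ψ hψ => (Finset.mem_filter.1 hψ).2.2.1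
  have hex' : ∀ l ∈ Lin G, ∃ ψ ∈ Q, ip (l * (D * C)) ψ ≠ 0 := by
    intro l hl
    obtain ⟨ψ, hψ, hf, h4, hne⟩ := hex
    obtain ⟨e1, e2⟩ := lin_mul_NT hM hl hψ
    refine ⟨l * ψ, Finset.mem_filter.2 ⟨e1, fun h => hf (lin_mul_fam hM hl h), by omega, l, hl, ?_⟩, ?_⟩
    · rw [hlin l hl]; exact hne
    · rw [hlin l hl]; exact hne
  refine ⟨Q, Finset.filter_subset _ _, ?_, hQ4, ?_⟩
  · rw [Finset.disjoint_left]
    intro ψ hψ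
    exact (Finset.mem_filter.1 hψ).2.1
  by_cases hsm : ∃ ψ ∈ Q, charDeg ψ ≤ 5
  · left
    obtain ⟨ψ, hψ, hd⟩ := hsm
    have hψ' := Finset.mem_filter.1 hψ
    have hrψ := nt_res hM h2 hψ'.1 hd
    have hcard : (Lin G).card ≤ Q.card := by
      refine lin_orbit hM (irr_isChar (mem_NT.1 hψ'.1).1) hrψ Q fun l hl => ?_
      obtain ⟨e1, e2⟩ := lin_mul_NT hM hl hψ'.1
      obtain ⟨-, hf, h4, l', hl', hne⟩ := hψ'
      refine Finset.mem_filter.2 ⟨e1, fun h => hf (lin_mul_fam hM hl h), by omega, l * l', ?_, ?_⟩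
      · have h1 := mem_Lin.1 hl
        have h3 := mem_Lin.1 hl'
        refine mem_Lin.2 ⟨linear_mul_irr (irr_isChar h1.1) h1.2 h3.1, ?_⟩
        rw [(irr_isChar h1.1).charDeg_mul (irr_isChar h3.1), h1.2, h3.2]
      · rw [mul_assoc, hlin l hl]; exact hne
    have h5 : ∑ ψ ∈ Q, (4 : ℤ) ≤ ∑ ψ ∈ Q, (5 * (charDeg ψ : ℤ) - 16) :=
      Finset.sum_le_sum fun ψ hψ => by have := hQ4 ψ hψ; omega
    rw [Finset.sum_const, nsmul_eq_mul] at h5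
    have : ((Lin G).card : ℤ) ≤ Q.card := by exact_mod_cast hcard
    linarith
  · right
    push Not at hsm
    have hfc := fiber_count ((Lin G).image (fun l => l * D)) Q (B := dual C) (c := 5) ?_ ?_ hC.dual ?_ ?_
    · rw [charDeg_dual, Finset.card_image_of_injOn] at hfc
      · have h5 : 7 * ∑ ψ ∈ Q, (charDeg ψ : ℤ) ≤ 3 * ∑ ψ ∈ Q, (5 * (charDeg ψ : ℤ) - 16) := by
          rw [Finset.mul_sum, Finset.mul_sum]
          exact Finset.sum_le_sum fun ψ hψ => by have := hsm ψ hψ; omega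
        have h6 : (5 * (Lin G).card : ℤ) ≤ charDeg C * ∑ ψ ∈ Q, (charDeg ψ : ℤ) := by exact_mod_cast hfc
        have h7 : (0 : ℤ) ≤ charDeg C := by positivity
        nlinarith
      · intro a ha b hb e
        have ha' := mem_TR.1 (lin_TR hM ha)
        have hb' := mem_TR.1 (lin_TR hM hb)
        exact gallagher_inj (irr_isChar (mem_NT.1 hD).1) hrD ha'.1 ha'.2 hb'.1 hb'.2 e
    · intro χ hχ
      obtain ⟨l, hl, rfl⟩ := Finset.mem_image.1 hχ
      exact (mem_NT.1 (lin_mul_NT hM hl hD).1).1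
    · exact fun ψ hψ => irr_isChar (mem_NT.1 (Finset.mem_filter.1 hψ).1).1
    · intro χ hχ
      obtain ⟨l, hl, rfl⟩ := Finset.mem_image.1 hχ
      obtain ⟨ψ, hψ, hne⟩ := hex' l hl
      refine ⟨ψ, hψ, ?_⟩
      rw [← mul_assoc, ip_mul_left, ip_comm] at hne
      rw [mul_comm]
      exact hne
    · intro χ hχ
      obtain ⟨l, hl, rfl⟩ := Finset.mem_image.1 hχ
      rw [(lin_mul_NT hM hl hD).2, hD5]

theorem case_A {M : Subgroup G} [M.Normal] (hmin : MinN M) (hM : commutator M = ⊤)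
    (h2 : ∀ θ ∈ IrrChar M, charDeg θ ≠ 2) (h3 : ∀ χ ∈ NT M, charDeg χ ≠ 3) :
    0 ≤ ∑ χ ∈ Irr G, (5 * (charDeg χ : ℤ) - 16) := by
  classical
  have h4 : ∀ χ ∈ NT M, 4 ≤ charDeg χ := by
    intro χ hχ
    have := nt_ge hM h2 hχ
    have := h3 χ hχ
    omega
  have hpos : ∀ χ ∈ NT M, 0 ≤ 5 * (charDeg χ : ℤ) - 16 := by
    intro χ hχ
    have := h4 χ hχ
    omega
  rw [sum_split M]
  by_cases h5 : ∃ χ ∈ NT M, charDeg χ = 5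
  · obtain ⟨D, hD, hD5⟩ := h5
    have hDi := (mem_NT.1 hD).1
    have hrD := nt_res hM h2 hD (by omega)
    obtain ⟨Q, hQ, hdis, hQ4, hQf⟩ := Q_lemma hM h2 hD hD5 (irr_isChar hDi).dual (by
      by_contra hcon
      push Not at hcon
      have hadj := isChar_adj hDi
      have h6 := adj_deg hDi
      rw [hD5] at h6
      have h7 : 5 ∣ charDeg (D * dual D - 1) := by
        refine hadj.deg_dvd 5 fun ψ hψ hne => ?_
        have hψ1 : ψ ≠ 1 := not_one_of_ip (adj_ip_one hDi) hne
        have hne' : ip (D * dual D) ψ ≠ 0 := by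
          rw [ip_sub_left, irr_ip_ne irr_one hψ (Ne.symm hψ1), sub_zero] at hne
          exact hne
        have hψN : ψ ∈ NT M := mem_NT.2 ⟨hψ, fun ht => hne' (mu_triv_self (irr_isChar hDi) hrD hψ ht hψ1)⟩
        have hf : ψ ∈ fam M D := by
          by_contra hf
          exact hne' (hcon ψ hψN hf (h4 ψ hψN))
        have := fam_deg (irr_isChar hDi) hf
        rwa [hD5] at this
      omega)
    have e1 : ∑ χ ∈ fam M D, (5 * (charDeg χ : ℤ) - 16) + ∑ χ ∈ Q, (5 * (charDeg χ : ℤ) - 16)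
        ≤ ∑ χ ∈ NT M, (5 * (charDeg χ : ℤ) - 16) := by
      rw [← Finset.sum_union hdis.symm]
      exact Finset.sum_le_sum_of_subset_of_nonneg (Finset.union_subset (fam_sub hD hrD) hQ) fun χ hχ _ => hpos χ hχ
    rw [fam_sum (irr_isChar hDi) hrD (fun d => 5 * (d : ℤ) - 16), hD5] at e1
    have e2 := lin_bound hM (fun d => (5 * (d : ℤ) - 16) + (5 * ((d * 5 : ℕ) : ℤ) - 16)) (fun d hd => by push_cast; omega)
    rw [Finset.sum_add_distrib] at e2
    rw [charDeg_dual, hD5] at hQf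
    push_cast at e1 e2 hQf
    rcases hQf with h | h <;> linarith [(Nat.cast_nonneg (Lin G).card : (0:ℤ) ≤ _)]
  · push Not at h5
    obtain ⟨X, hX, hX5, hXs⟩ := fam_S2 hmin hM
    have e1 : ∑ χ ∈ X, (5 * (charDeg χ : ℤ) - 16) ≤ ∑ χ ∈ NT M, (5 * (charDeg χ : ℤ) - 16) :=
      Finset.sum_le_sum_of_subset_of_nonneg hX fun χ hχ _ => hpos χ hχ
    have e2 : 7 * ∑ χ ∈ X, (charDeg χ : ℤ) ≤ 3 * ∑ χ ∈ X, (5 * (charDeg χ : ℤ) - 16) := by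
      rw [Finset.mul_sum, Finset.mul_sum]
      refine Finset.sum_le_sum fun χ hχ => ?_
      have := hX5 χ hχ
      have := h5 χ (hX hχ)
      omega
    have e3 : 5 * ∑ β ∈ TR M, (charDeg β : ℤ) ≤ ∑ χ ∈ X, (charDeg χ : ℤ) := by exact_mod_cast hXs
    have e4 : 0 ≤ ∑ β ∈ TR M, (16 * (charDeg β : ℤ) - 16) :=
      Finset.sum_nonneg fun β hβ => by have := irr_pos (mem_TR.1 hβ).1; omega
    have e5 : ∑ β ∈ TR M, (16 * (charDeg β : ℤ) - 16) = ∑ β ∈ TR M, (5 * (charDeg β : ℤ) - 16) + 11 * ∑ β ∈ TR M, (charDeg β : ℤ) := by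
      rw [Finset.mul_sum, ← Finset.sum_add_distrib]
      exact Finset.sum_congr rfl fun β _ => by ring
    have e6 : 0 ≤ ∑ β ∈ TR M, (charDeg β : ℤ) := Finset.sum_nonneg fun β _ => by positivity
    linarith

end
end ACD

namespace ACD
open Matrix
section
variable {G : Type} [Group G] [Finite G]

theorem cons_ge (hG : commutator G = ⊤) (h2 : ∀ θ ∈ IrrChar G, charDeg θ ≠ 2) {A a : G → ℂ}
    (h1 : ip A 1 = 0) (ha : a ∈ IrrChar G) (hne : ip A a ≠ 0) : 3 ≤ charDeg a := by
  have := perfect_deg hG ha (not_one_of_ip h1 hne)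
  have := h2 a ha
  omega

theorem dec_nine (hG : commutator G = ⊤) (h2 : ∀ θ ∈ IrrChar G, charDeg θ ≠ 2) {t : G}
    (ht : ∀ φ ∈ IrrChar G, charDeg φ = 3 → φ t = -1) {A : G → ℂ} (hA : IsChar A) (hd : charDeg A = 9)
    (h1 : ip A 1 = 0) (hAt : A t ≠ -3) :
    A ∈ IrrChar G ∨ (∃ σ ∈ IrrChar G, ∃ η ∈ IrrChar G, charDeg σ = 6 ∧ charDeg η = 3 ∧ A = σ + η) ∨
      ∃ φ ∈ IrrChar G, ∃ ε ∈ IrrChar G, charDeg φ = 5 ∧ charDeg ε = 4 ∧ A = φ + ε := by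
  have hge : ∀ a ∈ IrrChar G, ip A a ≠ 0 → 3 ≤ charDeg a := fun a ha hne => cons_ge hG h2 h1 ha hne
  by_cases h3 : ∃ a ∈ IrrChar G, ip A a ≠ 0 ∧ charDeg a = 3
  · obtain ⟨a, ha, hne, hda⟩ := h3
    have hB := hA.peel ha hne
    have dB := (irr_isChar ha).charDeg_sub hB
    have hgeB : ∀ b ∈ IrrChar G, ip (A - a) b ≠ 0 → 3 ≤ charDeg b := fun b hb h =>
      hge b hb (sub_constituent hB (irr_isChar ha) hb h)
    by_cases h6 : A - a ∈ IrrChar G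
    · right; left
      exact ⟨A - a, h6, a, ha, by omega, hda, by simp⟩
    · exfalso
      have hB0 : A - a ≠ 0 := by intro h; rw [h, charDeg_zero] at dB; omega
      have hex : ∃ b ∈ IrrChar G, ip (A - a) b ≠ 0 ∧ 2 * charDeg b ≤ charDeg (A - a) := by
        by_contra hcon
        push Not at hcon
        exact h6 (hB.irr_of_small hB0 hcon)
      obtain ⟨b, hb, hneb, hdb⟩ := hex
      have hC := hB.peel hb hneb
      have dC := (irr_isChar hb).charDeg_sub hC
      have := hgeB b hb hneb
      have hCi : A - a - b ∈ IrrChar G := by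
        refine hC.irr_of_small (by intro h; rw [h, charDeg_zero] at dC; omega) fun c hc hnec => ?_
        have := hgeB c hc (sub_constituent hC (irr_isChar hb) hc hnec)
        omega
      have e1 := ht a ha hda
      have e2 := ht b hb (by omega)
      have e3 := ht _ hCi (by omega)
      apply hAt
      simp only [Pi.sub_apply] at e3
      linear_combination e1 + e2 + e3
  · push Not at h3
    by_cases h4 : ∃ a ∈ IrrChar G, ip A a ≠ 0 ∧ charDeg a = 4
    · obtain ⟨a, ha, hne, hda⟩ := h4
      have hB := hA.peel ha hne
      have dB := (irr_isChar ha).charDeg_sub hB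
      right; right
      refine ⟨A - a, hB.irr_of_small (by intro h; rw [h, charDeg_zero] at dB; omega) fun b hb h => ?_, a, ha,
        by omega, hda, by simp⟩
      have := hge b hb (sub_constituent hB (irr_isChar ha) hb h)
      omega
    · push Not at h4
      left
      refine hA.irr_of_small (by intro h; rw [h, charDeg_zero] at hd; omega) fun b hb h => ?_
      have := hge b hb h
      have := h3 b hb h
      have := h4 b hb h
      omega

theorem dec_prod (hG : commutator G = ⊤) (h2 : ∀ θ ∈ IrrChar G, charDeg θ ≠ 2) {t : G}
    (ht : ∀ φ ∈ IrrChar G, charDeg φ = 3 → φ t = -1) {θ η : G → ℂ} (hθ : θ ∈ IrrChar G) (hd : charDeg θ = 3)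
    (hη : η ∈ IrrChar G) (hd' : charDeg η = 3) (hne : θ ≠ dual η) :
    θ * η ∈ IrrChar G ∨ (∃ σ ∈ IrrChar G, ∃ κ ∈ IrrChar G, charDeg σ = 6 ∧ charDeg κ = 3 ∧ θ * η = σ + κ) ∨
      ∃ φ ∈ IrrChar G, ∃ ε ∈ IrrChar G, charDeg φ = 5 ∧ charDeg ε = 4 ∧ θ * η = φ + ε := by
  refine dec_nine hG h2 ht ((irr_isChar hθ).mul (irr_isChar hη)) ?_ ?_ ?_
  · rw [(irr_isChar hθ).charDeg_mul (irr_isChar hη), hd, hd']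
  · rw [ip_mul_left, mul_one, irr_ip_ne hθ (irr_dual hη) hne]
  · rw [Pi.mul_apply, ht θ hθ hd, ht η hη hd']
    norm_num

theorem nonreal_adj (hG : commutator G = ⊤) (h2 : ∀ θ ∈ IrrChar G, charDeg θ ≠ 2) {t : G}
    (ht : ∀ φ ∈ IrrChar G, charDeg φ = 3 → φ t = -1) {θ : G → ℂ} (hθ : θ ∈ IrrChar G) (hd : charDeg θ = 3)
    (hne : θ ≠ dual θ) : θ * dual θ - 1 ∈ IrrChar G := by
  refine mem_irr_iff.2 ⟨isChar_adj hθ, ?_⟩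
  have hn : ip (θ * dual θ) (θ * dual θ) = 2 := by
    rw [← ip_prod]
    have hcube := deg3_cube hG (irr_isChar hθ) hd
    have hdd : charDeg (dual θ) = 3 := by rw [charDeg_dual, hd]
    rcases dec_prod hG h2 ht hθ hd hθ hd hne with h | ⟨σ, hσ, κ, hκ, dσ, dκ, e⟩ | ⟨φ, hφ, ε, hε, dφ, dε, e⟩
    · exfalso
      apply hcube
      refine irr_ne_deg h (irr_dual hθ) ?_
      rw [(irr_isChar hθ).charDeg_mul (irr_isChar hθ), hdd, hd]; norm_num
    · rw [e, ip_add_left, ip_add_right, ip_add_right, irr_norm hσ, irr_norm hκ, irr_ne_deg hσ hκ (by omega),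
        irr_ne_deg hκ hσ (by omega)]
      norm_num
    · exfalso
      apply hcube
      rw [e, ip_add_left, irr_ne_deg hφ (irr_dual hθ) (by omega), irr_ne_deg hε (irr_dual hθ) (by omega), add_zero]
  have h1 : ip (θ * dual θ) 1 = 1 := by rw [ip_mul_left, dual_dual, mul_one, irr_norm hθ]
  rw [ip_sub_left, ip_sub_right, ip_sub_right, hn, ip_comm 1, h1, irr_norm irr_one]
  norm_num

theorem real_sq (hG : commutator G = ⊤) (h2 : ∀ θ ∈ IrrChar G, charDeg θ ≠ 2)
    {θ : G → ℂ} (hθ : θ ∈ IrrChar G) (hd : charDeg θ = 3)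
    (hr : dual θ = θ) : ∃ F ∈ IrrChar G, charDeg F = 5 ∧ θ * θ = 1 + θ + F := by
  have hcube := deg3_cube hG (irr_isChar hθ) hd
  rw [hr] at hcube
  have hadj := isChar_adj hθ
  have hone := adj_ip_one hθ
  have hdeg := adj_deg hθ
  rw [hr] at hadj hone hdeg
  have h1θ : ip 1 θ = 0 := irr_ne_deg irr_one hθ (by rw [charDeg_one, hd]; norm_num)
  have hF := hadj.peel hθ (by rw [ip_sub_left, h1θ, sub_zero]; exact hcube)
  have dF := (irr_isChar hθ).charDeg_sub hF
  rw [hd] at hdeg dF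
  refine ⟨_, hF.irr_of_small (by intro h; rw [h, charDeg_zero] at dF; omega) fun b hb h => ?_, by omega, by ring⟩
  have := cons_ge hG h2 hone hb (sub_constituent hF (irr_isChar hθ) hb h)
  omega

theorem prod_ge_four (hG : commutator G = ⊤) (h2 : ∀ θ ∈ IrrChar G, charDeg θ ≠ 2) {t : G}
    (ht : ∀ φ ∈ IrrChar G, charDeg φ = 3 → φ t = -1) {θ η : G → ℂ} (hθ : θ ∈ IrrChar G) (hd : charDeg θ = 3)
    (hη : η ∈ IrrChar G) (hd' : charDeg η = 3) : ∃ κ ∈ IrrChar G, 4 ≤ charDeg κ ∧ ip (θ * η) κ ≠ 0 := by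
  by_cases hne : θ = dual η
  · subst hne
    by_cases hr : dual η = η
    · obtain ⟨F, hF, dF, e⟩ := real_sq hG h2 hη hd' hr
      refine ⟨F, hF, by omega, ?_⟩
      rw [hr, e, ip_add_left, ip_add_left, irr_norm hF, irr_ne_deg irr_one hF (by rw [charDeg_one]; omega),
        irr_ne_deg hη hF (by omega)]
      norm_num
    · have h := nonreal_adj hG h2 ht hη hd' (Ne.symm hr)
      have hdeg := adj_deg hη
      rw [hd'] at hdeg
      refine ⟨_, h, by omega, ?_⟩
      have e : dual η * η = (η * dual η - 1) + 1 := by ring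
      rw [e, ip_add_left, irr_norm h, irr_ne_deg irr_one h (by rw [charDeg_one]; omega)]
      norm_num
  · rcases dec_prod hG h2 ht hθ hd hη hd' hne with h | ⟨σ, hσ, κ, hκ, dσ, dκ, e⟩ | ⟨φ, hφ, ε, hε, dφ, dε, e⟩
    · refine ⟨_, h, ?_, by rw [irr_norm h]; exact one_ne_zero⟩
      rw [(irr_isChar hθ).charDeg_mul (irr_isChar hη), hd, hd']; norm_num
    · refine ⟨σ, hσ, by omega, ?_⟩
      rw [e, ip_add_left, irr_norm hσ, irr_ne_deg hκ hσ (by omega)]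
      norm_num
    · refine ⟨φ, hφ, by omega, ?_⟩
      rw [e, ip_add_left, irr_norm hφ, irr_ne_deg hε hφ (by omega)]
      norm_num

theorem not_triv_of_cons {M : Subgroup G} [M.Normal] {ψ : G → ℂ} {η : M → ℂ} (hη : η ∈ IrrChar M)
    (h1 : η ≠ 1) (hne : ip (res M ψ) η ≠ 0) : ¬ Triv M ψ := by
  intro ht
  apply hne
  have e : res M ψ = ψ 1 • (1 : M → ℂ) := by
    ext m
    simpa [res] using ht m m.2
  rw [e, ip_smul_left, irr_ip_ne irr_one hη (Ne.symm h1)]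
  simp

theorem extend {M : Subgroup G} [M.Normal] {A : G → ℂ} (hA : IsChar A) {η : M → ℂ} (hη : η ∈ IrrChar M)
    (hne : ip (res M A) η ≠ 0) (hd : charDeg A < 2 * charDeg η) :
    ∃ ψ ∈ IrrChar G, ip A ψ ≠ 0 ∧ res M ψ = η := by
  obtain ⟨ψ, hψ, h1, h2⟩ := lift_constituent hA M hne
  refine ⟨ψ, hψ, h1, ((irr_isChar hψ).res M).eq_of_deg hη h2 ?_⟩
  have h3 := clifford_dvd hψ hη h2
  have h4 := hA.deg_le hψ h1
  have h5 := irr_pos hψ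
  obtain ⟨k, hk⟩ := h3
  rw [charDeg_res]
  have : k < 2 := by
    by_contra hk2
    push Not at hk2
    nlinarith
  interval_cases k <;> omega

theorem mem_NT_of_res {M : Subgroup G} [M.Normal] {ψ : G → ℂ} (hψ : IsChar ψ) (hr : res M ψ ∈ IrrChar M)
    (hd : 2 ≤ charDeg ψ) : ψ ∈ NT M := by
  refine mem_NT.2 ⟨irr_of_res hψ hr, not_triv_of_cons hr ?_ (by rw [irr_norm hr]; exact one_ne_zero)⟩
  intro h
  have := charDeg_res M ψ
  rw [h, charDeg_one] at this
  omega

theorem fam_disj {M : Subgroup G} [M.Normal] {D E : G → ℂ} (hD : res M D ∈ IrrChar M) (hE : res M E ∈ IrrChar M)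
    (hne : res M D ≠ res M E) : Disjoint (fam M D) (fam M E) := by
  rw [Finset.disjoint_left]
  intro ψ h1 h2
  obtain ⟨β, hβ, e1⟩ := mem_fam.1 h1
  obtain ⟨γ, hγ, e2⟩ := mem_fam.1 h2
  rw [mem_TR] at hβ hγ
  have key : ∀ {β : G → ℂ} (D : G → ℂ), Triv M β → res M (β * D) = β 1 • res M D := by
    intro β D h
    ext m
    have := h m m.2
    simp [res, this]
  have e3 := key D hβ.2
  have e4 := key E hγ.2
  rw [e1] at e3
  rw [e2, e3] at e4
  have e5 : ip (β 1 • res M D) (res M D) = ip (γ 1 • res M E) (res M D) := by rw [e4]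
  rw [ip_smul_left, ip_smul_left, irr_norm hD, irr_ip_ne hE hD (Ne.symm hne)] at e5
  have h3 := irr_pos hβ.1
  have h4 := (irr_isChar hβ.1).one_eq
  rw [h4] at e5
  simp at e5
  omega

end
end ACD

namespace ACD
open Matrix
section
variable {G : Type} [Group G] [Finite G]

/-- the characters of degree `d` lying over nontrivial characters of `M` -/
noncomputable def XD (M : Subgroup G) (d : ℕ) : Finset (G → ℂ) := by
  classical exact (NT M).filter (fun χ => charDeg χ = d)

theorem mem_XD {M : Subgroup G} {d : ℕ} {χ : G → ℂ} : χ ∈ XD M d ↔ χ ∈ NT M ∧ charDeg χ = d := by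
  classical
  simp [XD]

/-- the characters of degree at least four lying over nontrivial characters of `M` -/
noncomputable def YD (M : Subgroup G) : Finset (G → ℂ) := by
  classical exact (NT M).filter (fun χ => 4 ≤ charDeg χ)

theorem mem_YD {M : Subgroup G} {χ : G → ℂ} : χ ∈ YD M ↔ χ ∈ NT M ∧ 4 ≤ charDeg χ := by
  classical
  simp [YD]

theorem nt_split {M : Subgroup G} [M.Normal] (hM : commutator M = ⊤) (h2 : ∀ θ ∈ IrrChar M, charDeg θ ≠ 2) :
    ∑ χ ∈ Irr G, (5 * (charDeg χ : ℤ) - 16) = ∑ χ ∈ TR M, (5 * (charDeg χ : ℤ) - 16)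
      + ∑ χ ∈ YD M, (5 * (charDeg χ : ℤ) - 16) - (XD M 3).card := by
  classical
  have e : NT M = YD M ∪ XD M 3 := by
    ext χ
    rw [Finset.mem_union, mem_YD, mem_XD]
    constructor
    · intro h
      have := nt_ge hM h2 h
      rcases Nat.lt_or_ge (charDeg χ) 4 with h4 | h4
      · right; exact ⟨h, by omega⟩
      · left; exact ⟨h, h4⟩
    · rintro (h | h) <;> exact h.1
  have hd : Disjoint (YD M) (XD M 3) := by
    rw [Finset.disjoint_left]
    intro χ h1 h3
    rw [mem_YD] at h1
    rw [mem_XD] at h3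
    omega
  rw [sum_split M, e, Finset.sum_union hd]
  have e3 : ∑ χ ∈ XD M 3, (5 * (charDeg χ : ℤ) - 16) = ∑ χ ∈ XD M 3, (-1 : ℤ) :=
    Finset.sum_congr rfl fun χ hχ => by rw [(mem_XD.1 hχ).2]; norm_num
  rw [e3, Finset.sum_const]
  simp
  ring

theorem base {M : Subgroup G} [M.Normal] (hM : commutator M = ⊤) (h2 : ∀ θ ∈ IrrChar M, charDeg θ ≠ 2)
    {t : M} (ht : ∀ φ ∈ IrrChar M, charDeg φ = 3 → φ t = -1) {χ : G → ℂ} (hχ : χ ∈ NT M) (hd : charDeg χ = 3)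
    {S : Finset (G → ℂ)} (hS : S ⊆ NT M) (hS4 : ∀ ψ ∈ S, 4 ≤ charDeg ψ) :
    ∑ β ∈ TR M, (5 * (charDeg β : ℤ) - 16) + ∑ ψ ∈ S, (4 * (charDeg ψ : ℤ) - 16) ≤
      ∑ χ ∈ Irr G, (5 * (charDeg χ : ℤ) - 16) := by
  classical
  have hrχ := nt_res hM h2 hχ (by omega)
  have hχi := (mem_NT.1 hχ).1
  have hc := fiber_count (XD M 3) (YD M) (fun η hη => (mem_NT.1 (mem_XD.1 hη).1).1)
    (fun ψ hψ => irr_isChar (mem_NT.1 (mem_YD.1 hψ).1).1) (irr_isChar hχi).dual (fun η hη => by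
      rw [mem_XD] at hη
      have hηi := (mem_NT.1 hη.1).1
      have hrη := nt_res hM h2 hη.1 (by omega)
      obtain ⟨κ, hκ, hκ4, hne⟩ := prod_ge_four hM h2 ht hrχ hd hrη hη.2
      obtain ⟨ψ, hψ, h3, h4⟩ := lift_constituent ((irr_isChar hχi).mul (irr_isChar hηi)) M
        (η := κ) hne
      refine ⟨ψ, mem_YD.2 ⟨mem_NT.2 ⟨hψ, not_triv_of_cons hκ ?_ h4⟩, ?_⟩, ?_⟩
      · rintro rfl
        rw [charDeg_one] at hκ4
        omega
      · have := Nat.le_of_dvd (irr_pos hψ) (clifford_dvd hψ hκ h4)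
        omega
      · rw [ip_mul_left, dual_dual, ip_comm]
        exact h3) (c := 3) (fun η hη => by rw [(mem_XD.1 hη).2])
  rw [charDeg_dual, hd] at hc
  rw [nt_split hM h2]
  have e1 : ∑ ψ ∈ S, (4 * (charDeg ψ : ℤ) - 16) ≤ ∑ ψ ∈ YD M, (4 * (charDeg ψ : ℤ) - 16) := by
    refine Finset.sum_le_sum_of_subset_of_nonneg (fun ψ hψ => mem_YD.2 ⟨hS hψ, hS4 ψ hψ⟩) fun ψ hψ _ => ?_
    have := (mem_YD.1 hψ).2
    omega
  have e2 : ∑ ψ ∈ YD M, (5 * (charDeg ψ : ℤ) - 16) = ∑ ψ ∈ YD M, (4 * (charDeg ψ : ℤ) - 16) + ∑ ψ ∈ YD M, (charDeg ψ : ℤ) := by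
    rw [← Finset.sum_add_distrib]
    exact Finset.sum_congr rfl fun β _ => by ring
  have e3 : ((XD M 3).card : ℤ) ≤ ∑ ψ ∈ YD M, (charDeg ψ : ℤ) := by
    have : (XD M 3).card ≤ ∑ ψ ∈ YD M, charDeg ψ := by omega
    exact_mod_cast this
  linarith

theorem fam_ge {M : Subgroup G} [M.Normal] {D : G → ℂ} (hD : IsChar D) {ψ : G → ℂ} (hψ : ψ ∈ fam M D) :
    charDeg D ≤ charDeg ψ := by
  obtain ⟨β, hβ, rfl⟩ := mem_fam.1 hψ
  rw [mem_TR] at hβ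
  rw [(irr_isChar hβ.1).charDeg_mul hD]
  have := irr_pos hβ.1
  nlinarith

theorem case_B_one {M : Subgroup G} [M.Normal] (hM : commutator M = ⊤) (h2 : ∀ θ ∈ IrrChar M, charDeg θ ≠ 2)
    {t : M} (ht : ∀ φ ∈ IrrChar M, charDeg φ = 3 → φ t = -1) {χ : G → ℂ} (hχ : χ ∈ NT M) (hd : charDeg χ = 3)
    {D : G → ℂ} (hD : IsChar D) (hr : res M D ∈ IrrChar M) (h8 : 8 ≤ charDeg D) :
    0 ≤ ∑ χ ∈ Irr G, (5 * (charDeg χ : ℤ) - 16) := by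
  have hN := mem_NT_of_res hD hr (by omega)
  have h := base hM h2 ht hχ hd (fam_sub hN hr) (fun ψ hψ => by have := fam_ge hD hψ; omega)
  rw [fam_sum hD hr (fun d => 4 * (d : ℤ) - 16), ← Finset.sum_add_distrib] at h
  refine le_trans (Finset.sum_nonneg fun β hβ => ?_) h
  have := irr_pos (mem_TR.1 hβ).1
  push_cast
  have h9 : (8 : ℤ) ≤ charDeg D := by exact_mod_cast h8
  have h10 : (1 : ℤ) ≤ charDeg β := by exact_mod_cast this
  nlinarith

theorem case_B_two {M : Subgroup G} [M.Normal] (hM : commutator M = ⊤) (h2 : ∀ θ ∈ IrrChar M, charDeg θ ≠ 2)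
    {t : M} (ht : ∀ φ ∈ IrrChar M, charDeg φ = 3 → φ t = -1) {χ : G → ℂ} (hχ : χ ∈ NT M) (hd : charDeg χ = 3)
    {D E : G → ℂ} (hD : IsChar D) (hr : res M D ∈ IrrChar M) (h6 : charDeg D = 6)
    (hE : IsChar E) (hrE : res M E ∈ IrrChar M) (h5 : charDeg E = 5) :
    0 ≤ ∑ χ ∈ Irr G, (5 * (charDeg χ : ℤ) - 16) := by
  classical
  have hN := mem_NT_of_res hD hr (by omega)
  have hNE := mem_NT_of_res hE hrE (by omega)
  have hdis : Disjoint (fam M D) (fam M E) := fam_disj hr hrE fun h => by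
    have : charDeg (res M D) = charDeg (res M E) := by rw [h]
    rw [charDeg_res, charDeg_res] at this
    omega
  have h := base hM h2 ht hχ hd (Finset.union_subset (fam_sub hN hr) (fam_sub hNE hrE)) (fun ψ hψ => by
    rcases Finset.mem_union.1 hψ with hψ | hψ
    · have := fam_ge hD hψ; omega
    · have := fam_ge hE hψ; omega)
  rw [Finset.sum_union hdis, fam_sum hD hr (fun d => 4 * (d : ℤ) - 16), fam_sum hE hrE (fun d => 4 * (d : ℤ) - 16),
    ← Finset.sum_add_distrib, ← Finset.sum_add_distrib] at h
  refine le_trans (Finset.sum_nonneg fun β hβ => ?_) h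
  have := irr_pos (mem_TR.1 hβ).1
  rw [h5, h6]
  push_cast
  omega

theorem same_class {M : Subgroup G} [M.Normal] {χ χ' : G → ℂ} (hχ : IsChar χ) (hχ' : IsChar χ')
    (hr : res M χ ∈ IrrChar M) (he : res M χ' = res M χ) : ∃ l ∈ Lin G, χ' = l * χ := by
  obtain ⟨l, hl, h1, -, e⟩ := same_res hχ hχ' hr he
  exact ⟨l, mem_Lin.2 ⟨hl, h1⟩, e⟩

theorem class_card {M : Subgroup G} [M.Normal] {χ : G → ℂ} (hχ : IsChar χ) (hr : res M χ ∈ IrrChar M)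
    (S : Finset (G → ℂ)) (hS : ∀ ψ ∈ S, IsChar ψ ∧ res M ψ = res M χ) : S.card ≤ (Lin G).card := by
  classical
  have : S ⊆ (Lin G).image (fun l => l * χ) := by
    intro ψ hψ
    obtain ⟨l, hl, e⟩ := same_class hχ (hS ψ hψ).1 hr (hS ψ hψ).2
    exact Finset.mem_image.2 ⟨l, hl, e.symm⟩
  exact (Finset.card_le_card this).trans Finset.card_image_le

theorem res_lin {M : Subgroup G} [M.Normal] (hM : commutator M = ⊤) {l ψ : G → ℂ} (hl : l ∈ Lin G) :
    res M (l * ψ) = res M ψ := by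
  ext m
  have h1 := lin_triv hM hl m m.2
  have h3 := (irr_isChar (mem_Lin.1 hl).1).one_eq
  rw [(mem_Lin.1 hl).2] at h3
  simp [res, h1, h3]

/-- either two classes, or a single one -/
theorem XD_two {M : Subgroup G} [M.Normal] (hM : commutator M = ⊤) {d : ℕ} {φ ψ : G → ℂ} (hφ : φ ∈ XD M d)
    (hψ : ψ ∈ XD M d) (hrφ : res M φ ∈ IrrChar M) (hrψ : res M ψ ∈ IrrChar M) (hne : res M φ ≠ res M ψ) :
    2 * (Lin G).card ≤ (XD M d).card := by
  classical
  have hmem : ∀ l ∈ Lin G, ∀ η ∈ XD M d, l * η ∈ XD M d := by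
    intro l hl η hη
    rw [mem_XD] at hη ⊢
    have := lin_mul_NT hM hl hη.1
    exact ⟨this.1, this.2.trans hη.2⟩
  let A := (XD M d).filter (fun η => res M η = res M φ)
  let B := (XD M d).filter (fun η => res M η ≠ res M φ)
  have hA : (Lin G).card ≤ A.card := lin_orbit hM (irr_isChar (mem_NT.1 (mem_XD.1 hφ).1).1) hrφ A fun l hl =>
    Finset.mem_filter.2 ⟨hmem l hl φ hφ, res_lin hM hl⟩
  have hB : (Lin G).card ≤ B.card := lin_orbit hM (irr_isChar (mem_NT.1 (mem_XD.1 hψ).1).1) hrψ B fun l hl =>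
    Finset.mem_filter.2 ⟨hmem l hl ψ hψ, by rw [res_lin hM hl]; exact Ne.symm hne⟩
  have : A.card + B.card = (XD M d).card := Finset.card_filter_add_card_filter_not _
  omega

theorem XD_one {M : Subgroup G} [M.Normal] (hM : commutator M = ⊤) {d : ℕ} {φ : G → ℂ} (hφ : φ ∈ XD M d)
    (hrφ : res M φ ∈ IrrChar M) : (Lin G).card ≤ (XD M d).card :=
  lin_orbit hM (irr_isChar (mem_NT.1 (mem_XD.1 hφ).1).1) hrφ _ fun l hl => by
    rw [mem_XD] at hφ ⊢
    have := lin_mul_NT hM hl hφ.1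
    exact ⟨this.1, this.2.trans hφ.2⟩

end
end ACD

namespace ACD
open Matrix
section
variable {G : Type} [Group G] [Finite G]

theorem case_B_single {M : Subgroup G} [M.Normal] (hM : commutator M = ⊤) (h2 : ∀ θ ∈ IrrChar M, charDeg θ ≠ 2)
    {χ D : G → ℂ} (hχ : χ ∈ NT M) (hd : charDeg χ = 3) (hreal : dual (res M χ) = res M χ)
    (hD : D ∈ NT M) (hD5 : charDeg D = 5) (he : res M χ * res M χ = 1 + res M χ + res M D)
    (hall : ∀ η ∈ XD M 3, res M η = res M χ) :
    0 ≤ ∑ χ ∈ Irr G, (5 * (charDeg χ : ℤ) - 16) := by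
  classical
  have hDi := (mem_NT.1 hD).1
  have hχi := (mem_NT.1 hχ).1
  have hrD := nt_res hM h2 hD (by omega)
  have hrχ := nt_res hM h2 hχ (by omega)
  have dF : charDeg (res M D) = 5 := hD5
  have dθ : charDeg (res M χ) = 3 := hd
  obtain ⟨Q, hQ, hdis, hQ4, hQf⟩ := Q_lemma hM h2 hD hD5 (irr_isChar hχi) (by
    by_contra hcon
    push Not at hcon
    have hP := (irr_isChar hrD).mul (irr_isChar hrχ)
    have hip : ip (res M D * res M χ) (res M χ) = 1 := by
      rw [ip_mul_left, hreal, he, ip_add_right, ip_add_right, irr_norm hrD,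
        irr_ne_deg hrD irr_one (by rw [charDeg_one]; omega), irr_ne_deg hrD hrχ (by omega)]
      norm_num
    have hone : ip (res M D * res M χ) 1 = 0 := by
      rw [ip_mul_left, hreal, mul_one, irr_ne_deg hrD hrχ (by omega)]
    have hB := hP.peel hrχ (by rw [hip]; exact one_ne_zero)
    have dB := (irr_isChar hrχ).charDeg_sub hB
    rw [(irr_isChar hrD).charDeg_mul (irr_isChar hrχ), dF, dθ] at dB
    have h5 : 5 ∣ charDeg (res M D * res M χ - res M χ) := by
      refine hB.deg_dvd 5 fun η hη hne => ?_
      have hne' := sub_constituent hB (irr_isChar hrχ) hη hne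
      obtain ⟨ψ, hψ, h3, h4⟩ := lift_constituent ((irr_isChar hDi).mul (irr_isChar hχi)) M (η := η) hne'
      have hψN : ψ ∈ NT M := mem_NT.2 ⟨hψ, not_triv_of_cons hη (not_one_of_ip hone hne') h4⟩
      have h5 := nt_ge hM h2 hψN
      by_cases h6 : charDeg ψ = 3
      · exfalso
        have h7 := hall ψ (mem_XD.2 ⟨hψN, h6⟩)
        rw [h7] at h4
        have h8 := irr_eq_of_ip hrχ hη h4
        rw [← h8, ip_sub_left, hip, irr_norm hrχ, sub_self] at hne
        exact hne rfl
      · have hf : ψ ∈ fam M D := by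
          by_contra hf
          exact h3 (hcon ψ hψN hf (by omega))
        obtain ⟨β, hβ, e⟩ := mem_fam.1 hf
        rw [mem_TR] at hβ
        have e2 : res M ψ = β 1 • res M D := by
          rw [← e]
          ext m
          have := hβ.2 m m.2
          simp [res, this]
        rw [e2, ip_smul_left] at h4
        have h8 := irr_eq_of_ip hrD hη (fun h => h4 (by rw [h]; simp))
        rw [← h8, dF]
    omega)
  rw [nt_split hM h2]
  have hX : (XD M 3).card ≤ (Lin G).card := class_card (irr_isChar hχi) hrχ _ fun ψ hψ =>
    ⟨irr_isChar (mem_NT.1 (mem_XD.1 hψ).1).1, hall ψ hψ⟩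
  have e1 : ∑ χ ∈ fam M D, (5 * (charDeg χ : ℤ) - 16) + ∑ χ ∈ Q, (5 * (charDeg χ : ℤ) - 16)
      ≤ ∑ χ ∈ YD M, (5 * (charDeg χ : ℤ) - 16) := by
    rw [← Finset.sum_union hdis.symm]
    refine Finset.sum_le_sum_of_subset_of_nonneg (Finset.union_subset ?_ ?_) ?_
    · intro ψ hψ
      exact mem_YD.2 ⟨fam_sub hD hrD hψ, by have := fam_ge (irr_isChar hDi) hψ; omega⟩
    · intro ψ hψ
      exact mem_YD.2 ⟨hQ hψ, hQ4 ψ hψ⟩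
    · intro ψ hψ _
      have := (mem_YD.1 hψ).2
      omega
  rw [fam_sum (irr_isChar hDi) hrD (fun d => 5 * (d : ℤ) - 16), hD5] at e1
  have e2 := lin_bound hM (fun d => (5 * (d : ℤ) - 16) + (5 * ((d * 5 : ℕ) : ℤ) - 16)) (fun d hd => by push_cast; omega)
  rw [Finset.sum_add_distrib] at e2
  rw [hd] at hQf
  have hX' : ((XD M 3).card : ℤ) ≤ (Lin G).card := by exact_mod_cast hX
  push_cast at e1 e2 hQf
  rcases hQf with h | h <;> linarith [(Nat.cast_nonneg (Lin G).card : (0:ℤ) ≤ _)]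

/-- the counting inequality used when there are at least two classes of degree three -/
theorem count_many {M : Subgroup G} [M.Normal] (hM : commutator M = ⊤) (h2 : ∀ θ ∈ IrrChar M, charDeg θ ≠ 2)
    {D : G → ℂ} (hD : D ∈ NT M) (hD5 : charDeg D = 5) :
    9 * ((XD M 5).card : ℤ) + 4 * (XD M 4).card - 11 * (Lin G).card - (XD M 3).card ≤
      ∑ χ ∈ Irr G, (5 * (charDeg χ : ℤ) - 16) := by
  classical
  have hDi := (mem_NT.1 hD).1
  have hrD := nt_res hM h2 hD (by omega)
  rw [nt_split hM h2]
  let K : ℕ → ℤ := fun d => if d ≤ 5 then 0 else 5 * (d : ℤ) - 16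
  have e1 : ∑ χ ∈ YD M, (5 * (charDeg χ : ℤ) - 16) = ∑ χ ∈ YD M, K (charDeg χ) + 9 * ((XD M 5).card : ℤ) + 4 * (XD M 4).card := by
    have a5 : (XD M 5) = (YD M).filter (fun χ => charDeg χ = 5) := by
      ext χ
      rw [mem_XD, Finset.mem_filter, mem_YD]
      constructor
      · rintro ⟨h, h'⟩; exact ⟨⟨h, by omega⟩, h'⟩
      · rintro ⟨⟨h, _⟩, h'⟩; exact ⟨h, h'⟩
    have a4 : (XD M 4) = (YD M).filter (fun χ => charDeg χ = 4) := by
      ext χ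
      rw [mem_XD, Finset.mem_filter, mem_YD]
      constructor
      · rintro ⟨h, h'⟩; exact ⟨⟨h, by omega⟩, h'⟩
      · rintro ⟨⟨h, _⟩, h'⟩; exact ⟨h, h'⟩
    rw [a5, a4, Finset.card_filter, Finset.card_filter]
    push_cast
    rw [Finset.mul_sum, Finset.mul_sum, ← Finset.sum_add_distrib, ← Finset.sum_add_distrib]
    refine Finset.sum_congr rfl fun χ hχ => ?_
    have := (mem_YD.1 hχ).2
    simp only [K]
    split_ifs <;> omega
  have hK : ∀ d, 0 ≤ K d := by
    intro d
    simp only [K]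
    split_ifs <;> omega
  have e2 : ∑ χ ∈ fam M D, K (charDeg χ) ≤ ∑ χ ∈ YD M, K (charDeg χ) :=
    Finset.sum_le_sum_of_subset_of_nonneg (fun ψ hψ =>
      mem_YD.2 ⟨fam_sub hD hrD hψ, by have := fam_ge (irr_isChar hDi) hψ; omega⟩) fun ψ _ _ => hK _
  rw [fam_sum (irr_isChar hDi) hrD K, hD5] at e2
  have e3 := lin_bound hM (fun d => (5 * (d : ℤ) - 16) + K (d * 5)) (fun d hd => by
    have : ¬ d * 5 ≤ 5 := by omega
    simp only [K, this, if_false]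
    push_cast
    omega)
  rw [Finset.sum_add_distrib] at e3
  have e4 : K (1 * 5) = 0 := by simp [K]
  rw [e4] at e3
  push_cast at e3
  linarith

theorem case_B_many {M : Subgroup G} [M.Normal] (hM : commutator M = ⊤) (h2 : ∀ θ ∈ IrrChar M, charDeg θ ≠ 2)
    (hreal : ∀ χ ∈ XD M 3, dual (res M χ) = res M χ)
    (hprod : ∀ χ ∈ XD M 3, ∀ η ∈ XD M 3, res M χ ≠ res M η → ∃ φ ∈ XD M 5, ∃ ε ∈ XD M 4, χ * η = φ + ε)
    {χ η D : G → ℂ} (hχ : χ ∈ XD M 3) (hη : η ∈ XD M 3) (hne : res M χ ≠ res M η)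
    (hD : D ∈ XD M 5) (he : res M χ * res M χ = 1 + res M χ + res M D) :
    0 ≤ ∑ χ ∈ Irr G, (5 * (charDeg χ : ℤ) - 16) := by
  classical
  have irr : ∀ {d : ℕ} {ψ : G → ℂ}, ψ ∈ XD M d → ψ ∈ IrrChar G := fun h => (mem_NT.1 (mem_XD.1 h).1).1
  have ri : ∀ {d : ℕ} {ψ : G → ℂ}, d ≤ 5 → ψ ∈ XD M d → res M ψ ∈ IrrChar M := fun h5 h =>
    nt_res hM h2 (mem_XD.1 h).1 (by rw [(mem_XD.1 h).2]; exact h5)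
  have dg : ∀ {d : ℕ} {ψ : G → ℂ}, ψ ∈ XD M d → charDeg (res M ψ) = d := fun h => (mem_XD.1 h).2
  have r1 := ri (by norm_num) hχ
  have r5 := ri (by norm_num) hD
  have hcount := count_many hM h2 (mem_XD.1 hD).1 (mem_XD.1 hD).2
  refine le_trans ?_ hcount
  have sum5 : ∀ d, ∑ ψ ∈ XD M d, charDeg ψ = d * (XD M d).card := by
    intro d
    rw [Finset.sum_congr rfl fun ψ hψ => (mem_XD.1 hψ).2, Finset.sum_const, smul_eq_mul, mul_comm]
  have c5 := fiber_count (XD M 3) (XD M 5) (fun ψ hψ => irr hψ) (fun ψ hψ => irr_isChar (irr hψ))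
    (irr_isChar (irr hχ)).dual (fun κ hκ => by
      have hIP := (irr_isChar (irr hχ)).mul (irr_isChar (irr hκ))
      have key : ∃ ψ ∈ XD M 5, ip (χ * κ) ψ ≠ 0 := by
        by_cases hk : res M χ = res M κ
        · have h1 : ip (res M (χ * κ)) (res M D) ≠ 0 := by
            rw [res_mul, ← hk, he, ip_add_left, ip_add_left, irr_norm r5,
              irr_ne_deg irr_one r5 (by rw [charDeg_one, dg hD]; norm_num),
              irr_ne_deg r1 r5 (by rw [dg hχ, dg hD]; norm_num)]
            norm_num
          obtain ⟨ψ, hψ, h3, h4⟩ := extend hIP r5 h1 (by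
            rw [(irr_isChar (irr hχ)).charDeg_mul (irr_isChar (irr hκ)), (mem_XD.1 hχ).2, (mem_XD.1 hκ).2, dg hD]
            norm_num)
          have hdψ : charDeg ψ = 5 := by rw [← charDeg_res M ψ, h4, dg hD]
          exact ⟨ψ, mem_XD.2 ⟨mem_NT_of_res (irr_isChar hψ) (by rw [h4]; exact r5) (by omega), hdψ⟩, h3⟩
        · obtain ⟨φ, hφ, ε, hε, e⟩ := hprod χ hχ κ hκ hk
          refine ⟨φ, hφ, ?_⟩
          rw [e, ip_add_left, irr_norm (irr hφ), irr_ne_deg (irr hε) (irr hφ) (by rw [(mem_XD.1 hε).2, (mem_XD.1 hφ).2]; norm_num)]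
          norm_num
      obtain ⟨ψ, hψ, h3⟩ := key
      refine ⟨ψ, hψ, ?_⟩
      rw [ip_mul_left, dual_dual, ip_comm]
      exact h3) (c := 3) (fun κ hκ => by rw [(mem_XD.1 hκ).2])
  let X' := (XD M 3).filter (fun κ => ¬ res M κ = res M χ)
  let X1 := (XD M 3).filter (fun κ => res M κ = res M χ)
  have c4 := fiber_count X' (XD M 4) (fun ψ hψ => irr (Finset.mem_filter.1 hψ).1) (fun ψ hψ => irr_isChar (irr hψ))
    (irr_isChar (irr hχ)).dual (fun κ hκ => by
      rw [Finset.mem_filter] at hκ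
      obtain ⟨φ, hφ, ε, hε, e⟩ := hprod χ hχ κ hκ.1 (Ne.symm hκ.2)
      refine ⟨ε, hε, ?_⟩
      rw [ip_mul_left, dual_dual, ip_comm]
      rw [e, ip_add_left, irr_norm (irr hε), irr_ne_deg (irr hφ) (irr hε) (by rw [(mem_XD.1 hε).2, (mem_XD.1 hφ).2]; norm_num)]
      norm_num) (c := 3) (fun κ hκ => by rw [(mem_XD.1 (Finset.mem_filter.1 hκ).1).2])
  have hX1 : X1.card ≤ (Lin G).card := class_card (irr_isChar (irr hχ)) r1 _ fun ψ hψ =>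
    ⟨irr_isChar (irr (Finset.mem_filter.1 hψ).1), (Finset.mem_filter.1 hψ).2⟩
  have hXX : X1.card + X'.card = (XD M 3).card := Finset.card_filter_add_card_filter_not _
  rw [sum5, charDeg_dual, (mem_XD.1 hχ).2] at c5 c4
  suffices h : 11 * (Lin G).card + (XD M 3).card ≤ 9 * (XD M 5).card + 4 * (XD M 4).card by omega
  obtain ⟨φ, hφ, ε, hε, e12⟩ := hprod χ hχ η hη hne
  have o5 := XD_one hM hφ (ri (by norm_num) hφ)
  have o4 := XD_one hM hε (ri (by norm_num) hε)
  by_cases t5 : ∃ φ' ∈ XD M 5, res M φ ≠ res M φ'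
  · obtain ⟨φ', hφ', h⟩ := t5
    have := XD_two hM hφ hφ' (ri (by norm_num) hφ) (ri (by norm_num) hφ') h
    omega
  push Not at t5
  have s5 : (XD M 5).card ≤ (Lin G).card := class_card (irr_isChar (irr hφ)) (ri (by norm_num) hφ) _ fun ψ hψ =>
    ⟨irr_isChar (irr hψ), (t5 ψ hψ).symm⟩
  by_cases t4 : ∃ ε' ∈ XD M 4, res M ε ≠ res M ε'
  · obtain ⟨ε', hε', h⟩ := t4
    have := XD_two hM hε hε' (ri (by norm_num) hε) (ri (by norm_num) hε') h
    omega
  push Not at t4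
  have hX2 : X'.card ≤ (Lin G).card := by
    refine class_card (irr_isChar (irr hη)) (ri (by norm_num) hη) _ fun κ hκ => ?_
    rw [Finset.mem_filter] at hκ
    refine ⟨irr_isChar (irr hκ.1), ?_⟩
    by_contra hcon
    obtain ⟨φ2, hφ2, ε2, hε2, e13⟩ := hprod χ hχ κ hκ.1 (Ne.symm hκ.2)
    obtain ⟨φ3, hφ3, ε3, hε3, e23⟩ := hprod η hη κ hκ.1 (Ne.symm hcon)
    have e12' := congrArg (res M) e12
    have e13' := congrArg (res M) e13
    have e23' := congrArg (res M) e23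
    rw [res_mul, res_add] at e12' e13' e23'
    rw [← t5 _ hφ2, ← t4 _ hε2] at e13'
    rw [← t5 _ hφ3, ← t4 _ hε3] at e23'
    rw [← t5 _ hD] at he
    have rφ := ri (by norm_num) hφ
    have rε := ri (by norm_num) hε
    have z1 : ip (res M φ) (res M ε) = 0 := irr_ne_deg rφ rε (by rw [dg hφ, dg hε]; norm_num)
    have z2 : ip (res M χ) (res M ε) = 0 := irr_ne_deg r1 rε (by rw [dg hχ, dg hε]; norm_num)
    have z3 : ip (res M χ) (res M φ) = 0 := irr_ne_deg r1 rφ (by rw [dg hχ, dg hφ]; norm_num)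
    have z4 : ip 1 (res M φ) = 0 := irr_ne_deg irr_one rφ (by rw [dg hφ, charDeg_one]; norm_num)
    have z5 : ip 1 (res M ε) = 0 := irr_ne_deg irr_one rε (by rw [dg hε, charDeg_one]; norm_num)
    have q1 : ip (res M χ * res M η) (res M χ * res M κ) = 2 := by
      rw [e12', e13', ip_add_left, ip_add_right, ip_add_right, irr_norm rφ, irr_norm rε, z1, ip_comm, z1]
      norm_num
    have q2 : ip (res M χ * res M η) (res M χ * res M κ) = ip (res M χ * res M χ) (res M η * res M κ) := by
      rw [ip_mul_left, hreal η hη, mul_comm (res M χ) (res M κ), ← mul_assoc, ip_mul_right, hreal χ hχ]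
    rw [q2, he, e23'] at q1
    simp only [ip_add_left, ip_add_right, irr_norm rφ, z1, z2, z3, z4, z5] at q1
    norm_num at q1
  omega

theorem case_B {M : Subgroup G} [M.Normal] (hM : commutator M = ⊤) (h2 : ∀ θ ∈ IrrChar M, charDeg θ ≠ 2)
    {t : M} (ht : ∀ φ ∈ IrrChar M, charDeg φ = 3 → φ t = -1) {χ : G → ℂ} (hχN : χ ∈ NT M) (hd : charDeg χ = 3) :
    0 ≤ ∑ χ ∈ Irr G, (5 * (charDeg χ : ℤ) - 16) := by
  classical
  have irr : ∀ {d : ℕ} {ψ : G → ℂ}, ψ ∈ XD M d → ψ ∈ IrrChar G := fun h => (mem_NT.1 (mem_XD.1 h).1).1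
  have ri : ∀ {d : ℕ} {ψ : G → ℂ}, d ≤ 5 → ψ ∈ XD M d → res M ψ ∈ IrrChar M := fun h5 h =>
    nt_res hM h2 (mem_XD.1 h).1 (by rw [(mem_XD.1 h).2]; exact h5)
  have dg : ∀ {d : ℕ} {ψ : G → ℂ}, ψ ∈ XD M d → charDeg (res M ψ) = d := fun h => (mem_XD.1 h).2
  have hχ : χ ∈ XD M 3 := mem_XD.2 ⟨hχN, hd⟩
  by_cases hreal : ∃ η ∈ XD M 3, dual (res M η) ≠ res M η
  · obtain ⟨η, hη, hne⟩ := hreal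
    have h8 := nonreal_adj hM h2 ht (ri (by norm_num) hη) (dg hη) (Ne.symm hne)
    have hdeg := adj_deg (irr hη)
    rw [(mem_XD.1 hη).2] at hdeg
    exact case_B_one hM h2 ht hχN hd (D := η * dual η - 1) (isChar_adj (irr hη)) h8 (by omega)
  push Not at hreal
  have hsq : ∃ D ∈ XD M 5, res M χ * res M χ = 1 + res M χ + res M D := by
    obtain ⟨F, hF, dF, e⟩ := real_sq hM h2 (ri (by norm_num) hχ) (dg hχ) (hreal χ hχ)
    have h1 : ip (res M (χ * χ)) F ≠ 0 := by
      rw [res_mul, e, ip_add_left, ip_add_left, irr_norm hF,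
        irr_ne_deg irr_one hF (by rw [charDeg_one]; omega),
        irr_ne_deg (ri (by norm_num) hχ) hF (by rw [dg hχ]; omega)]
      norm_num
    obtain ⟨ψ, hψ, h3, h4⟩ := extend ((irr_isChar (irr hχ)).mul (irr_isChar (irr hχ))) hF h1 (by
      rw [(irr_isChar (irr hχ)).charDeg_mul (irr_isChar (irr hχ)), hd, dF]
      norm_num)
    have hdψ : charDeg ψ = 5 := by rw [← charDeg_res M ψ, h4, dF]
    exact ⟨ψ, mem_XD.2 ⟨mem_NT_of_res (irr_isChar hψ) (by rw [h4]; exact hF) (by omega), hdψ⟩, by rw [h4, e]⟩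
  obtain ⟨D, hD, he⟩ := hsq
  by_cases hall : ∀ η ∈ XD M 3, res M η = res M χ
  · exact case_B_single hM h2 hχN hd (hreal χ hχ) (mem_XD.1 hD).1 (mem_XD.1 hD).2 he hall
  push Not at hall
  obtain ⟨η, hη, hne⟩ := hall
  by_cases hprod : ∀ χ ∈ XD M 3, ∀ η ∈ XD M 3, res M χ ≠ res M η → ∃ φ ∈ XD M 5, ∃ ε ∈ XD M 4, χ * η = φ + ε
  · exact case_B_many hM h2 hreal hprod hχ hη (Ne.symm hne) hD he
  push Not at hprod
  obtain ⟨α, hα, κ, hκ, hne2, hcon⟩ := hprod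
  have hIP := (irr_isChar (irr hα)).mul (irr_isChar (irr hκ))
  have dIP : charDeg (α * κ) = 9 := by
    rw [(irr_isChar (irr hα)).charDeg_mul (irr_isChar (irr hκ)), (mem_XD.1 hα).2, (mem_XD.1 hκ).2]
  rcases dec_prod hM h2 ht (ri (by norm_num) hα) (dg hα) (ri (by norm_num) hκ) (dg hκ)
    (by rw [hreal κ hκ]; exact hne2) with h | ⟨σ, hσ, μ, hμ, dσ, dμ, e⟩ | ⟨φ, hφ, ε, hε, dφ, dε, e⟩
  · exact case_B_one hM h2 ht hχN hd hIP h (by omega)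
  · have h1 : ip (res M (α * κ)) σ ≠ 0 := by
      rw [res_mul, e, ip_add_left, irr_norm hσ, irr_ne_deg hμ hσ (by omega)]
      norm_num
    obtain ⟨ψ, hψ, h3, h4⟩ := extend hIP hσ h1 (by omega)
    have hdψ : charDeg ψ = 6 := by rw [← charDeg_res M ψ, h4, dσ]
    exact case_B_two hM h2 ht hχN hd (irr_isChar hψ) (by rw [h4]; exact hσ) hdψ (irr_isChar (irr hD))
      (ri (by norm_num) hD) (mem_XD.1 hD).2
  · exfalso
    have h1 : ip (res M (α * κ)) φ ≠ 0 := by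
      rw [res_mul, e, ip_add_left, irr_norm hφ, irr_ne_deg hε hφ (by omega)]
      norm_num
    obtain ⟨ψ, hψ, h3, h4⟩ := extend hIP hφ h1 (by omega)
    have hdψ : charDeg ψ = 5 := by rw [← charDeg_res M ψ, h4, dφ]
    have hB := hIP.peel hψ h3
    have dB := (irr_isChar hψ).charDeg_sub hB
    have hrB : res M (α * κ - ψ) = ε := by
      rw [res_sub, res_mul, e, h4]
      simp
    refine hcon ψ (mem_XD.2 ⟨mem_NT_of_res (irr_isChar hψ) (by rw [h4]; exact hφ) (by omega), hdψ⟩) (α * κ - ψ)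
      (mem_XD.2 ⟨mem_NT_of_res hB (by rw [hrB]; exact hε) (by omega), by omega⟩) ?_
    ring

end
end ACD

namespace ACD
open Matrix
section

theorem main_aux (n : ℕ) : ∀ (G : Type) [Group G] [Finite G], Nat.card G = n → ¬ Group.IsSolvable G →
    0 ≤ ∑ χ ∈ Irr G, (5 * (charDeg χ : ℤ) - 16) := by
  induction n using Nat.strong_induction_on with
  | _ n ih =>
  intro G _ _ hn hs
  classical
  obtain ⟨N, hNn, hN0, hN⟩ := residual hs
  obtain ⟨M, hMn, hmin, hMN⟩ := exists_min N hNn hN0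
  by_cases hM : ∀ a b : M, a * b = b * a
  · have h1 := case_abelian hN hMN hM hmin
    have hlt : Nat.card (G ⧸ M) < n := by
      have h2 := Subgroup.card_eq_card_quotient_mul_card_subgroup M
      have h3 : 1 < Nat.card M := by
        rw [Subgroup.one_lt_card_iff_ne_bot]
        exact hmin.1
      have h4 : 0 < Nat.card (G ⧸ M) := Nat.card_pos
      nlinarith
    have hq : ¬ Group.IsSolvable (G ⧸ M) := by
      intro hq
      apply hs
      have hMs : Group.IsSolvable M := Group.isSolvable_of_comm hM
      exact Group.isSolvable_of_ker_le_range M.subtype (QuotientGroup.mk' M) (by simp)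
    have h5 := ih _ hlt (G ⧸ M) rfl hq
    rw [sum_quotient (fun d => 5 * (d : ℤ) - 16)] at h5
    rw [sum_split M]
    have h6 : 0 ≤ ∑ χ ∈ TR M, (5 * (charDeg χ : ℤ) - 16) := by
      convert h5 using 1
      rw [TR]
    linarith
  · obtain ⟨hP, hZ⟩ := min_perfect hmin hM
    have h2 : ∀ θ ∈ IrrChar M, charDeg θ ≠ 2 := fun θ hθ => no_two hmin hP hZ hθ
    by_cases h3 : ∃ χ ∈ NT M, charDeg χ = 3
    · obtain ⟨χ, hχ, hd⟩ := h3
      obtain ⟨t, ht⟩ := min_invol hmin hP hZ (mem_NT.1 hχ).1 (mem_NT.1 hχ).2 hd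
      exact case_B hP h2 ht hχ hd
    · push Not at h3
      exact case_A hmin hP h2 h3

theorem main_thm (G : Type) [Group G] [Finite G] (h : acd G < 16 / 5) : Group.IsSolvable G := by
  by_contra hs
  have h1 := main_aux _ G rfl hs
  have e : {χ ∈ IrrChar G | True} = ((Irr G : Finset (G → ℂ)) : Set (G → ℂ)) := by
    ext χ; simp
  rw [acd, acdRel, e, Set.ncard_coe_finset, finsum_mem_coe_finset] at h
  have hpos : 0 < (Irr G).card := Finset.card_pos.2 ⟨1, mem_Irr.2 irr_one⟩
  have hpos' : (0 : ℝ) < (Irr G).card := by exact_mod_cast hpos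
  rw [div_lt_div_iff₀ hpos' (by norm_num)] at h
  rw [Finset.sum_sub_distrib, ← Finset.mul_sum, Finset.sum_const, nsmul_eq_mul] at h1
  have h2 : (0 : ℝ) ≤ 5 * ∑ χ ∈ Irr G, (charDeg χ : ℝ) - (Irr G).card * 16 := by exact_mod_cast h1
  linarith

end
end ACD

/-- If the average of the degrees of the irreducible complex characters of a
finite group `G` is strictly less than `16/5`, then `G` is solvable. -/
theorem avg_char_degree_lt_sixteen_fifths_solvable (G : Type) [Group G] [Finite G]
    (h : acd G < 16 / 5) : IsSolvable G := by
  exact ACD.main_thm G h
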